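/- (Puig) Suppose α ∈ ℝ is Diophantine and λ > 0 with λ ≠ 1. Then for every ω ∈ ℝ, the spectrum of the almost Mathieu operator H^{λ,α}_ω is a Cantor set: it is closed, has no isolated points, and has empty interior in ℝ. -/

import Mathlib

/-- An irrational `α` is Diophantine if there are `c > 0` and `r > 1` with
`|sin(2πnα)| > c/|n|^r` for every nonzero integer `n`. -/
def IsDiophantine (α : ℝ) : Prop :=
  Irrational α ∧ ∃ c > (0 : ℝ), ∃ r > (1 : ℝ),
    ∀ n : ℤ, n ≠ 0 → c / |(n : ℝ)| ^ r < |Real.sin (2 * Real.pi * n * α)|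

namespace AlmostMathieu
open Filter Topology

/-- The character `x ↦ exp (2πix)`. -/
noncomputable def e (x : ℝ) : ℂ := Complex.exp (((2 * Real.pi * x : ℝ) : ℂ) * Complex.I)

lemma e_add (x y : ℝ) : e (x + y) = e x * e y := by
  rw [e, e, e, ← Complex.exp_add]; congr 1; push_cast; ring

lemma e_zero : e 0 = 1 := by simp [e]

lemma norm_e (x : ℝ) : ‖e x‖ = 1 := Complex.norm_exp_ofReal_mul_I _

lemma e_neg (x : ℝ) : e (-x) = (starRingEnd ℂ) (e x) := by
  rw [e, e, ← Complex.exp_conj, map_mul, Complex.conj_ofReal, Complex.conj_I]; congr 1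
  push_cast; ring

lemma e_int (n : ℤ) : e n = 1 := by
  rw [e, Complex.exp_eq_one_iff]; exact ⟨n, by push_cast; ring⟩

lemma e_nat_mul (n : ℕ) (x : ℝ) : e (n * x) = e x ^ n := by
  rw [e, e, ← Complex.exp_nat_mul]; congr 1; push_cast; ring

lemma e_eq_one {x : ℝ} (h : e x = 1) : ∃ n : ℤ, x = n := by
  rw [e, Complex.exp_eq_one_iff] at h
  obtain ⟨n, hn⟩ := h
  refine ⟨n, ?_⟩
  have h2 : ((2 * Real.pi * x : ℝ) : ℂ) = ((2 * Real.pi * n : ℝ) : ℂ) := by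
    apply mul_right_cancel₀ Complex.I_ne_zero
    rw [hn]; push_cast; ring
  have h3 := Complex.ofReal_injective h2
  have : (2 * Real.pi) ≠ 0 := by positivity
  exact mul_left_cancel₀ this h3

lemma e_re (x : ℝ) : (e x).re = Real.cos (2 * Real.pi * x) := by
  rw [e, Complex.exp_ofReal_mul_I_re]

lemma e_im (x : ℝ) : (e x).im = Real.sin (2 * Real.pi * x) := by
  rw [e, Complex.exp_ofReal_mul_I_im]

lemma e_add_e_neg (x : ℝ) : e x + e (-x) = ((2 * Real.cos (2 * Real.pi * x) : ℝ) : ℂ) := by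
  rw [e_neg, Complex.add_conj, e_re]

lemma continuous_e : Continuous e := by unfold e; fun_prop

lemma e_mul_ne_one {α : ℝ} (hα : Irrational α) {m : ℤ} (hm : m ≠ 0) : e (m * α) ≠ 1 := by
  intro h
  obtain ⟨n, hn⟩ := e_eq_one h
  exact (hα.intCast_mul hm).ne_int n hn

lemma norm_sum_e_le {α : ℝ} (hα : Irrational α) {m : ℤ} (hm : m ≠ 0) :
    ∃ C : ℝ, ∀ (x : ℝ) (N : ℕ), ‖∑ n ∈ Finset.range N, e (m * (x + n * α))‖ ≤ C := by
  have h1 : e (m * α) ≠ 1 := e_mul_ne_one hα hm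
  refine ⟨2 / ‖e (m * α) - 1‖, fun x N => ?_⟩
  have : ∑ n ∈ Finset.range N, e (m * (x + n * α)) =
      e (m * x) * ∑ n ∈ Finset.range N, e (m * α) ^ n := by
    rw [Finset.mul_sum]
    refine Finset.sum_congr rfl fun n _ => ?_
    rw [← e_nat_mul, ← e_add]; congr 1; ring
  rw [this, geom_sum_eq h1, norm_mul, norm_e, one_mul, norm_div]
  gcongr
  calc ‖e (m * α) ^ N - 1‖ ≤ ‖e (m * α) ^ N‖ + ‖(1 : ℂ)‖ := norm_sub_le _ _
    _ = 2 := by rw [norm_pow, norm_e]; norm_num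

/-- Uniform convergence of Birkhoff averages of `f` along the rotation by `α`. -/
def UnifAvg (α : ℝ) (f : C(AddCircle (1 : ℝ), ℂ)) (A : ℂ) : Prop :=
  ∀ ε > (0 : ℝ), ∃ N₀ : ℕ, ∀ N ≥ N₀, ∀ x : ℝ,
    ‖∑ n ∈ Finset.range N, f ((x + n * α : ℝ) : AddCircle (1 : ℝ)) - N * A‖ ≤ ε * N

lemma UnifAvg.add {α : ℝ} {f g : C(AddCircle (1 : ℝ), ℂ)} {A B : ℂ} (hf : UnifAvg α f A)
    (hg : UnifAvg α g B) : UnifAvg α (f + g) (A + B) := by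
  intro ε hε
  obtain ⟨N₁, h₁⟩ := hf (ε / 2) (by positivity)
  obtain ⟨N₂, h₂⟩ := hg (ε / 2) (by positivity)
  refine ⟨max N₁ N₂, fun N hN x => ?_⟩
  have e1 := h₁ N (le_trans (le_max_left _ _) hN) x
  have e2 := h₂ N (le_trans (le_max_right _ _) hN) x
  simp only [ContinuousMap.add_apply, Finset.sum_add_distrib]
  calc _ = ‖(∑ n ∈ Finset.range N, f ((x + n * α : ℝ) : AddCircle (1 : ℝ)) - N * A) +
      (∑ n ∈ Finset.range N, g ((x + n * α : ℝ) : AddCircle (1 : ℝ)) - N * B)‖ := by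
        congr 1; ring
    _ ≤ _ := norm_add_le _ _
    _ ≤ ε / 2 * N + ε / 2 * N := add_le_add e1 e2
    _ = _ := by ring

lemma UnifAvg.smul {α : ℝ} {f : C(AddCircle (1 : ℝ), ℂ)} {A : ℂ} (c : ℂ)
    (hf : UnifAvg α f A) : UnifAvg α (c • f) (c * A) := by
  intro ε hε
  obtain ⟨N₁, h₁⟩ := hf (ε / (‖c‖ + 1)) (by positivity)
  refine ⟨N₁, fun N hN x => ?_⟩
  have e1 := h₁ N hN x
  simp only [ContinuousMap.smul_apply, smul_eq_mul, ← Finset.mul_sum]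
  calc _ = ‖c * (∑ n ∈ Finset.range N, f ((x + n * α : ℝ) : AddCircle (1 : ℝ)) - N * A)‖ := by
        congr 1; ring
    _ ≤ (‖c‖ + 1) * (ε / (‖c‖ + 1) * N) := by
        rw [norm_mul]; gcongr; linarith
    _ = _ := by field_simp

lemma unifAvg_fourier {α : ℝ} (hα : Irrational α) (m : ℤ) :
    ∃ A, UnifAvg α (fourier m) A := by
  have hf : ∀ y : ℝ, (fourier m : C(AddCircle (1 : ℝ), ℂ)) (y : AddCircle (1 : ℝ)) = e (m * y) := by
    intro y
    rw [fourier_coe_apply, e]; congr 1; push_cast; ring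
  by_cases hm : m = 0
  · refine ⟨1, fun ε hε => ⟨0, fun N _ x => ?_⟩⟩
    subst hm
    simp only [fourier_zero, Finset.sum_const, Finset.card_range, nsmul_eq_mul, mul_one, sub_self,
      norm_zero]
    positivity
  · obtain ⟨C, hC⟩ := norm_sum_e_le hα hm
    refine ⟨0, fun ε hε => ⟨⌈C / ε⌉₊, fun N hN x => ?_⟩⟩
    simp only [hf, mul_zero, sub_zero]
    refine (hC x N).trans ?_
    have : C / ε ≤ N := Nat.ceil_le.mp hN
    rwa [div_le_iff₀' hε] at this

lemma UnifAvg.norm_sub_le {α : ℝ} {f g : C(AddCircle (1 : ℝ), ℂ)} {A B : ℂ} (hf : UnifAvg α f A)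
    (hg : UnifAvg α g B) : ‖A - B‖ ≤ ‖f - g‖ := by
  refine le_of_forall_pos_le_add fun ε hε => ?_
  obtain ⟨N₁, h₁⟩ := hf (ε / 2) (by positivity)
  obtain ⟨N₂, h₂⟩ := hg (ε / 2) (by positivity)
  set N := max (max N₁ N₂) 1 with hN
  have e1 := h₁ N (by omega) 0
  have e2 := h₂ N (by omega) 0
  have hNpos : (0 : ℝ) < N := by
    have : 1 ≤ N := by omega
    exact_mod_cast this
  have e3 : ‖∑ n ∈ Finset.range N, (f - g) ((0 + n * α : ℝ) : AddCircle (1 : ℝ))‖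
      ≤ N * ‖f - g‖ := by
    refine (norm_sum_le _ _).trans ?_
    calc _ ≤ ∑ n ∈ Finset.range N, ‖f - g‖ := Finset.sum_le_sum fun n _ =>
          ContinuousMap.norm_coe_le_norm _ _
      _ = _ := by simp
  have e4 : N * ‖A - B‖ ≤ N * (‖f - g‖ + ε) := by
    calc N * ‖A - B‖ = ‖(N : ℂ) * (A - B)‖ := by simp
      _ = ‖(∑ n ∈ Finset.range N, (f - g) ((0 + n * α : ℝ) : AddCircle (1 : ℝ)))
          - (∑ n ∈ Finset.range N, f ((0 + n * α : ℝ) : AddCircle (1 : ℝ)) - N * A)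
          + (∑ n ∈ Finset.range N, g ((0 + n * α : ℝ) : AddCircle (1 : ℝ)) - N * B)‖ := by
          congr 1
          simp only [ContinuousMap.sub_apply, Finset.sum_sub_distrib]; ring
      _ ≤ N * ‖f - g‖ + ε / 2 * N + ε / 2 * N :=
          (norm_add_le _ _).trans (add_le_add ((_root_.norm_sub_le _ _).trans (add_le_add e3 e1)) e2)
      _ = _ := by ring
  exact le_of_mul_le_mul_left e4 hNpos

lemma exists_unifAvg {α : ℝ} (hα : Irrational α) (f : C(AddCircle (1 : ℝ), ℂ)) :
    ∃ A, UnifAvg α f A := by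
  let S : Submodule ℂ C(AddCircle (1 : ℝ), ℂ) :=
    { carrier := {f | ∃ A, UnifAvg α f A}
      add_mem' := fun ⟨A, hA⟩ ⟨B, hB⟩ => ⟨A + B, hA.add hB⟩
      zero_mem' := ⟨0, fun ε hε => ⟨0, fun N _ x => by simp; positivity⟩⟩
      smul_mem' := fun c _ ⟨A, hA⟩ => ⟨c * A, hA.smul c⟩ }
  have hS : S.topologicalClosure = ⊤ := by
    rw [eq_top_iff, ← span_fourier_closure_eq_top]
    apply Submodule.topologicalClosure_mono
    rw [Submodule.span_le]
    rintro _ ⟨m, rfl⟩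
    exact unifAvg_fourier hα m
  have hf : f ∈ closure (S : Set C(AddCircle (1 : ℝ), ℂ)) := by
    rw [← Submodule.topologicalClosure_coe, hS]; trivial
  obtain ⟨g, hg, hgf⟩ := mem_closure_iff_seq_limit.mp hf
  choose A hA using hg
  have hcau : CauchySeq A := by
    rw [Metric.cauchySeq_iff]
    intro ε hε
    obtain ⟨N, hN⟩ := Metric.cauchySeq_iff.mp hgf.cauchySeq ε hε
    refine ⟨N, fun m hm n hn => ?_⟩
    have := hN m hm n hn
    rw [dist_eq_norm] at this ⊢
    exact ((hA m).norm_sub_le (hA n)).trans_lt this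
  obtain ⟨B, hB⟩ := cauchySeq_tendsto_of_complete hcau
  refine ⟨B, fun ε hε => ?_⟩
  obtain ⟨k, hk1, hk2⟩ := ((Metric.tendsto_nhds.mp hgf (ε / 3) (by positivity)).and
    (Metric.tendsto_nhds.mp hB (ε / 3) (by positivity))).exists
  obtain ⟨N₀, hN₀⟩ := hA k (ε / 3) (by positivity)
  refine ⟨N₀, fun N hN x => ?_⟩
  rw [dist_eq_norm] at hk1 hk2
  have e3 : ‖∑ n ∈ Finset.range N, (g k - f) ((x + n * α : ℝ) : AddCircle (1 : ℝ))‖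
      ≤ N * (ε / 3) := by
    refine (norm_sum_le _ _).trans ?_
    calc _ ≤ ∑ n ∈ Finset.range N, ε / 3 := Finset.sum_le_sum fun n _ =>
          (ContinuousMap.norm_coe_le_norm _ _).trans hk1.le
      _ = _ := by simp
  have e4 : ‖(N : ℂ) * (A k - B)‖ ≤ N * (ε / 3) := by
    rw [norm_mul, Complex.norm_natCast]; gcongr
  calc _ = ‖(∑ n ∈ Finset.range N, (g k) ((x + n * α : ℝ) : AddCircle (1 : ℝ)) - N * A k)
          - (∑ n ∈ Finset.range N, (g k - f) ((x + n * α : ℝ) : AddCircle (1 : ℝ)))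
          + (N : ℂ) * (A k - B)‖ := by
          congr 1
          simp only [ContinuousMap.sub_apply, Finset.sum_sub_distrib]; ring
    _ ≤ ε / 3 * N + N * (ε / 3) + N * (ε / 3) :=
          (norm_add_le _ _).trans (add_le_add ((_root_.norm_sub_le _ _).trans
            (add_le_add (hN₀ N hN x) e3)) e4)
    _ = _ := by ring

/-- Birkhoff averages of a continuous periodic function along an irrational rotation converge
uniformly. -/
theorem exists_uniform_average {α : ℝ} (hα : Irrational α) {g : ℝ → ℝ} (hg : Continuous g)
    (hper : Function.Periodic g 1) :
    ∃ A : ℝ, ∀ ε > (0 : ℝ), ∃ N₀ : ℕ, ∀ N ≥ N₀, ∀ x : ℝ,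
      |∑ n ∈ Finset.range N, g (x + n * α) - N * A| ≤ ε * N := by
  have hc : Continuous (hper.lift) := (QuotientAddGroup.isQuotientMap_mk _).continuous_iff.mpr hg
  let f : C(AddCircle (1 : ℝ), ℂ) := ⟨fun t => (hper.lift t : ℂ), by fun_prop⟩
  obtain ⟨A, hA⟩ := exists_unifAvg hα f
  refine ⟨A.re, fun ε hε => ?_⟩
  obtain ⟨N₀, h⟩ := hA ε hε
  refine ⟨N₀, fun N hN x => ?_⟩
  refine le_trans (le_trans (le_of_eq ?_) (Complex.abs_re_le_norm _)) (h N hN x)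
  have hfc : ∀ y : ℝ, f ((y : ℝ) : AddCircle (1 : ℝ)) = (g y : ℂ) := fun _ => rfl
  rw [Complex.sub_re, Complex.re_sum]
  simp only [hfc, Complex.ofReal_re]
  simp

/-- A lower bound of Diophantine type for `|sin (πnα)|`. -/
def SinLower (α c r : ℝ) : Prop :=
  ∀ n : ℤ, n ≠ 0 → c / |(n : ℝ)| ^ r ≤ |Real.sin (Real.pi * (n * α))|

/-- The truncation of `x ↦ log |sin (πx)|` at height `-M`. -/
noncomputable def truncLog (M : ℕ) (x : ℝ) : ℝ :=
  Real.log (max |Real.sin (Real.pi * x)| (Real.exp (-M)))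

lemma continuous_truncLog (M : ℕ) : Continuous (truncLog M) := by
  refine Continuous.log (by fun_prop) fun x => ?_
  exact (lt_max_of_lt_right (Real.exp_pos _)).ne'

lemma periodic_truncLog (M : ℕ) : Function.Periodic (truncLog M) 1 := by
  intro x
  rw [truncLog, truncLog, mul_add, mul_one, Real.sin_add_pi, abs_neg]

lemma exp_truncLog (M : ℕ) (x : ℝ) :
    Real.exp (truncLog M x) = max |Real.sin (Real.pi * x)| (Real.exp (-M)) :=
  Real.exp_log (lt_max_of_lt_right (Real.exp_pos _))

lemma abs_sin_le_exp_truncLog (M : ℕ) (x : ℝ) :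
    |Real.sin (Real.pi * x)| ≤ Real.exp (truncLog M x) := by
  rw [exp_truncLog]; exact le_max_left _ _

lemma truncLog_nonpos (M : ℕ) (x : ℝ) : truncLog M x ≤ 0 := by
  apply Real.log_nonpos (le_max_of_le_left (abs_nonneg _))
  exact max_le (Real.abs_sin_le_one _) (by simp)

lemma neg_le_truncLog (M : ℕ) (x : ℝ) : -(M : ℝ) ≤ truncLog M x := by
  rw [← Real.exp_le_exp, exp_truncLog]; exact le_max_right _ _

lemma card_le_of_separated {s : Finset ℤ} {b : ℤ} {m : ℕ} {D : ℝ} (hD : 0 < D)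
    (hs : s ⊆ Finset.Ico b (b + m))
    (hsep : ∀ i ∈ s, ∀ j ∈ s, i ≠ j → D ≤ |((i - j : ℤ) : ℝ)|) :
    (s.card : ℝ) ≤ m / D + 1 := by
  have h1 : s.card ≤ (Finset.range (⌊(m : ℝ) / D⌋₊ + 1)).card := by
    refine Finset.card_le_card_of_injOn (fun n => ⌊((n - b : ℤ) : ℝ) / D⌋₊) ?_ ?_
    · intro n hn
      have hn' := Finset.mem_Ico.mp (hs hn)
      have : ((n - b : ℤ) : ℝ) ≤ m := by
        have : n - b ≤ m := by omega
        exact_mod_cast this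
      simp only [Finset.coe_range, Set.mem_Iio]
      exact Nat.lt_succ_of_le (Nat.floor_le_floor (by gcongr))
    · intro i hi j hj hij
      by_contra hne
      have h := hsep i hi j hj hne
      have hi' := Finset.mem_Ico.mp (hs hi)
      have hj' := Finset.mem_Ico.mp (hs hj)
      have hi0 : (0 : ℝ) ≤ ((i - b : ℤ) : ℝ) := by
        have : 0 ≤ i - b := by omega
        exact_mod_cast this
      have hj0 : (0 : ℝ) ≤ ((j - b : ℤ) : ℝ) := by
        have : 0 ≤ j - b := by omega
        exact_mod_cast this
      simp only at hij
      have a1 := Nat.floor_le (div_nonneg hi0 hD.le)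
      have a2 := Nat.lt_floor_add_one (((i - b : ℤ) : ℝ) / D)
      have b1 := Nat.floor_le (div_nonneg hj0 hD.le)
      have b2 := Nat.lt_floor_add_one (((j - b : ℤ) : ℝ) / D)
      rw [hij] at a1 a2
      have : |((i - b : ℤ) : ℝ) / D - ((j - b : ℤ) : ℝ) / D| < 1 := by
        rw [abs_lt]; constructor <;> linarith
      rw [← sub_div, abs_div, abs_of_pos hD, div_lt_one hD] at this
      push_cast at this h
      rw [show (i : ℝ) - b - (j - b) = i - j by ring] at this
      linarith
  rw [Finset.card_range] at h1
  calc (s.card : ℝ) ≤ (⌊(m : ℝ) / D⌋₊ + 1 : ℕ) := by exact_mod_cast h1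
    _ ≤ m / D + 1 := by
      push_cast
      have := Nat.floor_le (a := (m : ℝ) / D) (by positivity)
      linarith

lemma truncLog_sub_log_le {M P : ℕ} {x : ℝ} (h0 : 0 < |Real.sin (Real.pi * x)|)
    (hP : -Real.log |Real.sin (Real.pi * x)| ≤ P) :
    truncLog M x - Real.log |Real.sin (Real.pi * x)| ≤
      ((Finset.Ico M P).filter fun p : ℕ => |Real.sin (Real.pi * x)| < Real.exp (-p)).card := by
  set y := |Real.sin (Real.pi * x)| with hy
  rcases le_or_gt (Real.exp (-M)) y with h | h
  · rw [truncLog, ← hy, max_eq_left h, sub_self]; positivity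
  · have hlog : Real.log y < -M := by
      rwa [Real.log_lt_iff_lt_exp h0]
    rw [truncLog, ← hy, max_eq_right h.le, Real.log_exp]
    have hsub : Finset.Ico M ⌈-Real.log y⌉₊ ⊆
        (Finset.Ico M P).filter fun p : ℕ => y < Real.exp (-p) := by
      intro p hp
      rw [Finset.mem_Ico] at hp
      rw [Finset.mem_filter, Finset.mem_Ico]
      refine ⟨⟨hp.1, hp.2.trans_le (Nat.ceil_le.mpr hP)⟩, ?_⟩
      have := Nat.lt_ceil.mp hp.2
      rw [← Real.log_lt_iff_lt_exp h0]; linarith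
    have hcard := Finset.card_le_card hsub
    rw [Nat.card_Ico] at hcard
    have h2 := Nat.le_ceil (-Real.log y)
    have h3 : (⌈-Real.log y⌉₊ : ℝ) ≤ M + ((⌈-Real.log y⌉₊ - M : ℕ) : ℝ) := by
      have : ⌈-Real.log y⌉₊ ≤ M + (⌈-Real.log y⌉₊ - M) := by omega
      exact_mod_cast this
    have h4 : ((⌈-Real.log y⌉₊ - M : ℕ) : ℝ) ≤
        ((Finset.Ico M P).filter fun p : ℕ => y < Real.exp (-p)).card := by exact_mod_cast hcard
    linarith

lemma separation_of_small {α c r : ℝ} (hc : 0 < c) (hr : 0 < r) (h : SinLower α c r)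
    {p : ℕ} {i j : ℤ} (hij : i ≠ j) (hi : |Real.sin (Real.pi * (i * α))| < Real.exp (-p))
    (hj : |Real.sin (Real.pi * (j * α))| < Real.exp (-p)) :
    (c / 2 * Real.exp p) ^ (1 / r) ≤ |((i - j : ℤ) : ℝ)| := by
  have hne : i - j ≠ 0 := sub_ne_zero.mpr hij
  have h1 := h (i - j) hne
  have hpos : 0 < |((i - j : ℤ) : ℝ)| := abs_pos.mpr (by exact_mod_cast hne)
  have h2 : |Real.sin (Real.pi * (((i - j : ℤ) : ℝ) * α))| ≤ 2 * Real.exp (-p) := by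
    have : Real.pi * (((i - j : ℤ) : ℝ) * α) = Real.pi * (i * α) - Real.pi * (j * α) := by
      push_cast; ring
    rw [this, Real.sin_sub]
    refine (abs_sub _ _).trans ?_
    rw [abs_mul, abs_mul]
    have c1 := Real.abs_cos_le_one (Real.pi * (j * α))
    have c2 := Real.abs_cos_le_one (Real.pi * (i * α))
    have s1 := abs_nonneg (Real.sin (Real.pi * (i * α)))
    have s2 := abs_nonneg (Real.sin (Real.pi * (j * α)))
    nlinarith
  have h3 : c / 2 * Real.exp p ≤ |((i - j : ℤ) : ℝ)| ^ r := by
    have h4 := h1.trans h2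
    rw [div_le_iff₀ (by positivity)] at h4
    have : Real.exp p * Real.exp (-p) = 1 := by rw [← Real.exp_add]; simp
    have e0 := Real.exp_pos (p : ℝ)
    calc c / 2 * Real.exp p ≤ (2 * Real.exp (-p) * |((i - j : ℤ) : ℝ)| ^ r) / 2 * Real.exp p := by
          gcongr
      _ = (Real.exp p * Real.exp (-p)) * |((i - j : ℤ) : ℝ)| ^ r := by ring
      _ = _ := by rw [this, one_mul]
  calc (c / 2 * Real.exp p) ^ (1 / r) ≤ (|((i - j : ℤ) : ℝ)| ^ r) ^ (1 / r) := by gcongr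
    _ = _ := by rw [← Real.rpow_mul hpos.le, mul_one_div_cancel hr.ne', Real.rpow_one]

lemma exists_log_bound (c r B : ℝ) {ε : ℝ} (hε : 0 < ε) :
    ∃ m₀ : ℕ, ∀ m ≥ m₀, (⌈r * Real.log (B * m) - Real.log c⌉₊ : ℝ) ≤ ε * m := by
  have h1 : Tendsto (fun m : ℕ => Real.log m / m) atTop (𝓝 0) := by
    have := Real.isLittleO_log_id_atTop.tendsto_div_nhds_zero
    exact this.comp tendsto_natCast_atTop_atTop
  have h2 : Tendsto (fun m : ℕ => (|r * Real.log B - Real.log c| + 1) / (m : ℝ) +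
      |r| * (Real.log m / m)) atTop (𝓝 (0 + |r| * 0)) :=
    (tendsto_const_div_atTop_nhds_zero_nat _).add (h1.const_mul _)
  rw [mul_zero, add_zero] at h2
  obtain ⟨m₁, hm₁⟩ := eventually_atTop.mp (h2.eventually (gt_mem_nhds hε))
  refine ⟨max m₁ 1, fun m hm => ?_⟩
  have hm1 : 1 ≤ m := le_trans (le_max_right _ _) hm
  have hmpos : (0 : ℝ) < m := by exact_mod_cast hm1
  have h3 := hm₁ m (le_trans (le_max_left _ _) hm)
  have hlogm : 0 ≤ Real.log m := Real.log_natCast_nonneg m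
  have h5 : r * Real.log (B * m) - Real.log c ≤
      (|r * Real.log B - Real.log c|) + |r| * Real.log m := by
    rcases eq_or_ne B 0 with hB | hB
    · subst hB
      simp only [zero_mul, Real.log_zero, mul_zero, zero_sub]
      have := neg_abs_le (Real.log c)
      rw [abs_neg]
      nlinarith [mul_nonneg (abs_nonneg r) hlogm]
    · rw [Real.log_mul hB hmpos.ne']
      have := le_abs_self (r * Real.log B - Real.log c)
      have := mul_le_mul_of_nonneg_right (le_abs_self r) hlogm
      linarith
  have h6 := Nat.ceil_lt_add_one (a := |r * Real.log B - Real.log c| + |r| * Real.log m)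
    (by positivity)
  have h7 : (⌈r * Real.log (B * m) - Real.log c⌉₊ : ℝ) ≤
      ⌈|r * Real.log B - Real.log c| + |r| * Real.log m⌉₊ := by
    exact_mod_cast Nat.ceil_le_ceil h5
  have h8 : (|r * Real.log B - Real.log c| + 1) / (m : ℝ) + |r| * (Real.log m / m) =
      (|r * Real.log B - Real.log c| + 1 + |r| * Real.log m) / m := by ring
  rw [h8, div_lt_iff₀ hmpos] at h3
  linarith

lemma sum_tail_le {α c r : ℝ} (hc : 0 < c) (hr : 0 < r) (h : SinLower α c r) (B : ℝ) {ε : ℝ}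
    (hε : 0 < ε) : ∃ M m₀ : ℕ, ∀ m ≥ m₀, ∀ (b : ℤ) (s : Finset ℤ), s ⊆ Finset.Ico b (b + m) →
      (∀ n ∈ s, n ≠ 0 ∧ |(n : ℝ)| ≤ B * m) →
      ∑ n ∈ s, (truncLog M (n * α) - Real.log |Real.sin (Real.pi * (n * α))|) ≤ ε * m := by
  set ρ := Real.exp (-(1 / r)) with hρ
  have hρ1 : ρ < 1 := by rw [hρ, Real.exp_lt_one_iff]; simpa using hr
  have hρ0 : 0 < ρ := Real.exp_pos _
  set K := (c / 2) ^ (-(1 / r)) with hK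
  have hK0 : 0 < K := by positivity
  have hD : ∀ p : ℕ, 1 / (c / 2 * Real.exp p) ^ (1 / r) = K * ρ ^ p := by
    intro p
    rw [one_div, ← Real.rpow_neg (by positivity), Real.mul_rpow (by positivity) (by positivity),
      ← Real.exp_mul, hρ, ← Real.exp_nat_mul]
  obtain ⟨M, hM⟩ : ∃ M : ℕ, K * ρ ^ M / (1 - ρ) ≤ ε / 2 := by
    have : Tendsto (fun M : ℕ => K * ρ ^ M / (1 - ρ)) atTop (𝓝 (K * 0 / (1 - ρ))) :=
      ((tendsto_pow_atTop_nhds_zero_of_lt_one hρ0.le hρ1).const_mul _).div_const _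
    rw [mul_zero, zero_div] at this
    obtain ⟨M, hM⟩ := (this.eventually (gt_mem_nhds (show 0 < ε / 2 by positivity))).exists
    exact ⟨M, hM.le⟩
  obtain ⟨m₀, hm₀⟩ := exists_log_bound c r B (show 0 < ε / 2 by positivity)
  refine ⟨M, m₀, fun m hm b s hs hsn => ?_⟩
  set P := ⌈r * Real.log (B * m) - Real.log c⌉₊ with hP
  have hlow : ∀ n ∈ s, 0 < |Real.sin (Real.pi * (n * α))| ∧
      -Real.log |Real.sin (Real.pi * (n * α))| ≤ P := by
    intro n hn
    obtain ⟨hn0, hnB⟩ := hsn n hn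
    have hnpos : 0 < |(n : ℝ)| := abs_pos.mpr (by exact_mod_cast hn0)
    have hlt := h n hn0
    have hpos : 0 < c / |(n : ℝ)| ^ r := by positivity
    refine ⟨hpos.trans_le hlt, ?_⟩
    have h1 := Real.log_le_log hpos hlt
    rw [Real.log_div hc.ne' (by positivity), Real.log_rpow hnpos] at h1
    have h2 := Real.log_le_log hnpos hnB
    have h3 := mul_le_mul_of_nonneg_left h2 hr.le
    have h4 := Nat.le_ceil (r * Real.log (B * m) - Real.log c)
    rw [← hP] at h4
    linarith
  have hcount : ∀ p : ℕ, ((s.filter fun n : ℤ =>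
      |Real.sin (Real.pi * (n * α))| < Real.exp (-p)).card : ℝ) ≤ m * (K * ρ ^ p) + 1 := by
    intro p
    have hDpos : 0 < (c / 2 * Real.exp p) ^ (1 / r) := by positivity
    have := card_le_of_separated (s := s.filter fun n : ℤ =>
      |Real.sin (Real.pi * (n * α))| < Real.exp (-p)) (b := b) (m := m) hDpos
      ((Finset.filter_subset _ _).trans hs) (fun i hi j hj hij =>
        separation_of_small hc hr h hij (Finset.mem_filter.mp hi).2 (Finset.mem_filter.mp hj).2)
    rwa [div_eq_mul_one_div, hD p] at this
  calc ∑ n ∈ s, (truncLog M (n * α) - Real.log |Real.sin (Real.pi * (n * α))|)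
      ≤ ∑ n ∈ s, (((Finset.Ico M P).filter fun p : ℕ =>
          |Real.sin (Real.pi * (n * α))| < Real.exp (-p)).card : ℝ) :=
        Finset.sum_le_sum fun n hn => truncLog_sub_log_le (hlow n hn).1 (hlow n hn).2
    _ = ∑ p ∈ Finset.Ico M P, ((s.filter fun n : ℤ =>
          |Real.sin (Real.pi * (n * α))| < Real.exp (-p)).card : ℝ) := by
        simp only [Finset.card_filter]
        push_cast
        exact Finset.sum_comm
    _ ≤ ∑ p ∈ Finset.Ico M P, (m * (K * ρ ^ p) + 1) := Finset.sum_le_sum fun p _ => hcount p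
    _ = m * (K * ∑ p ∈ Finset.Ico M P, ρ ^ p) + (P - M : ℕ) := by
        rw [Finset.sum_add_distrib, ← Finset.mul_sum, ← Finset.mul_sum]; simp
    _ ≤ m * (K * (ρ ^ M / (1 - ρ))) + P := by
        gcongr
        · exact geom_sum_Ico_le_of_lt_one hρ0.le hρ1
        · omega
    _ ≤ m * (ε / 2) + ε / 2 * m := by
        gcongr
        · rw [← mul_div_assoc]; exact hM
        · exact hm₀ m hm
    _ = ε * m := by ring

/-- Sines along an orbit segment of an arbitrary point are, in geometric mean, not larger than sines
along an orbit segment of `0`. -/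
theorem prod_sin_le {α c r : ℝ} (hα : Irrational α) (hc : 0 < c) (hr : 0 < r)
    (h : SinLower α c r) (B : ℝ) {ε : ℝ} (hε : 0 < ε) :
    ∃ m₀ : ℕ, ∀ m ≥ m₀, ∀ (a i n₀ : ℤ) (x₀ : ℝ),
      (∀ j ∈ (Finset.Ico a (a + m)).erase i, n₀ + j ≠ 0 ∧ |((n₀ + j : ℤ) : ℝ)| ≤ B * m) →
      ∏ j ∈ (Finset.Ico a (a + m)).erase i, |Real.sin (Real.pi * (x₀ + j * α))| ≤
        Real.exp (ε * m) *
          ∏ j ∈ (Finset.Ico a (a + m)).erase i, |Real.sin (Real.pi * (((n₀ + j : ℤ) : ℝ) * α))| := by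
  obtain ⟨M, m₁, hM⟩ := sum_tail_le hc hr h B (show 0 < ε / 4 by positivity)
  obtain ⟨A, hA⟩ := exists_uniform_average hα (continuous_truncLog M) (periodic_truncLog M)
  obtain ⟨m₂, hm₂⟩ := hA (ε / 4) (by positivity)
  refine ⟨max (max m₁ m₂) ⌈M / (ε / 4)⌉₊, fun m hm a i n₀ x₀ hj => ?_⟩
  have hm1 : m₁ ≤ m := by omega
  have hm2 : m₂ ≤ m := by omega
  have hm3 : (M : ℝ) ≤ ε / 4 * m := by
    have : (M : ℝ) / (ε / 4) ≤ m := Nat.ceil_le.mp (by omega)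
    rwa [div_le_iff₀' (by positivity)] at this
  set I := Finset.Ico a (a + m) with hI
  set s := I.erase i with hs
  have hreindex : ∀ x : ℝ, ∑ j ∈ I, truncLog M (x + j * α) =
      ∑ n ∈ Finset.range m, truncLog M ((x + a * α) + n * α) := by
    intro x
    have : I = (Finset.range m).image (fun n : ℕ => a + (n : ℤ)) := by
      ext j
      simp only [hI, Finset.mem_Ico, Finset.mem_image, Finset.mem_range]
      constructor
      · rintro ⟨h1, h2⟩; exact ⟨(j - a).toNat, by omega, by omega⟩
      · rintro ⟨n, h1, h2⟩; omega
    rw [this, Finset.sum_image (by intro x _ y _ hxy; simpa using hxy)]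
    refine Finset.sum_congr rfl fun n _ => ?_
    push_cast; congr 1; ring
  have hup : ∑ j ∈ s, truncLog M (x₀ + j * α) ≤ m * A + ε / 4 * m + M := by
    have h1 := (abs_le.mp (hm₂ m hm2 (x₀ + a * α))).2
    rw [← hreindex] at h1
    have h2 : ∑ j ∈ s, truncLog M (x₀ + j * α) ≤ ∑ j ∈ I, truncLog M (x₀ + j * α) + M := by
      by_cases hi : i ∈ I
      · rw [← Finset.add_sum_erase I _ hi]
        have := neg_le_truncLog M (x₀ + i * α)
        linarith
      · rw [hs, Finset.erase_eq_of_notMem hi]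
        have : (0 : ℝ) ≤ M := by positivity
        linarith
    linarith
  have hlo : m * A - ε / 4 * m ≤ ∑ j ∈ s, truncLog M (n₀ * α + j * α) := by
    have h1 := (abs_le.mp (hm₂ m hm2 (n₀ * α + a * α))).1
    rw [← hreindex] at h1
    have h2 : ∑ j ∈ I, truncLog M (n₀ * α + j * α) ≤ ∑ j ∈ s, truncLog M (n₀ * α + j * α) := by
      by_cases hi : i ∈ I
      · rw [← Finset.add_sum_erase I _ hi]
        have := truncLog_nonpos M (n₀ * α + i * α)
        linarith
      · rw [hs, Finset.erase_eq_of_notMem hi]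
    linarith
  have htail : ∑ j ∈ s, (truncLog M (n₀ * α + j * α) -
      Real.log |Real.sin (Real.pi * (((n₀ + j : ℤ) : ℝ) * α))|) ≤ ε / 4 * m := by
    have h1 := hM m hm1 (n₀ + a) (s.image fun j => n₀ + j) (by
      intro n hn
      obtain ⟨j, hj1, rfl⟩ := Finset.mem_image.mp hn
      have := Finset.mem_Ico.mp (Finset.mem_of_mem_erase hj1)
      rw [Finset.mem_Ico]; omega) (by
      intro n hn
      obtain ⟨j, hj1, rfl⟩ := Finset.mem_image.mp hn
      exact hj j hj1)
    rw [Finset.sum_image (by intro x _ y _ hxy; simpa using hxy)] at h1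
    refine le_trans (le_of_eq (Finset.sum_congr rfl fun j _ => ?_)) h1
    push_cast; rw [add_mul]
  rw [Finset.sum_sub_distrib] at htail
  have hpos : ∀ j ∈ s, 0 < |Real.sin (Real.pi * (((n₀ + j : ℤ) : ℝ) * α))| := by
    intro j hjs
    have hn0 := (hj j hjs).1
    have hnpos : 0 < |((n₀ + j : ℤ) : ℝ)| := abs_pos.mpr (by exact_mod_cast hn0)
    exact lt_of_lt_of_le (by positivity) (h _ hn0)
  calc ∏ j ∈ s, |Real.sin (Real.pi * (x₀ + j * α))|
      ≤ ∏ j ∈ s, Real.exp (truncLog M (x₀ + j * α)) :=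
        Finset.prod_le_prod (fun _ _ => abs_nonneg _) fun j _ => abs_sin_le_exp_truncLog _ _
    _ = Real.exp (∑ j ∈ s, truncLog M (x₀ + j * α)) := (Real.exp_sum _ _).symm
    _ ≤ Real.exp (ε * m + ∑ j ∈ s, Real.log |Real.sin (Real.pi * (((n₀ + j : ℤ) : ℝ) * α))|) := by
        rw [Real.exp_le_exp]; linarith
    _ = _ := by
        rw [Real.exp_add, Real.exp_sum]
        congr 1
        exact Finset.prod_congr rfl fun j hjs => Real.exp_log (hpos j hjs)

/-- The continuant (box determinant) of the Jacobi operator with diagonal `-w (θ + nα)` on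
`0 ≤ n < k`. -/
noncomputable def cont (w : ℝ → ℝ) (α : ℝ) : ℝ → ℕ → ℝ
  | _, 0 => 1
  | θ, 1 => w θ
  | θ, k + 2 => w θ * cont w α (θ + α) (k + 1) - cont w α (θ + 2 * α) k

lemma cont_succ_succ (w : ℝ → ℝ) (α θ : ℝ) (k : ℕ) : cont w α θ (k + 2) =
    w θ * cont w α (θ + α) (k + 1) - cont w α (θ + 2 * α) k := by rw [cont]

lemma cont_succ_succ_right (w : ℝ → ℝ) (α : ℝ) (k : ℕ) : ∀ θ, cont w α θ (k + 2) =
    w (θ + (k + 1) * α) * cont w α θ (k + 1) - cont w α θ k := by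
  induction k using Nat.twoStepInduction with
  | zero => intro θ; simp [cont]; ring
  | one =>
    intro θ
    rw [cont_succ_succ]
    simp only [cont]
    rw [show θ + α + α = θ + ((1 : ℕ) + 1) * α by push_cast; ring,
      show θ + 2 * α = θ + ((1 : ℕ) + 1) * α by push_cast; ring]
    ring
  | more k h1 h2 =>
    intro θ
    rw [cont_succ_succ w α θ (k + 2), h2 (θ + α), h1 (θ + 2 * α), cont_succ_succ w α θ (k + 1),
      cont_succ_succ w α θ k]
    rw [show θ + α + ((k + 1 : ℕ) + 1) * α = θ + ((k + 2 : ℕ) + 1) * α by push_cast; ring,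
      show θ + 2 * α + ((k : ℕ) + 1) * α = θ + ((k + 2 : ℕ) + 1) * α by push_cast; ring]
    ring

lemma cont_reflect {w : ℝ → ℝ} (hw : ∀ x, w (-x) = w x) (α : ℝ) (k : ℕ) : ∀ θ,
    cont w α (-θ - (k - 1) * α) k = cont w α θ k := by
  induction k using Nat.twoStepInduction with
  | zero => intro θ; simp [cont]
  | one => intro θ; simp [cont, hw]
  | more k h1 h2 =>
    intro θ
    rw [cont_succ_succ_right, cont_succ_succ, ← h1 (θ + 2 * α), ← h2 (θ + α)]
    rw [show -θ - (((k + 2 : ℕ) : ℝ) - 1) * α + (k + 1) * α = -θ by push_cast; ring, hw,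
      show -(θ + 2 * α) - ((k : ℝ) - 1) * α = -θ - (((k + 2 : ℕ) : ℝ) - 1) * α by push_cast; ring,
      show -(θ + α) - (((k + 1 : ℕ) : ℝ) - 1) * α = -θ - (((k + 2 : ℕ) : ℝ) - 1) * α by
        push_cast; ring]

lemma solution_forward {w : ℝ → ℝ} {α : ℝ} {u : ℤ → ℝ}
    (hu : ∀ n : ℤ, u (n + 1) + u (n - 1) = w (n * α) * u n) (k : ℕ) : ∀ x : ℤ,
    u (x + k + 1) = cont w α (x * α) (k + 1) * u x -
      cont w α ((x + 1 : ℤ) * α) k * u (x - 1) := by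
  induction k using Nat.twoStepInduction with
  | zero => intro x; have := hu x; simp [cont]; linarith
  | one =>
    intro x
    have h0 := hu x
    have h1 := hu (x + 1)
    rw [show x + 1 - 1 = x by ring] at h1
    rw [cont_succ_succ]
    simp only [cont]
    push_cast at h1 ⊢
    rw [show (x : ℝ) * α + α = (x + 1) * α by ring]
    rw [show u (x + 1 + 1) = w ((x + 1) * α) * u (x + 1) - u x by linarith,
      show u (x + 1) = w (x * α) * u x - u (x - 1) by linarith]
    ring
  | more k h1 h2 =>
    intro x
    have e1 := h1 x
    have e2 := h2 x
    have e3 := hu (x + k + 2)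
    rw [cont_succ_succ_right w α (k + 1) (x * α),
      cont_succ_succ_right w α k ((x + 1 : ℤ) * α)]
    rw [show x + (k : ℤ) + 2 - 1 = x + k + 1 by ring] at e3
    rw [show x + ((k + 1 : ℕ) : ℤ) + 1 = x + k + 2 by push_cast; ring] at e2
    rw [show x + ((k + 2 : ℕ) : ℤ) + 1 = x + k + 2 + 1 by push_cast; ring]
    rw [show (x : ℝ) * α + (((k + 1 : ℕ) : ℝ) + 1) * α = ((x + k + 2 : ℤ) : ℝ) * α by
        push_cast; ring,
      show ((x + 1 : ℤ) : ℝ) * α + ((k : ℝ) + 1) * α = ((x + k + 2 : ℤ) : ℝ) * α by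
        push_cast; ring]
    rw [e1, e2] at e3
    rw [eq_sub_of_add_eq e3]
    ring

lemma green_formula {w : ℝ → ℝ} {α : ℝ} {u : ℤ → ℝ}
    (hu : ∀ n : ℤ, u (n + 1) + u (n - 1) = w (n * α) * u n) (j i : ℕ) : ∀ x : ℤ,
    u (x + i) * cont w α (x * α) (i + j + 1) = cont w α (x * α) i * u (x + i + j + 1) +
      cont w α ((x + i + 1 : ℤ) * α) j * u (x - 1) := by
  induction i using Nat.twoStepInduction with
  | zero =>
    intro x
    have := solution_forward hu j x
    simp only [Nat.cast_zero, add_zero, zero_add, cont]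
    rw [this]; ring
  | one =>
    intro x
    have h1 := solution_forward hu j (x + 1)
    have h0 := hu x
    rw [show 1 + j + 1 = j + 2 by ring, cont_succ_succ]
    rw [show x + 1 - 1 = x by ring] at h1
    simp only [Nat.cast_one, cont]
    rw [h1, show u (x - 1) = w (x * α) * u x - u (x + 1) by linarith]
    rw [show (x : ℝ) * α + α = ((x + 1 : ℤ) : ℝ) * α by push_cast; ring,
      show (x : ℝ) * α + 2 * α = ((x + 1 + 1 : ℤ) : ℝ) * α by push_cast; ring]
    ring
  | more i h1 h2 =>
    intro x
    have e1 := h1 (x + 2)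
    have e2 := h2 (x + 1)
    have h0 := hu x
    rw [show i + 2 + j + 1 = (i + j + 1) + 2 by ring, cont_succ_succ, cont_succ_succ w α _ i]
    rw [show (x : ℝ) * α + α = ((x + 1 : ℤ) : ℝ) * α by push_cast; ring,
      show (x : ℝ) * α + 2 * α = ((x + 2 : ℤ) : ℝ) * α by push_cast; ring]
    rw [show x + 2 + (i : ℤ) = x + ((i + 2 : ℕ) : ℤ) by push_cast; ring,
      show x + 2 - 1 = x + 1 by ring] at e1
    rw [show x + 1 + ((i + 1 : ℕ) : ℤ) = x + ((i + 2 : ℕ) : ℤ) by push_cast; ring,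
      show x + 1 - 1 = x by ring, show i + 1 + j + 1 = i + j + 1 + 1 by ring] at e2
    rw [mul_sub, mul_left_comm, e1, e2, show u (x - 1) = w (x * α) * u x - u (x + 1) by linarith]
    ring

section Trig

variable (lam α E : ℝ)

/-- The diagonal coefficient `E - 2λ cos (2πθ)` of the eigenvalue equation. -/
noncomputable def coeff (θ : ℝ) : ℝ := E - 2 * lam * Real.cos (2 * Real.pi * θ)

lemma coeff_neg (θ : ℝ) : coeff lam E (-θ) = coeff lam E θ := by
  rw [coeff, coeff, mul_neg, Real.cos_neg]

lemma coeff_mul_e (θ : ℝ) : (coeff lam E θ : ℂ) * e θ = E * e θ - lam * (e θ ^ 2 + 1) := by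
  have h := e_add_e_neg θ
  have h2 : e θ * e (-θ) = 1 := by rw [← e_add]; simp [e_zero]
  rw [coeff]
  push_cast at h ⊢
  rw [show ((E : ℂ) - 2 * lam * Complex.cos (2 * Real.pi * θ)) * e θ =
    E * e θ - lam * ((2 * Complex.cos (2 * Real.pi * θ)) * e θ) by ring, ← h]
  linear_combination (-(lam : ℂ)) * h2

lemma exists_poly_cont (k : ℕ) : ∃ Q : Polynomial ℂ, Q.natDegree ≤ 2 * k ∧
    ‖Q.coeff 0‖ = |lam| ^ k ∧
    ∀ θ, (cont (coeff lam E) α θ k : ℂ) * e (k * θ) = Q.eval (e θ) := by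
  have hshift : ∀ (β : ℝ) (j : ℕ) (Q : Polynomial ℂ), Q.natDegree ≤ 2 * j →
      (∀ θ, (cont (coeff lam E) α θ j : ℂ) * e (j * θ) = Q.eval (e θ)) →
      ∃ Q' : Polynomial ℂ, Q'.natDegree ≤ 2 * j ∧ ‖Q'.coeff 0‖ = ‖Q.coeff 0‖ ∧
      ∀ θ, (cont (coeff lam E) α (θ + β) j : ℂ) * e (j * θ) = Q'.eval (e θ) := by
    intro β j Q hQ h
    refine ⟨Polynomial.C (e (-(j * β))) * Q.comp (Polynomial.C (e β) * Polynomial.X), ?_, ?_, ?_⟩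
    · refine (Polynomial.natDegree_C_mul_le _ _).trans (Polynomial.natDegree_comp_le.trans ?_)
      have : (Polynomial.C (e β) * Polynomial.X).natDegree ≤ 1 := by
        compute_degree
      calc _ ≤ Q.natDegree * 1 := by gcongr
        _ ≤ 2 * j := by omega
    · rw [Polynomial.coeff_C_mul, norm_mul, norm_e, one_mul, Polynomial.coeff_zero_eq_eval_zero,
        Polynomial.eval_comp, Polynomial.coeff_zero_eq_eval_zero]
      simp
    · intro θ
      rw [Polynomial.eval_mul, Polynomial.eval_C, Polynomial.eval_comp, Polynomial.eval_mul,
        Polynomial.eval_C, Polynomial.eval_X, ← e_add, add_comm β θ, ← h, mul_left_comm, ← e_add]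
      congr 2; ring
  induction k using Nat.twoStepInduction with
  | zero => exact ⟨1, by simp, by simp, fun θ => by simp [cont, e_zero]⟩
  | one =>
    refine ⟨Polynomial.C (E : ℂ) * Polynomial.X -
      Polynomial.C (lam : ℂ) * (Polynomial.X ^ 2 + 1), by compute_degree, by simp, fun θ => ?_⟩
    simp only [cont, Nat.cast_one, one_mul, coeff_mul_e]
    simp
  | more k h1 h2 =>
    obtain ⟨Q1, d1, c1, e1⟩ := h1
    obtain ⟨Q2, d2, c2, e2⟩ := h2
    obtain ⟨R1, d3, c3, e3⟩ := hshift (2 * α) k Q1 d1 e1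
    obtain ⟨R2, d4, c4, e4⟩ := hshift α (k + 1) Q2 d2 e2
    refine ⟨(Polynomial.C (E : ℂ) * Polynomial.X -
      Polynomial.C (lam : ℂ) * (Polynomial.X ^ 2 + 1)) * R2 - Polynomial.X ^ 2 * R1, ?_, ?_, ?_⟩
    · refine (Polynomial.natDegree_sub_le _ _).trans (max_le ?_ ?_)
      · refine Polynomial.natDegree_mul_le.trans ?_
        have : (Polynomial.C (E : ℂ) * Polynomial.X -
          Polynomial.C (lam : ℂ) * (Polynomial.X ^ 2 + 1)).natDegree ≤ 2 := by compute_degree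
        omega
      · refine Polynomial.natDegree_mul_le.trans ?_
        have : (Polynomial.X ^ 2 : Polynomial ℂ).natDegree ≤ 2 := by compute_degree
        omega
    · have : ((Polynomial.C (E : ℂ) * Polynomial.X -
          Polynomial.C (lam : ℂ) * (Polynomial.X ^ 2 + 1)) * R2 - Polynomial.X ^ 2 * R1).coeff 0
          = -(lam : ℂ) * R2.coeff 0 := by
        simp [Polynomial.coeff_zero_eq_eval_zero]
      rw [this, norm_mul, c4, c2, norm_neg, Complex.norm_real, Real.norm_eq_abs]
      ring
    · intro θ
      rw [cont_succ_succ, Polynomial.eval_sub, Polynomial.eval_mul, Polynomial.eval_mul, ← e3,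
        ← e4]
      have hw := coeff_mul_e lam E θ
      have h5 : e ((k + 2 : ℕ) * θ) = e θ * e ((k + 1 : ℕ) * θ) := by
        rw [← e_add]; congr 1; push_cast; ring
      have h6 : e ((k + 2 : ℕ) * θ) = e θ ^ 2 * e (k * θ) := by
        rw [← e_nat_mul 2, ← e_add]; congr 1; push_cast; ring
      push_cast
      rw [sub_mul]
      conv_lhs =>
        rw [show ((k : ℝ) + 2) * θ = ((k + 2 : ℕ) : ℝ) * θ by push_cast; ring]
        arg 1
        rw [h5]
      rw [h6]
      simp only [Polynomial.eval_sub, Polynomial.eval_mul, Polynomial.eval_C, Polynomial.eval_X,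
        Polynomial.eval_add, Polynomial.eval_pow, Polynomial.eval_one]
      rw [← hw]
      push_cast
      ring

/-- The supremum of a continuant over all phases is bounded below by `λ ^ k`. -/
lemma pow_le_of_cont_le {k : ℕ} {S : ℝ} (hS : ∀ θ, |cont (coeff lam E) α θ k| ≤ S) :
    |lam| ^ k ≤ S := by
  obtain ⟨Q, -, hc, hQ⟩ := exists_poly_cont lam α E k
  rw [← hc, Polynomial.coeff_zero_eq_eval_zero]
  refine Complex.norm_le_of_forall_mem_frontier_norm_le (U := Metric.ball (0 : ℂ) 1)
    Metric.isBounded_ball (Q.differentiable.diffContOnCl) (fun z hz => ?_)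
    (subset_closure (Metric.mem_ball_self one_pos))
  rw [frontier_ball (0 : ℂ) one_ne_zero, mem_sphere_zero_iff_norm] at hz
  have hz' : z = e (z.arg / (2 * Real.pi)) := by
    have := Complex.norm_mul_exp_arg_mul_I z
    rw [hz] at this
    rw [e, mul_div_cancel₀ _ (by positivity)]
    simpa using this.symm
  rw [hz', ← hQ, norm_mul, norm_e, mul_one, Complex.norm_real]
  exact hS _

/-- A continuant is a polynomial in the cosine of its central phase. -/
lemma exists_poly_cos (k : ℕ) : ∃ R : Polynomial ℝ, R.natDegree ≤ k ∧
    ∀ φ, cont (coeff lam E) α (φ - (k - 1) / 2 * α) k = R.eval (Real.cos (2 * Real.pi * φ)) := by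
  obtain ⟨Q, hd, -, hQ⟩ := exists_poly_cont lam α E k
  set f : ℝ → ℝ := fun φ => cont (coeff lam E) α (φ - (k - 1) / 2 * α) k with hf
  have heven : ∀ φ, f (-φ) = f φ := by
    intro φ
    have := cont_reflect (coeff_neg lam E) α k (φ - (k - 1) / 2 * α)
    rw [hf]; simp only
    rw [← this]; congr 1; ring
  set q : ℕ → ℂ := fun i => Q.coeff i * e (-((i - k) * ((k - 1) / 2 * α))) with hq
  have hexp : ∀ φ, (f φ : ℂ) = ∑ i ∈ Finset.range (2 * k + 1), q i * e (((i : ℝ) - k) * φ) := by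
    intro φ
    set ψ := φ - (k - 1) / 2 * α with hψ
    have h1 := hQ ψ
    rw [Polynomial.eval_eq_sum_range' (n := 2 * k + 1) (by omega)] at h1
    have h2 : e (k * ψ) * e (-(k * ψ)) = 1 := by rw [← e_add]; simp [e_zero]
    calc (f φ : ℂ) = (cont (coeff lam E) α ψ k * e (k * ψ)) * e (-(k * ψ)) := by
          rw [mul_assoc, h2, mul_one]
      _ = _ := by
        rw [h1, Finset.sum_mul]
        refine Finset.sum_congr rfl fun i _ => ?_
        rw [hq]; simp only
        rw [← e_nat_mul, mul_assoc, mul_assoc, ← e_add, ← e_add]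
        congr 2; rw [hψ]; ring
  have hcos : ∀ φ, f φ = ∑ i ∈ Finset.range (2 * k + 1),
      (q i).re * Real.cos (((i : ℤ) - k : ℤ) * (2 * Real.pi * φ)) := by
    intro φ
    have h1 := congrArg Complex.re (hexp φ)
    have h2 := congrArg Complex.re (hexp (-φ))
    rw [heven, Complex.re_sum] at h2
    rw [Complex.re_sum] at h1
    simp only [Complex.ofReal_re, Complex.mul_re, e_re, e_im] at h1 h2
    have h3 : f φ = (f φ + f φ) / 2 := by ring
    rw [h3]
    nth_rewrite 1 [h1]
    rw [h2, ← Finset.sum_add_distrib, Finset.sum_div]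
    refine Finset.sum_congr rfl fun i _ => ?_
    rw [show 2 * Real.pi * (((i : ℝ) - k) * -φ) = -(2 * Real.pi * (((i : ℝ) - k) * φ)) by ring,
      Real.cos_neg, Real.sin_neg]
    rw [show ((((i : ℤ) - k : ℤ)) : ℝ) * (2 * Real.pi * φ) = 2 * Real.pi * (((i : ℝ) - k) * φ) by
      push_cast; ring]
    ring
  refine ⟨∑ i ∈ Finset.range (2 * k + 1),
    Polynomial.C (q i).re * Polynomial.Chebyshev.T ℝ ((i : ℤ) - k), ?_, fun φ => ?_⟩
  · refine Polynomial.natDegree_sum_le_of_forall_le _ _ fun i hi => ?_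
    refine (Polynomial.natDegree_C_mul_le _ _).trans ?_
    rw [Polynomial.Chebyshev.natDegree_T]
    have := Finset.mem_range.mp hi
    omega
  · rw [show cont (coeff lam E) α (φ - (k - 1) / 2 * α) k = f φ from rfl, hcos,
      Polynomial.eval_finsetSum]
    refine Finset.sum_congr rfl fun i _ => ?_
    rw [Polynomial.eval_mul, Polynomial.eval_C, Polynomial.Chebyshev.T_real_cos]

end Trig

section Growth

attribute [local instance] Matrix.linftyOpNormedRing Matrix.linftyOpNormedAlgebra

/-- The transfer matrix over `k` steps of `u (n+1) + u (n-1) = w (θ + nα) u n`. -/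
noncomputable def transfer (w : ℝ → ℝ) (α θ : ℝ) : ℕ → Matrix (Fin 2) (Fin 2) ℝ
  | 0 => 1
  | k + 1 => !![w (θ + k * α), -1; 1, 0] * transfer w α θ k

lemma transfer_add (w : ℝ → ℝ) (α θ : ℝ) (j k : ℕ) :
    transfer w α θ (j + k) = transfer w α (θ + j * α) k * transfer w α θ j := by
  induction k with
  | zero => simp [transfer]
  | succ k ih =>
    rw [← add_assoc, transfer, ih, transfer, mul_assoc]
    congr 4; push_cast; ring_nf

lemma transfer_eq_cont (w : ℝ → ℝ) (α θ : ℝ) (k : ℕ) : transfer w α θ (k + 2) =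
    !![cont w α θ (k + 2), -cont w α (θ + α) (k + 1);
      cont w α θ (k + 1), -cont w α (θ + α) k] := by
  induction k with
  | zero =>
    simp [transfer, cont, Matrix.one_fin_two]
    ring_nf
  | succ k ih =>
    rw [transfer, ih, cont_succ_succ_right w α (k + 1) θ, cont_succ_succ_right w α k (θ + α)]
    rw [show θ + α + ((k : ℝ) + 1) * α = θ + ((k + 2 : ℕ) : ℝ) * α by push_cast; ring,
      show θ + (((k + 1 : ℕ) : ℝ) + 1) * α = θ + ((k + 2 : ℕ) : ℝ) * α by push_cast; ring]
    simp
    constructor <;> ring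

lemma norm_fin_two (a b c d : ℝ) : ‖(!![a, b; c, d] : Matrix (Fin 2) (Fin 2) ℝ)‖ =
    max (|a| + |b|) (|c| + |d|) := by
  rw [Matrix.linfty_opNorm_def]
  simp [Fin.univ_succ]

lemma norm_transfer_le {w : ℝ → ℝ} {B : ℝ} (hB : ∀ x, |w x| ≤ B) (α θ : ℝ) (k : ℕ) :
    ‖transfer w α θ k‖ ≤ (B + 1) ^ k := by
  have hB0 : 0 ≤ B := (abs_nonneg _).trans (hB 0)
  induction k with
  | zero => simp [transfer]
  | succ k ih =>
    rw [transfer, pow_succ']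
    refine (norm_mul_le _ _).trans (mul_le_mul ?_ ih (norm_nonneg _) (by positivity))
    rw [norm_fin_two]
    have := hB (θ + k * α)
    simp only [abs_neg, abs_one, abs_zero, add_zero]
    exact max_le (by linarith) (by linarith)

lemma abs_coeff_le (lam E x : ℝ) : |coeff lam E x| ≤ |E| + 2 * |lam| := by
  rw [coeff]
  refine (abs_sub _ _).trans ?_
  rw [abs_mul, abs_mul, abs_two]
  have := Real.abs_cos_le_one (2 * Real.pi * x)
  have h2 := mul_le_mul_of_nonneg_left this (by positivity : 0 ≤ 2 * |lam|)
  linarith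

/-- Uniform exponential growth rate of the continuants. -/
theorem exists_growth_rate {lam : ℝ} (hlam : 1 < |lam|) (α E : ℝ) : ∃ L : ℝ, 0 < L ∧
    (∀ ε > 0, ∃ C > 0, ∀ θ (k : ℕ), |cont (coeff lam E) α θ k| ≤ C * Real.exp (k * (L + ε))) ∧
    ∀ K : ℕ, 2 ≤ K → ∃ k : ℕ, k ≤ K ∧ K ≤ k + 2 ∧ ∃ θ,
      Real.exp (k * L) / 8 ≤ |cont (coeff lam E) α θ k| := by
  set w := coeff lam E with hw
  set S : ℕ → ℝ := fun k => ⨆ θ, ‖transfer w α θ k‖ with hS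
  have hbdd : ∀ k, BddAbove (Set.range fun θ => ‖transfer w α θ k‖) := fun k =>
    ⟨_, by rintro _ ⟨θ, rfl⟩; exact norm_transfer_le (abs_coeff_le lam E) α θ k⟩
  have hle : ∀ k θ, ‖transfer w α θ k‖ ≤ S k := fun k θ => le_ciSup (hbdd k) θ
  have hcont : ∀ k θ, |cont w α θ k| ≤ S k := by
    intro k θ
    refine le_trans ?_ (hle k θ)
    match k with
    | 0 => simp [cont, transfer]
    | 1 =>
      have : transfer w α θ 1 = !![w θ, -1; 1, 0] := by simp [transfer]
      rw [this, norm_fin_two]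
      exact le_max_of_le_left (by simp [cont])
    | k + 2 =>
      rw [transfer_eq_cont, norm_fin_two]
      exact le_max_of_le_left (by simp)
  have hSlow : ∀ k, |lam| ^ k ≤ S k := fun k => pow_le_of_cont_le lam α E (hcont k)
  have hlam0 : 0 < |lam| := by linarith
  have hSpos : ∀ k, 0 < S k := fun k => (pow_pos hlam0 k).trans_le (hSlow k)
  have hsub : Subadditive fun k => Real.log (S k) := by
    intro j k
    rw [← Real.log_mul (hSpos j).ne' (hSpos k).ne']
    refine Real.log_le_log (hSpos _) (ciSup_le fun θ => ?_)
    rw [transfer_add, mul_comm (S j)]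
    exact (norm_mul_le _ _).trans (mul_le_mul (hle _ _) (hle _ _) (norm_nonneg _) (hSpos k).le)
  have hlow : ∀ k : ℕ, k ≠ 0 → Real.log |lam| ≤ Real.log (S k) / k := by
    intro k hk
    rw [le_div_iff₀ (by positivity), mul_comm, ← Real.log_pow]
    exact Real.log_le_log (pow_pos hlam0 k) (hSlow k)
  have hb : BddBelow (Set.range fun k : ℕ => Real.log (S k) / k) := by
    refine ⟨0, ?_⟩
    rintro _ ⟨k, rfl⟩
    rcases eq_or_ne k 0 with rfl | hk
    · simp
    · exact (Real.log_nonneg hlam.le).trans (hlow k hk)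
  have hlim := hsub.tendsto_lim hb
  have hL : Real.log |lam| ≤ hsub.lim := by
    refine ge_of_tendsto hlim ?_
    filter_upwards [eventually_ne_atTop 0] with k hk using hlow k hk
  have hL0 : 0 < hsub.lim := (Real.log_pos hlam).trans_le hL
  refine ⟨hsub.lim, hL0, fun ε hε => ?_, fun K hK => ?_⟩
  · obtain ⟨k0, hk0⟩ := (hlim.eventually (gt_mem_nhds (lt_add_of_pos_right _ hε))).exists_forall_of_atTop
    refine ⟨1 + ∑ k ∈ Finset.range (k0 + 1), S k, ?_, fun θ k => ?_⟩
    · have : 0 ≤ ∑ k ∈ Finset.range (k0 + 1), S k := Finset.sum_nonneg fun k _ => (hSpos k).le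
      linarith
    refine (hcont k θ).trans ?_
    have hsum : 0 ≤ ∑ k ∈ Finset.range (k0 + 1), S k := Finset.sum_nonneg fun k _ => (hSpos k).le
    have hexp1 : 1 ≤ Real.exp (k * (hsub.lim + ε)) := Real.one_le_exp (by positivity)
    rcases lt_or_ge k (k0 + 1) with h | h
    · have := Finset.single_le_sum (f := S) (fun k _ => (hSpos k).le) (Finset.mem_range.mpr h)
      nlinarith
    · have h1 := hk0 k (by omega)
      have hkpos : (0 : ℝ) < k := by exact_mod_cast (by omega : 0 < k)
      rw [div_lt_iff₀ hkpos, mul_comm, Real.log_lt_iff_lt_exp (hSpos k)] at h1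
      nlinarith
  · obtain ⟨k, rfl⟩ : ∃ k, K = k + 2 := ⟨K - 2, by omega⟩
    have h1 := hsub.lim_le_div hb (n := k + 2) (by omega)
    rw [le_div_iff₀ (by positivity), mul_comm, Real.le_log_iff_exp_le (hSpos _)] at h1
    obtain ⟨θ, hθ⟩ := exists_lt_of_lt_ciSup (show S (k + 2) / 2 < ⨆ θ, ‖transfer w α θ (k + 2)‖
      from half_lt_self (hSpos _))
    rw [transfer_eq_cont, norm_fin_two] at hθ
    simp only [abs_neg] at hθ
    have hmono : ∀ j : ℕ, j ≤ k + 2 → Real.exp (j * hsub.lim) ≤ Real.exp ((k + 2 : ℕ) * hsub.lim) :=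
      fun j hj => Real.exp_le_exp.mpr (by gcongr)
    by_contra! hcon
    have c1 := hcon (k + 2) le_rfl (by omega) θ
    have c2 := hcon (k + 1) (by omega) (by omega) θ
    have c3 := hcon (k + 1) (by omega) (by omega) (θ + α)
    have c4 := hcon k (by omega) (by omega) (θ + α)
    have m1 := hmono (k + 1) (by omega)
    have m2 := hmono k (by omega)
    have hS0 := hSpos (k + 2)
    rcases max_choice (|cont w α θ (k + 2)| + |cont w α (θ + α) (k + 1)|)
      (|cont w α θ (k + 1)| + |cont w α (θ + α) k|) with h | h <;> rw [h] at hθ <;> linarith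

end Growth

lemma exists_large_node {ι : Type*} [DecidableEq ι] {R : Polynomial ℝ} {s : Finset ι} {v : ι → ℝ}
    (hv : Set.InjOn v s) (hR : R.natDegree < s.card) {z ρ : ℝ}
    (h : ∀ i ∈ s, ∏ j ∈ s.erase i, |z - v j| ≤ ρ * ∏ j ∈ s.erase i, |v i - v j|) :
    ∃ i ∈ s, |R.eval z| ≤ s.card * ρ * |R.eval (v i)| := by
  have hne : s.Nonempty := Finset.card_pos.mp (by omega)
  have hb : ∀ i ∈ s, |(Lagrange.basis s v i).eval z| ≤ ρ := by
    intro i hi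
    rw [Lagrange.basis, Polynomial.eval_prod, Finset.abs_prod]
    have h0 : 0 < ∏ j ∈ s.erase i, |v i - v j| := by
      refine Finset.prod_pos fun j hj => abs_pos.mpr (sub_ne_zero.mpr fun h => ?_)
      have := hv hi (Finset.mem_of_mem_erase hj) h
      exact (Finset.ne_of_mem_erase hj) this.symm
    rw [← mul_le_mul_iff_left₀ h0]
    refine le_trans (le_of_eq ?_) (h i hi)
    rw [← Finset.prod_mul_distrib]
    refine Finset.prod_congr rfl fun j hj => ?_
    have h1 : v i - v j ≠ 0 := sub_ne_zero.mpr fun h =>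
      (Finset.ne_of_mem_erase hj) (hv hi (Finset.mem_of_mem_erase hj) h).symm
    rw [Lagrange.basisDivisor, ← abs_mul]
    congr 1
    simp only [Polynomial.eval_mul, Polynomial.eval_C, Polynomial.eval_sub, Polynomial.eval_X]
    field_simp
  by_contra! hcon
  have hdeg : R.degree < s.card :=
    (Polynomial.degree_le_natDegree).trans_lt (by exact_mod_cast hR)
  have hinterp := Lagrange.eq_interpolate hv hdeg
  have h1 : |R.eval z| ≤ ∑ i ∈ s, |R.eval (v i)| * ρ := by
    conv_lhs => rw [hinterp]
    rw [Lagrange.interpolate_apply, Polynomial.eval_finsetSum]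
    refine (Finset.abs_sum_le_sum_abs _ _).trans (Finset.sum_le_sum fun i hi => ?_)
    rw [Polynomial.eval_mul, Polynomial.eval_C, abs_mul]
    exact mul_le_mul_of_nonneg_left (hb i hi) (abs_nonneg _)
  have hc : (0 : ℝ) < s.card := by exact_mod_cast Finset.card_pos.mpr hne
  have h2 : ∑ i ∈ s, |R.eval (v i)| * ρ < ∑ i ∈ s, |R.eval z| / s.card := by
    refine Finset.sum_lt_sum_of_nonempty hne fun i hi => ?_
    rw [lt_div_iff₀ hc]
    linarith [hcon i hi]
  rw [Finset.sum_const, nsmul_eq_mul, mul_div_cancel₀ _ hc.ne'] at h2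
  linarith

lemma abs_cos_sub_cos (x y : ℝ) : |Real.cos (2 * Real.pi * x) - Real.cos (2 * Real.pi * y)| =
    2 * (|Real.sin (Real.pi * (x + y))| * |Real.sin (Real.pi * (y - x))|) := by
  rw [Real.cos_sub_cos, abs_mul, abs_mul, show |(-2 : ℝ)| = 2 by norm_num]
  rw [show (2 * Real.pi * x + 2 * Real.pi * y) / 2 = Real.pi * (x + y) by ring,
    show (2 * Real.pi * x - 2 * Real.pi * y) / 2 = -(Real.pi * (y - x)) by ring, Real.sin_neg,
    abs_neg, mul_assoc]

/-- The centre, on the circle, of the orbit segment of length `k` starting at site `j`. -/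
noncomputable def centre (α : ℝ) (k : ℕ) (j : ℤ) : ℝ := (j + ((k : ℝ) - 1) / 2) * α

lemma SinLower.sin_ne_zero {α c r : ℝ} (hc : 0 < c) (h : SinLower α c r) {n : ℤ} (hn : n ≠ 0) :
    0 < |Real.sin (Real.pi * (n * α))| := by
  refine lt_of_lt_of_le ?_ (h n hn)
  have : 0 < |(n : ℝ)| := by simpa using hn
  positivity

lemma cos_centre_sub (α : ℝ) (k : ℕ) (i j : ℤ) :
    |Real.cos (2 * Real.pi * centre α k i) - Real.cos (2 * Real.pi * centre α k j)| =
    2 * (|Real.sin (Real.pi * (((i + k - 1 + j : ℤ) : ℝ) * α))| *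
      |Real.sin (Real.pi * (((-i + j : ℤ) : ℝ) * α))|) := by
  rw [abs_cos_sub_cos]
  congr 5 <;> (rw [centre, centre]; push_cast; ring)

theorem exists_window_bound {α c r : ℝ} (hα : Irrational α) (hc : 0 < c) (hr : 0 < r)
    (h : SinLower α c r) (B : ℝ) {ε : ℝ} (hε : 0 < ε) :
    ∃ m₀ : ℕ, ∀ m ≥ m₀, ∀ (a i : ℤ) (k : ℕ) (φ : ℝ),
      (∀ j ∈ (Finset.Ico a (a + m)).erase i, i + k - 1 + j ≠ 0 ∧
        |((i + k - 1 + j : ℤ) : ℝ)| ≤ B * m ∧ |((-i + j : ℤ) : ℝ)| ≤ B * m) →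
      ∏ j ∈ (Finset.Ico a (a + m)).erase i,
        |Real.cos (2 * Real.pi * φ) - Real.cos (2 * Real.pi * centre α k j)| ≤
      Real.exp (2 * ε * m) * ∏ j ∈ (Finset.Ico a (a + m)).erase i,
        |Real.cos (2 * Real.pi * centre α k i) - Real.cos (2 * Real.pi * centre α k j)| := by
  obtain ⟨m₀, hm₀⟩ := prod_sin_le hα hc hr h B hε
  refine ⟨m₀, fun m hm a i k φ hj => ?_⟩
  have h1 := hm₀ m hm a i (i + k - 1) (φ + ((k : ℝ) - 1) / 2 * α)
    fun j hj' => ⟨(hj j hj').1, (hj j hj').2.1⟩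
  have h2 := hm₀ m hm a i (-i) (((k : ℝ) - 1) / 2 * α - φ) fun j hj' =>
    ⟨fun h0 => Finset.ne_of_mem_erase hj' (by omega), (hj j hj').2.2⟩
  simp only [cos_centre_sub]
  simp only [abs_cos_sub_cos, Finset.prod_mul_distrib]
  have h3 := mul_le_mul h1 h2 (Finset.prod_nonneg fun _ _ => abs_nonneg _)
    (by positivity [Finset.prod_nonneg (s := (Finset.Ico a (a + m)).erase i) (f := fun j : ℤ =>
      |Real.sin (Real.pi * (((i + k - 1 + j : ℤ) : ℝ) * α))|) fun _ _ => abs_nonneg _])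
  have h4 : ∀ j : ℤ, φ + centre α k j = φ + ((k : ℝ) - 1) / 2 * α + j * α := fun j => by
    rw [centre]; ring
  have h5 : ∀ j : ℤ, centre α k j - φ = ((k : ℝ) - 1) / 2 * α - φ + j * α := fun j => by
    rw [centre]; ring
  simp only [h4, h5]
  rw [show Real.exp (2 * ε * m) = Real.exp (ε * m) * Real.exp (ε * m) by
    rw [← Real.exp_add]; ring_nf]
  have h6 : (0 : ℝ) ≤ ∏ j ∈ (Finset.Ico a (a + m)).erase i, (2 : ℝ) := by positivity
  have h7 := mul_le_mul_of_nonneg_left h3 h6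
  linarith

theorem exists_large_cont {α c r : ℝ} (hα : Irrational α) (hc : 0 < c) (hr : 0 < r)
    (h : SinLower α c r) (lam E : ℝ) {ε : ℝ} (hε : 0 < ε) :
    ∃ k₀ : ℕ, ∀ k ≥ k₀, ∀ y : ℤ, k ≤ y → y ≤ k + 2 → ∀ θ, ∃ j : ℤ,
      (y - 8 * (k / 10 : ℕ) ≤ j ∧ j < y - (k / 10 : ℕ) ∨
        -8 * (k / 10 : ℕ) - 15 ≤ j ∧ j ≤ -5 * (k / 10 : ℕ) - 6) ∧
      |cont (coeff lam E) α θ k| ≤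
        (k + 1) * Real.exp (2 * ε * (k + 1)) * |cont (coeff lam E) α (j * α) k| := by
  obtain ⟨m₀, hm₀⟩ := exists_window_bound hα hc hr h 40 hε
  refine ⟨10 * (m₀ + 20), fun k hk y hy1 hy2 θ => ?_⟩
  obtain ⟨R, hRd, hR⟩ := exists_poly_cos lam α E k
  set q := k / 10 with hq
  have hq0 : m₀ + 20 ≤ q := by omega
  have hkq : k < 10 * q + 10 := by omega
  have hkq' : 10 * q ≤ k := by omega
  set m₁ := k + 1 - 7 * q with hm₁
  set m₂ := 7 * q with hm₂
  set a₁ : ℤ := -5 * q - 5 - m₁ with ha₁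
  set a₂ : ℤ := y - 8 * q with ha₂
  set J₁ := Finset.Ico a₁ (a₁ + m₁) with hJ₁
  set J₂ := Finset.Ico a₂ (a₂ + m₂) with hJ₂
  have hmem : ∀ j ∈ J₁ ∪ J₂, (y - 8 * q ≤ j ∧ j < y - q ∨ -8 * q - 15 ≤ j ∧ j ≤ -5 * q - 6) := by
    intro j hj
    rw [Finset.mem_union, hJ₁, hJ₂, Finset.mem_Ico, Finset.mem_Ico] at hj
    omega
  have hdisj : Disjoint J₁ J₂ := by
    rw [Finset.disjoint_left]
    intro j hj hj'
    rw [hJ₁, Finset.mem_Ico] at hj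
    rw [hJ₂, Finset.mem_Ico] at hj'
    omega
  have hne : ∀ i ∈ J₁ ∪ J₂, ∀ j ∈ J₁ ∪ J₂, i + k - 1 + j ≠ 0 ∧
      |i + k - 1 + j| ≤ 120 * q ∧ |-i + j| ≤ 120 * q := by
    intro i hi j hj
    have h1 := hmem i hi
    have h2 := hmem j hj
    rw [abs_le, abs_le]
    omega
  have hcast : ∀ (x : ℤ) (m : ℕ), 3 * q ≤ m → |x| ≤ 120 * q → |(x : ℝ)| ≤ 40 * m := by
    intro x m hm hx
    have h1 : |(x : ℝ)| ≤ 120 * q := by exact_mod_cast hx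
    have h2 : (3 * q : ℝ) ≤ m := by exact_mod_cast hm
    linarith
  set v : ℤ → ℝ := fun j => Real.cos (2 * Real.pi * centre α k j) with hv
  have hinj : Set.InjOn v (J₁ ∪ J₂ : Finset ℤ) := by
    intro i hi j hj hij
    by_contra hcon
    have h1 := cos_centre_sub α k i j
    rw [show Real.cos (2 * Real.pi * centre α k i) = Real.cos (2 * Real.pi * centre α k j) from hij,
      sub_self, abs_zero] at h1
    have h2 := h.sin_ne_zero hc (hne i hi j hj).1
    have h3 := h.sin_ne_zero hc (show -i + j ≠ 0 by omega)
    have := mul_pos h2 h3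
    linarith
  have hcard : (J₁ ∪ J₂).card = k + 1 := by
    rw [Finset.card_union_of_disjoint hdisj, hJ₁, hJ₂, Int.card_Ico, Int.card_Ico]
    omega
  set φ := θ + ((k : ℝ) - 1) / 2 * α with hφ
  obtain ⟨i, hi, hRi⟩ := exists_large_node (R := R) hinj (by omega) (z := Real.cos (2 * Real.pi * φ))
    (ρ := Real.exp (2 * ε * (k + 1))) (fun i hi => by
      have hsplit : ∀ f : ℤ → ℝ, ∏ j ∈ (J₁ ∪ J₂).erase i, f j =
          (∏ j ∈ J₁.erase i, f j) * ∏ j ∈ J₂.erase i, f j := fun f => by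
        rw [Finset.erase_union_distrib, Finset.prod_union]
        exact hdisj.mono (Finset.erase_subset _ _) (Finset.erase_subset _ _)
      rw [hsplit, hsplit]
      have h1 := hm₀ m₁ (by omega) a₁ i k φ fun j hj => by
        obtain ⟨x1, x2, x3⟩ := hne i hi j (Finset.mem_union_left _ (Finset.mem_of_mem_erase hj))
        exact ⟨x1, hcast _ _ (by omega) x2, hcast _ _ (by omega) x3⟩
      have h2 := hm₀ m₂ (by omega) a₂ i k φ fun j hj => by
        obtain ⟨x1, x2, x3⟩ := hne i hi j (Finset.mem_union_right _ (Finset.mem_of_mem_erase hj))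
        exact ⟨x1, hcast _ _ (by omega) x2, hcast _ _ (by omega) x3⟩
      refine (mul_le_mul h1 h2 (Finset.prod_nonneg fun _ _ => abs_nonneg _)
        (mul_nonneg (Real.exp_nonneg _) (Finset.prod_nonneg fun _ _ => abs_nonneg _))).trans
        (le_of_eq ?_)
      have : Real.exp (2 * ε * (k + 1)) = Real.exp (2 * ε * m₁) * Real.exp (2 * ε * m₂) := by
        have h3 : ((k : ℝ) + 1) = m₁ + m₂ := by
          have : k + 1 = m₁ + m₂ := by omega
          exact_mod_cast this
        rw [h3, ← Real.exp_add]; ring_nf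
      rw [this]
      ring)
  refine ⟨i, hmem i hi, ?_⟩
  rw [← hR, hcard, show φ - ((k : ℝ) - 1) / 2 * α = θ by rw [hφ]; ring] at hRi
  have hvi : R.eval (v i) = cont (coeff lam E) α (i * α) k := by
    rw [hv]; simp only
    rw [← hR, centre]; congr 1; ring
  rw [hvi] at hRi
  push_cast at hRi
  exact hRi

/-- If the continuant of the segment of length `k` starting at `j` is exponentially large, then a
solution is small well inside of that segment. -/
lemma abs_mul_le_of_green {w : ℝ → ℝ} {α : ℝ} {u : ℤ → ℝ}
    (hu : ∀ n : ℤ, u (n + 1) + u (n - 1) = w (n * α) * u n) {C₀ C A : ℝ} (hC : 0 < C) (hA : 0 ≤ A)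
    (hcont : ∀ θ (k : ℕ), |cont w α θ k| ≤ C * Real.exp (k * A))
    {j t : ℤ} {k q : ℕ} (h1 : j + q ≤ t) (h2 : t + q < j + k)
    (hb1 : |u (j + k)| ≤ C₀) (hb2 : |u (j - 1)| ≤ C₀) :
    |u t| * |cont w α (j * α) k| ≤ 2 * C * Real.exp ((k - q) * A) * C₀ := by
  obtain ⟨i, hi⟩ : ∃ i : ℕ, t = j + i := ⟨(t - j).toNat, by omega⟩
  obtain ⟨l, hl⟩ : ∃ l : ℕ, k = i + l + 1 := ⟨k - 1 - i, by omega⟩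
  have hg := green_formula hu l i j
  have hC₀ : 0 ≤ C₀ := (abs_nonneg _).trans hb1
  have hmono : ∀ n : ℕ, n + q ≤ k → C * Real.exp (n * A) ≤ C * Real.exp ((k - q) * A) := by
    intro n hn
    have : (n : ℝ) + q ≤ k := by exact_mod_cast hn
    gcongr
    linarith
  rw [← abs_mul, hi, hl, hg]
  refine (abs_add_le _ _).trans ?_
  rw [abs_mul, abs_mul, ← hl]
  have e1 := (hcont (j * α) i).trans (hmono i (by omega))
  have e2 := (hcont ((j + i + 1 : ℤ) * α) l).trans (hmono l (by omega))
  have e3 : |u (j + i + l + 1)| ≤ C₀ := by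
    rwa [show j + (i : ℤ) + l + 1 = j + k by rw [hl]; push_cast; ring]
  have h3 := mul_le_mul e1 e3 (abs_nonneg _) (by positivity)
  have h4 := mul_le_mul e2 hb2 (abs_nonneg _) (by positivity)
  linarith

lemma solution_eq_zero {R : Type*} [Ring R] {w : ℤ → R} {u : ℤ → R}
    (hu : ∀ n : ℤ, u (n + 1) + u (n - 1) = w n * u n)
    (h0 : u 0 = 0) (h1 : u 1 = 0) : u = 0 := by
  have key : ∀ n : ℕ, (u n = 0 ∧ u (n + 1) = 0) ∧ (u (-n) = 0 ∧ u (-n + 1) = 0) := by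
    intro n
    induction n with
    | zero => simp [h0, h1]
    | succ n ih =>
      obtain ⟨⟨a, b⟩, c, d⟩ := ih
      have e1 := hu (n + 1)
      have e2 := hu (-n)
      rw [b, show (n : ℤ) + 1 - 1 = n by ring, a] at e1
      rw [c, d] at e2
      push_cast
      refine ⟨⟨b, by simpa using e1⟩, ?_, ?_⟩
      · rw [show -((n : ℤ) + 1) = -n - 1 by ring]; simpa using e2
      · rw [show -((n : ℤ) + 1) + 1 = -n by ring]; exact c
  funext n
  obtain ⟨m, rfl | rfl⟩ := n.eq_nat_or_neg
  · exact (key m).1.1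
  · exact (key m).2.1

lemma sq_le_exp {γ y : ℝ} (hγ : 0 < γ) (hy : 0 ≤ y) :
    (y + 1) * (1 + 3 * y) ≤ 12 / γ ^ 2 * Real.exp γ * Real.exp (γ * y) := by
  have h1 := Real.add_one_le_exp (γ * (y + 1) / 2)
  have h2 : γ * (y + 1) / 2 ≤ Real.exp (γ * (y + 1) / 2) := by linarith
  have h3 := mul_le_mul h2 h2 (by positivity) (by positivity)
  rw [← Real.exp_add, show γ * (y + 1) / 2 + γ * (y + 1) / 2 = γ + γ * y by ring, Real.exp_add] at h3
  calc (y + 1) * (1 + 3 * y) ≤ 12 / γ ^ 2 * (γ * (y + 1) / 2 * (γ * (y + 1) / 2)) := by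
        field_simp; nlinarith
    _ ≤ 12 / γ ^ 2 * (Real.exp γ * Real.exp (γ * y)) := by gcongr
    _ = _ := by ring

theorem decay_right {α c r : ℝ} (hα : Irrational α) (hc : 0 < c) (hr : 0 < r)
    (h : SinLower α c r) {lam : ℝ} (hlam : 1 < |lam|) {E : ℝ} {u : ℤ → ℝ}
    (hu : ∀ n : ℤ, u (n + 1) + u (n - 1) = coeff lam E (n * α) * u n) {C₀ : ℝ}
    (hC₀ : ∀ n : ℤ, |u n| ≤ C₀ * (1 + |(n : ℝ)|)) (hne : u ≠ 0) :
    ∃ C γ : ℝ, 0 < γ ∧ ∀ y : ℕ, |u y| ≤ C * Real.exp (-(γ * y)) := by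
  obtain ⟨L, hL, hup, hlow⟩ := exists_growth_rate hlam α E
  set ε := L / 66 with hε
  have hε0 : 0 < ε := by positivity
  obtain ⟨C, hC, hcont⟩ := hup ε hε0
  obtain ⟨k₀, hk₀⟩ := exists_large_cont hα hc hr h lam E hε0
  have hC₀' : 0 ≤ C₀ := by
    have := (abs_nonneg _).trans (hC₀ 0); simpa using this
  set γ := L / 80 with hγ
  have hγ0 : 0 < γ := by positivity
  set C₂ := 16 * C * C₀ * (12 / γ ^ 2 * Real.exp γ) with hC₂
  have hC₂0 : 0 ≤ C₂ := by positivity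
  -- smallness of `u` at sites well inside a segment with large continuant
  have small : ∀ (y k : ℕ) (j t : ℤ) (θ : ℝ), 150 ≤ k → k ≤ y → y ≤ k + 2 →
      j + (k / 10 : ℕ) ≤ t → t + (k / 10 : ℕ) < j + k → |j| ≤ y →
      Real.exp (k * L) / 8 ≤ |cont (coeff lam E) α θ k| →
      |cont (coeff lam E) α θ k| ≤
        (k + 1) * Real.exp (2 * ε * (k + 1)) * |cont (coeff lam E) α (j * α) k| →
      |u t| ≤ C₂ * Real.exp (-(γ * y)) := by
    intro y k j t θ hk hky hyk h1 h2 hj h3 h4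
    set q := k / 10 with hq
    have hyr : (k : ℝ) ≤ y := by exact_mod_cast hky
    have hyr2 : (y : ℝ) ≤ k + 2 := by exact_mod_cast hyk
    have hy150 : (150 : ℝ) ≤ y := by exact_mod_cast hk.trans hky
    have hqk : ((k : ℝ) + 1) ≤ 11 * q := by
      have : k + 1 ≤ 11 * q := by omega
      exact_mod_cast this
    have hqy : (y : ℝ) ≤ 20 * q := by
      have : y ≤ 20 * q := by omega
      exact_mod_cast this
    have hjr : |(j : ℝ)| ≤ y := by exact_mod_cast hj
    have hb : ∀ n : ℤ, |(n : ℝ)| ≤ 3 * y → |u n| ≤ C₀ * (1 + 3 * y) := fun n hn =>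
      (hC₀ n).trans (by gcongr)
    have hg := abs_mul_le_of_green hu hC (show 0 ≤ L + ε by positivity) hcont h1 h2
      (hb (j + k) (by
        push_cast
        rw [abs_le] at hjr ⊢
        constructor <;> linarith))
      (hb (j - 1) (by
        push_cast
        rw [abs_le] at hjr ⊢
        constructor <;> linarith))
    have hk1 : (0 : ℝ) ≤ k + 1 := by positivity
    have h5 : |u t| * (Real.exp (k * L) / 8) ≤ (k + 1) * Real.exp (2 * ε * (k + 1)) *
        (2 * C * Real.exp ((k - q) * (L + ε)) * (C₀ * (1 + 3 * y))) :=
      calc |u t| * (Real.exp (k * L) / 8)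
          ≤ |u t| * ((k + 1) * Real.exp (2 * ε * (k + 1)) * |cont (coeff lam E) α (j * α) k|) :=
            mul_le_mul_of_nonneg_left (h3.trans h4) (abs_nonneg _)
        _ = (k + 1) * Real.exp (2 * ε * (k + 1)) * (|u t| * |cont (coeff lam E) α (j * α) k|) := by
            ring
        _ ≤ _ := by gcongr
    have h6 : Real.exp (2 * ε * (k + 1)) * Real.exp ((k - q) * (L + ε)) ≤
        Real.exp (k * L) * Real.exp (-(2 * γ * y)) := by
      rw [← Real.exp_add, ← Real.exp_add, Real.exp_le_exp]
      have hLe : L = 66 * ε := by rw [hε]; ring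
      have hγe : γ = 66 * ε / 80 := by rw [hγ, hLe]
      rw [hγe, hLe]
      have h7 : 0 ≤ (q : ℝ) := by positivity
      nlinarith
    have hE : 0 < Real.exp (k * L) := Real.exp_pos _
    have h8 : |u t| ≤ 16 * C * C₀ * ((y + 1) * (1 + 3 * y)) * Real.exp (-(2 * γ * y)) := by
      rw [← mul_le_mul_iff_left₀ (show 0 < Real.exp (k * L) / 8 by positivity)]
      refine h5.trans ?_
      calc _ = 2 * C * C₀ * ((k + 1) * (1 + 3 * y)) *
            (Real.exp (2 * ε * (k + 1)) * Real.exp ((k - q) * (L + ε))) := by ring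
        _ ≤ 2 * C * C₀ * ((y + 1) * (1 + 3 * y)) *
            (Real.exp (k * L) * Real.exp (-(2 * γ * y))) := by gcongr
        _ = _ := by ring
    refine h8.trans ?_
    calc _ ≤ 16 * C * C₀ * (12 / γ ^ 2 * Real.exp γ * Real.exp (γ * y)) *
          Real.exp (-(2 * γ * y)) := by
          refine mul_le_mul_of_nonneg_right (mul_le_mul_of_nonneg_left
            (sq_le_exp hγ0 (by positivity)) (by positivity)) (Real.exp_nonneg _)
      _ = C₂ * (Real.exp (γ * y) * Real.exp (-(2 * γ * y))) := by rw [hC₂]; ring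
      _ = _ := by rw [← Real.exp_add]; ring_nf
  have hpos : 0 < max |u 0| |u 1| := by
    by_contra! hcon
    have a0 := abs_nonpos_iff.mp ((le_max_left _ _).trans hcon)
    have a1 := abs_nonpos_iff.mp ((le_max_right _ _).trans hcon)
    exact hne (solution_eq_zero hu a0 a1)
  have hlim : Tendsto (fun y : ℕ => C₂ * Real.exp (-(γ * y))) atTop (𝓝 0) := by
    have : Tendsto (fun y : ℕ => γ * (y : ℝ)) atTop atTop :=
      tendsto_natCast_atTop_atTop.const_mul_atTop hγ0
    simpa using (Real.tendsto_exp_neg_atTop_nhds_zero.comp this).const_mul C₂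
  obtain ⟨y₁, hy₁⟩ := (hlim.eventually (gt_mem_nhds hpos)).exists_forall_of_atTop
  set y₂ := max y₁ (k₀ + 300) with hy₂
  have hlarge : ∀ y : ℕ, y₂ ≤ y → |u y| ≤ C₂ * Real.exp (-(γ * y)) := by
    intro y hy
    obtain ⟨k, hky, hyk, θ, hθ⟩ := hlow y (by omega)
    obtain ⟨j, hj, hjc⟩ := hk₀ k (by omega) y (by exact_mod_cast hky) (by exact_mod_cast hyk) θ
    rcases hj with hj | hj
    · exact small y k j y θ (by omega) hky hyk (by omega) (by omega) (by rw [abs_le]; omega) hθ hjc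
    · exfalso
      have b0 := small y k j 0 θ (by omega) hky hyk (by omega) (by omega)
        (by rw [abs_le]; omega) hθ hjc
      have b1 := small y k j 1 θ (by omega) hky hyk (by omega) (by omega)
        (by rw [abs_le]; omega) hθ hjc
      have := hy₁ y (by omega)
      exact absurd (max_le b0 b1) (not_le.mpr this)
  refine ⟨max C₂ (C₀ * (1 + y₂) * Real.exp (γ * y₂)), γ, hγ0, fun y => ?_⟩
  rcases le_or_gt y₂ y with hy | hy
  · exact (hlarge y hy).trans (by gcongr; exact le_max_left _ _)
  · have hyr : (y : ℝ) ≤ y₂ := by exact_mod_cast hy.le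
    have b := hC₀ y
    rw [Int.cast_natCast, abs_of_nonneg (by positivity : (0 : ℝ) ≤ y)] at b
    calc |u y| ≤ C₀ * (1 + y₂) * 1 := by rw [mul_one]; exact b.trans (by gcongr)
      _ ≤ C₀ * (1 + y₂) * (Real.exp (γ * y₂) * Real.exp (-(γ * y))) := by
          gcongr
          rw [← Real.exp_add]
          exact Real.one_le_exp (by nlinarith)
      _ = C₀ * (1 + y₂) * Real.exp (γ * y₂) * Real.exp (-(γ * y)) := by ring
      _ ≤ _ := by gcongr; exact le_max_right _ _

/-- Anderson localization at phase `0`: polynomially bounded solutions decay exponentially. -/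
theorem localization {α c r : ℝ} (hα : Irrational α) (hc : 0 < c) (hr : 0 < r)
    (h : SinLower α c r) {lam : ℝ} (hlam : 1 < |lam|) {E : ℝ} {u : ℤ → ℝ}
    (hu : ∀ n : ℤ, u (n + 1) + u (n - 1) = coeff lam E (n * α) * u n) {C₀ : ℝ}
    (hC₀ : ∀ n : ℤ, |u n| ≤ C₀ * (1 + |(n : ℝ)|)) :
    ∃ C γ : ℝ, 0 < γ ∧ ∀ n : ℤ, |u n| ≤ C * Real.exp (-(γ * |(n : ℝ)|)) := by
  by_cases hne : u = 0
  · exact ⟨0, 1, one_pos, by simp [hne]⟩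
  obtain ⟨C₁, γ₁, hγ₁, h₁⟩ := decay_right hα hc hr h hlam hu hC₀ hne
  obtain ⟨C₂, γ₂, hγ₂, h₂⟩ := decay_right (u := fun n => u (-n)) (C₀ := C₀) hα hc hr h hlam
    (fun n => by
      have := hu (-n)
      rw [show ((-n : ℤ) : ℝ) * α = -(n * α) by push_cast; ring, coeff_neg] at this
      rw [← this, add_comm (u (-n + 1))]
      congr 2 <;> ring)
    (fun n => by simpa using hC₀ (-n))
    (fun h0 => hne (by funext n; simpa using congrFun h0 (-n)))
  have hC : 0 ≤ max C₁ C₂ := by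
    have := (abs_nonneg _).trans (h₁ 0)
    simp only [Nat.cast_zero, mul_zero, neg_zero, Real.exp_zero, mul_one] at this
    exact this.trans (le_max_left _ _)
  refine ⟨max C₁ C₂, min γ₁ γ₂, lt_min hγ₁ hγ₂, fun n => ?_⟩
  obtain ⟨m, rfl | rfl⟩ := n.eq_nat_or_neg
  · refine (h₁ m).trans ?_
    rw [Int.cast_natCast, abs_of_nonneg (by positivity : (0 : ℝ) ≤ m)]
    gcongr
    · exact le_max_left _ _
    · exact min_le_left _ _
  · refine (h₂ m).trans ?_
    rw [Int.cast_neg, abs_neg, Int.cast_natCast, abs_of_nonneg (by positivity : (0 : ℝ) ≤ m)]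
    gcongr
    · exact le_max_right _ _
    · exact min_le_right _ _

/-- The `n`-th Fourier coefficient of a `1`-periodic function. -/
noncomputable def cf (f : ℝ → ℂ) (n : ℤ) : ℂ := ∫ θ in (0 : ℝ)..1, e (-(n * θ)) * f θ

section Fourier

variable {f g : ℝ → ℂ}

/-- The continuous function on the circle defined by a continuous periodic function. -/
noncomputable def toCircle (f : ℝ → ℂ) (hf : Continuous f) (hper : Function.Periodic f 1) :
    C(AddCircle (1 : ℝ), ℂ) :=
  ⟨hper.lift, (QuotientAddGroup.isQuotientMap_mk _).continuous_iff.mpr hf⟩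

lemma toCircle_coe (hf : Continuous f) (hper : Function.Periodic f 1) (x : ℝ) :
    toCircle f hf hper (x : AddCircle (1 : ℝ)) = f x := rfl

lemma fourier_coe (n : ℤ) (x : ℝ) : fourier n (x : AddCircle (1 : ℝ)) = e (n * x) := by
  rw [fourier_coe_apply, e]
  congr 1; push_cast; ring

lemma fourierCoeff_toCircle (hf : Continuous f) (hper : Function.Periodic f 1) (n : ℤ) :
    fourierCoeff (toCircle f hf hper) n = cf f n := by
  rw [fourierCoeff_eq_intervalIntegral _ n 0, cf]
  simp only [fourier_coe, toCircle_coe]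
  simp

lemma hasSum_cf (hf : Continuous f) (hper : Function.Periodic f 1) (h : Summable (cf f)) (x : ℝ) :
    HasSum (fun n : ℤ => cf f n * e (n * x)) (f x) := by
  have h' : Summable (fourierCoeff (toCircle f hf hper)) := by
    convert h using 1
    funext n; exact fourierCoeff_toCircle hf hper n
  have := has_pointwise_sum_fourier_series_of_summable h' (x : AddCircle (1 : ℝ))
  simpa only [fourierCoeff_toCircle, fourier_coe, smul_eq_mul, toCircle_coe] using this

lemma tendsto_cf (hf : Continuous f) (hper : Function.Periodic f 1) :
    Tendsto (cf f) cofinite (𝓝 0) := by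
  have h := (hasSum_sq_fourierCoeff
    (ContinuousMap.toLp 2 AddCircle.haarAddCircle ℂ (toCircle f hf hper))).summable
  simp only [fourierCoeff_toLp, fourierCoeff_toCircle] at h
  have h2 := h.tendsto_cofinite_zero
  rw [tendsto_zero_iff_norm_tendsto_zero]
  have h3 := (Real.continuous_sqrt.tendsto 0).comp h2
  simpa [Function.comp_def, Real.sqrt_sq] using h3

lemma eq_zero_of_cf_eq_zero (hf : Continuous f) (hper : Function.Periodic f 1)
    (h : ∀ n, cf f n = 0) : f = 0 := by
  funext x
  have hs : Summable (cf f) := by rw [show cf f = fun _ => 0 from funext h]; exact summable_zero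
  have := hasSum_cf hf hper hs x
  simp only [h, zero_mul] at this
  exact this.unique hasSum_zero

lemma cf_intervalIntegrable (hf : Continuous f) (n : ℤ) (a b : ℝ) :
    IntervalIntegrable (fun θ => e (-(n * θ)) * f θ) MeasureTheory.volume a b := by
  refine Continuous.intervalIntegrable ?_ _ _
  exact (continuous_e.comp (by fun_prop)).mul hf

lemma cf_add (hf : Continuous f) (hg : Continuous g) (n : ℤ) :
    cf (fun θ => f θ + g θ) n = cf f n + cf g n := by
  rw [cf, cf, cf, ← intervalIntegral.integral_add (cf_intervalIntegrable hf n 0 1)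
    (cf_intervalIntegrable hg n 0 1)]
  simp only [mul_add]

lemma cf_const_mul (a : ℂ) (n : ℤ) : cf (fun θ => a * f θ) n = a * cf f n := by
  rw [cf, cf, ← intervalIntegral.integral_const_mul]
  congr 1; funext θ; ring

lemma cf_shift (hper : Function.Periodic f 1) (α : ℝ) (n : ℤ) :
    cf (fun θ => f (θ + α)) n = e (n * α) * cf f n := by
  have hp : Function.Periodic (fun θ => e (-(n * θ)) * f θ) 1 := by
    intro θ
    simp only [hper θ]
    rw [show -(n * (θ + 1) : ℝ) = -(n * θ) + ((-n : ℤ) : ℝ) by push_cast; ring, e_add, e_int,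
      mul_one]
  have h := hp.intervalIntegral_add_eq (t := 0) (s := 0 + α)
  rw [zero_add, zero_add, add_comm α 1] at h
  rw [cf, cf, h, ← intervalIntegral.integral_const_mul]
  have h2 := intervalIntegral.integral_comp_add_right (a := 0) (b := 1)
    (fun θ => e (n * α) * (e (-(n * θ)) * f θ)) α
  rw [zero_add] at h2
  rw [← h2]
  congr 1; funext θ
  rw [← mul_assoc, ← e_add]
  congr 2; ring

lemma cf_mul_e (n m : ℤ) : cf (fun θ => e (m * θ) * f θ) n = cf f (n - m) := by
  rw [cf, cf]
  congr 1; funext θ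
  rw [← mul_assoc, ← e_add]
  congr 2; push_cast; ring

lemma cf_mul_cos (hf : Continuous f) (n : ℤ) :
    cf (fun θ => ((2 * Real.cos (2 * Real.pi * θ) : ℝ) : ℂ) * f θ) n =
      cf f (n - 1) + cf f (n + 1) := by
  have h : (fun θ => ((2 * Real.cos (2 * Real.pi * θ) : ℝ) : ℂ) * f θ) =
      fun θ => e ((1 : ℤ) * θ) * f θ + e ((-1 : ℤ) * θ) * f θ := by
    funext θ
    rw [← e_add_e_neg]; push_cast; rw [one_mul, neg_one_mul]; ring
  rw [h, cf_add, cf_mul_e, cf_mul_e, sub_neg_eq_add]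
  · exact (continuous_e.comp (by fun_prop)).mul hf
  · exact (continuous_e.comp (by fun_prop)).mul hf

lemma norm_cf_le {M : ℝ} (hM : ∀ θ, ‖f θ‖ ≤ M) (n : ℤ) : ‖cf f n‖ ≤ M := by
  have := intervalIntegral.norm_integral_le_of_norm_le_const (a := 0) (b := 1) (C := M)
    (f := fun θ => e (-(n * θ)) * f θ) (fun θ _ => by rw [norm_mul, norm_e, one_mul]; exact hM θ)
  simpa [cf] using this

lemma hasDerivAt_e (n : ℤ) (θ : ℝ) :
    HasDerivAt (fun θ : ℝ => e (-(n * θ))) (-(2 * Real.pi * n * Complex.I) * e (-(n * θ))) θ := by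
  have h1 : HasDerivAt (fun θ : ℝ => ((2 * Real.pi * (-(n * θ)) : ℝ) : ℂ) * Complex.I)
      (((2 * Real.pi * (-n) : ℝ) : ℂ) * Complex.I) θ := by
    refine HasDerivAt.mul_const ?_ _
    refine HasDerivAt.ofReal_comp ?_
    have := (((hasDerivAt_id θ).const_mul (n : ℝ)).neg).const_mul (2 * Real.pi)
    simpa using this
  have h2 := h1.cexp
  convert! h2 using 1
  rw [e]; push_cast; ring

lemma cf_deriv (hf : ContDiff ℝ 1 f) (hper : Function.Periodic f 1) (n : ℤ) :
    cf (deriv f) n = (2 * Real.pi * n * Complex.I) * cf f n := by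
  have hd : ∀ x, HasDerivAt f (deriv f x) x := fun x =>
    (hf.differentiable one_ne_zero x).hasDerivAt
  have h := intervalIntegral.integral_mul_deriv_eq_deriv_mul (a := 0) (b := 1)
    (u := fun θ : ℝ => e (-(n * θ))) (v := f) (fun x _ => hasDerivAt_e n x) (fun x _ => hd x)
    (Continuous.intervalIntegrable (continuous_const.mul (continuous_e.comp (by fun_prop))) _ _)
    ((hf.continuous_deriv le_rfl).intervalIntegrable _ _)
  have h1 : e (-((n : ℝ) * 1)) = 1 := by
    rw [show -((n : ℝ) * 1) = ((-n : ℤ) : ℝ) by push_cast; ring, e_int]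
  have h2 : f 1 = f 0 := by simpa using hper 0
  rw [h1, h2, mul_zero, neg_zero, e_zero, sub_self, zero_sub] at h
  rw [cf, h, cf, ← intervalIntegral.integral_const_mul, ← intervalIntegral.integral_neg]
  congr 1; funext θ; ring

lemma exists_bound_of_periodic {E : Type*} [NormedAddCommGroup E] {f : ℝ → E} (hf : Continuous f)
    (hper : Function.Periodic f 1) : ∃ M > 0, ∀ θ, ‖f θ‖ ≤ M := by
  obtain ⟨M, hM⟩ := (isCompact_Icc (a := (0 : ℝ)) (b := 1)).exists_bound_of_continuousOn
    hf.continuousOn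
  refine ⟨max M 1, by positivity, fun θ => ?_⟩
  obtain ⟨y, hy, hyθ⟩ := hper.exists_mem_Ico₀ one_pos θ
  rw [hyθ]
  exact (hM y ⟨hy.1, hy.2.le⟩).trans (le_max_left _ _)

lemma norm_cf_le_pow (hf : ContDiff ℝ (⊤ : ℕ∞) f) (hper : Function.Periodic f 1) (K : ℕ) :
    ∃ M > 0, ∀ n : ℤ, ‖cf f n‖ * |(n : ℝ)| ^ K ≤ M := by
  induction K generalizing f with
  | zero =>
    obtain ⟨M, hM, h⟩ := exists_bound_of_periodic hf.continuous hper
    exact ⟨M, hM, fun n => by simpa using norm_cf_le h n⟩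
  | succ K ih =>
    have hd : ContDiff ℝ (⊤ : ℕ∞) (deriv f) := (contDiff_infty_iff_deriv.mp hf).2
    have hp : Function.Periodic (deriv f) 1 := by
      intro x
      have : (fun y => f (y + 1)) = f := funext hper
      rw [← deriv_comp_add_const, this]
    obtain ⟨M, hM, h⟩ := ih hd hp
    refine ⟨M, hM, fun n => ?_⟩
    have h1 := h n
    rw [cf_deriv (hf.of_le (by exact_mod_cast le_top)) hper, norm_mul] at h1
    have h2 : ‖(2 * Real.pi * n * Complex.I : ℂ)‖ = 2 * Real.pi * |(n : ℝ)| := by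
      simp [abs_of_pos Real.pi_pos]
    rw [h2] at h1
    have h3 : (1 : ℝ) ≤ 2 * Real.pi := by linarith [Real.pi_gt_three]
    have h4 : 0 ≤ ‖cf f n‖ * |(n : ℝ)| ^ (K + 1) := by positivity
    calc _ ≤ 2 * Real.pi * (‖cf f n‖ * |(n : ℝ)| ^ (K + 1)) := by nlinarith
      _ = 2 * Real.pi * |(n : ℝ)| * ‖cf f n‖ * |(n : ℝ)| ^ K := by ring
      _ ≤ M := h1

end Fourier

lemma norm_e_sub_one (x : ℝ) : ‖e x - 1‖ = 2 * |Real.sin (Real.pi * x)| := by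
  have h := Complex.norm_exp_I_mul_ofReal_sub_one (2 * Real.pi * x)
  rw [e, mul_comm, h, Real.norm_eq_abs, abs_mul, abs_two]
  congr 3; ring

lemma summable_of_mul_sq_le {b : ℤ → ℂ} {M : ℝ} (h : ∀ n : ℤ, n ≠ 0 → ‖b n‖ * |(n : ℝ)| ^ 2 ≤ M) :
    Summable fun n => ‖b n‖ := by
  have h1 : Summable fun n : ℤ => M * (1 / (n : ℝ) ^ 2) + if n = 0 then ‖b 0‖ else 0 :=
    ((Real.summable_one_div_int_pow.mpr one_lt_two).mul_left M).add
      (summable_of_ne_finset_zero (s := {0}) fun n hn => by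
        rw [if_neg (by simpa using hn)])
  refine Summable.of_nonneg_of_le (fun n => norm_nonneg _) (fun n => ?_) h1
  by_cases hn : n = 0
  · subst hn; simp
  · have h2 := h n hn
    rw [if_neg hn, add_zero, mul_one_div, le_div_iff₀ (by positivity), ← sq_abs]
    exact h2

theorem SinLower.exists_cohomology {α c r : ℝ} (hc : 0 < c) (h : SinLower α c r)
    {f : ℝ → ℝ} (hf : ContDiff ℝ (⊤ : ℕ∞) f) (hper : Function.Periodic f 1) :
    ∃ (β : ℝ → ℝ) (m : ℝ), Continuous β ∧ Function.Periodic β 1 ∧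
      ∀ θ, β (θ + α) - β θ = f θ - m := by
  set F : ℝ → ℂ := fun θ => (f θ : ℂ) with hF
  have hFs : ContDiff ℝ (⊤ : ℕ∞) F := Complex.ofRealCLM.contDiff.comp hf
  have hFp : Function.Periodic F 1 := fun θ => by simp only [hF, hper θ]
  obtain ⟨M, hM0, hM⟩ := norm_cf_le_pow hFs hFp (⌈r⌉₊ + 2)
  obtain ⟨M', hM0', hM'⟩ := norm_cf_le_pow hFs hFp 2
  have hFsum : Summable fun n => ‖cf F n‖ := summable_of_mul_sq_le fun n _ => hM' n
  have hlow : ∀ n : ℤ, n ≠ 0 → 2 * c / |(n : ℝ)| ^ ⌈r⌉₊ ≤ ‖e (n * α) - 1‖ := by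
    intro n hn
    have h1 : (1 : ℝ) ≤ |(n : ℝ)| := by
      exact_mod_cast Int.one_le_abs hn
    rw [norm_e_sub_one, mul_div_assoc]
    refine mul_le_mul_of_nonneg_left (le_trans ?_ (h n hn)) zero_le_two
    rw [← Real.rpow_natCast]
    gcongr
    exact Nat.le_ceil r
  have hne : ∀ n : ℤ, n ≠ 0 → e (n * α) - 1 ≠ 0 := by
    intro n hn
    rw [← norm_pos_iff]
    refine lt_of_lt_of_le ?_ (hlow n hn)
    have : 0 < |(n : ℝ)| := abs_pos.mpr (by exact_mod_cast hn)
    positivity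
  set b : ℤ → ℂ := fun n => if n = 0 then 0 else cf F n / (e (n * α) - 1) with hb
  have hbs : Summable fun n => ‖b n‖ := by
    refine summable_of_mul_sq_le (M := M / (2 * c)) fun n hn => ?_
    have h0 : 0 < |(n : ℝ)| := abs_pos.mpr (by exact_mod_cast hn)
    rw [hb]
    simp only [if_neg hn]
    rw [norm_div, le_div_iff₀ (by positivity), div_mul_eq_mul_div, div_mul_eq_mul_div,
      div_le_iff₀ (norm_pos_iff.mpr (hne n hn))]
    have h1 := hM n
    have h2 := hlow n hn
    rw [div_le_iff₀ (by positivity)] at h2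
    calc ‖cf F n‖ * |(n : ℝ)| ^ 2 * (2 * c)
        ≤ ‖cf F n‖ * |(n : ℝ)| ^ 2 * (‖e (n * α) - 1‖ * |(n : ℝ)| ^ ⌈r⌉₊) := by gcongr
      _ = ‖cf F n‖ * |(n : ℝ)| ^ (⌈r⌉₊ + 2) * ‖e (n * α) - 1‖ := by ring
      _ ≤ M * ‖e (n * α) - 1‖ := by gcongr
  have hterm : ∀ θ, Summable fun n : ℤ => b n * e (n * θ) := fun θ =>
    Summable.of_norm (by simpa [norm_e] using hbs)
  set B : ℝ → ℂ := fun θ => ∑' n : ℤ, b n * e (n * θ) with hB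
  have hBc : Continuous B := by
    refine continuous_tsum (fun n => ?_) hbs fun n θ => by rw [norm_mul, norm_e, mul_one]
    exact continuous_const.mul (continuous_e.comp (by fun_prop))
  have hBp : Function.Periodic B 1 := by
    intro θ
    simp only [hB, mul_add, e_add, mul_one, e_int]
  refine ⟨fun θ => (B θ).re, (cf F 0).re, Complex.continuous_re.comp hBc, fun θ => by
    simp only [hBp θ], fun θ => ?_⟩
  have h1 := hasSum_cf hFs.continuous hFp hFsum.of_norm θ
  have h2 : HasSum (fun n : ℤ => b n * e (n * (θ + α)) - b n * e (n * θ)) (B (θ + α) - B θ) :=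
    (hterm (θ + α)).hasSum.sub (hterm θ).hasSum
  have h3 : HasSum (fun n : ℤ => if n = 0 then cf F 0 else 0) (cf F 0) := hasSum_ite_eq 0 _
  have h4 : (fun n : ℤ => b n * e (n * (θ + α)) - b n * e (n * θ)) =
      fun n : ℤ => cf F n * e (n * θ) - if n = 0 then cf F 0 else 0 := by
    funext n
    by_cases hn : n = 0
    · subst hn; simp [hb, e_zero]
    · simp only [hb, if_neg hn, mul_add, e_add]
      field_simp [hne n hn]
      ring
  rw [h4] at h2
  have h5 := h2.unique (h1.sub h3)
  have h6 := congrArg Complex.re h5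
  simpa [hF] using h6

section FourierSeries

variable {u : ℤ → ℝ} {C γ : ℝ}

/-- The Fourier series with real coefficients `u`. -/
noncomputable def series (u : ℤ → ℝ) (θ : ℝ) : ℂ := ∑' n : ℤ, (u n : ℂ) * e (n * θ)

lemma summable_pow_mul_exp (hγ : 0 < γ) (k : ℕ) :
    Summable fun n : ℤ => |(n : ℝ)| ^ k * Real.exp (-(γ * |(n : ℝ)|)) := by
  have h := Real.summable_pow_mul_exp_neg_nat_mul k hγ
  refine Summable.of_nat_of_neg ?_ ?_ <;> simpa [neg_mul] using h

lemma summable_abs_of_decay (hγ : 0 < γ)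
    (hu : ∀ n : ℤ, |u n| ≤ C * Real.exp (-(γ * |(n : ℝ)|))) (k : ℕ) :
    Summable fun n : ℤ => |u n| * |(n : ℝ)| ^ k := by
  refine Summable.of_nonneg_of_le (fun n => by positivity) (fun n => ?_)
    ((summable_pow_mul_exp hγ k).mul_left C)
  calc |u n| * |(n : ℝ)| ^ k ≤ C * Real.exp (-(γ * |(n : ℝ)|)) * |(n : ℝ)| ^ k := by
        gcongr; exact hu n
    _ = _ := by ring

lemma hasSum_series (hs : Summable fun n => |u n|) (θ : ℝ) :
    HasSum (fun n : ℤ => (u n : ℂ) * e (n * θ)) (series u θ) :=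
  (Summable.of_norm (by simpa [norm_e] using hs)).hasSum

lemma iteratedDeriv_e (n : ℤ) (k : ℕ) (θ : ℝ) :
    iteratedDeriv k (fun θ : ℝ => e (n * θ)) θ = (2 * Real.pi * n * Complex.I) ^ k * e (n * θ) := by
  induction k generalizing θ with
  | zero => simp
  | succ k ih =>
    rw [iteratedDeriv_succ, show iteratedDeriv k (fun θ : ℝ => e (n * θ)) = _ from funext ih]
    have h := (hasDerivAt_e (-n) θ).const_mul ((2 * Real.pi * n * Complex.I) ^ k)
    have h2 : (fun θ : ℝ => e (-(((-n : ℤ) : ℝ) * θ))) = fun θ : ℝ => e (n * θ) := by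
      funext θ; congr 1; push_cast; ring
    have h4 : ∀ y : ℝ, e (-(((-n : ℤ) : ℝ) * y)) = e (n * y) := fun y => congrFun h2 y
    simp only [h4] at h
    rw [h.deriv]; push_cast; ring

lemma contDiff_e_mul (n : ℤ) : ContDiff ℝ (⊤ : ℕ∞) (fun θ : ℝ => e (n * θ)) := by
  unfold e
  refine ContDiff.cexp (ContDiff.mul ?_ contDiff_const)
  exact Complex.ofRealCLM.contDiff.comp
    (contDiff_const.mul (contDiff_const.mul contDiff_id))

lemma contDiff_series (hγ : 0 < γ) (hu : ∀ n : ℤ, |u n| ≤ C * Real.exp (-(γ * |(n : ℝ)|))) :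
    ContDiff ℝ (⊤ : ℕ∞) (series u) := by
  refine contDiff_tsum (N := ⊤) (v := fun k n => (2 * Real.pi) ^ k * (|u n| * |(n : ℝ)| ^ k))
    (fun n => contDiff_const.mul (contDiff_e_mul n))
    (fun k _ => (summable_abs_of_decay hγ hu k).mul_left _) fun k n θ _ => ?_
  rw [norm_iteratedFDeriv_eq_norm_iteratedDeriv, iteratedDeriv_const_mul_field, iteratedDeriv_e]
  simp only [norm_mul, norm_pow, norm_e, Complex.norm_real, Complex.norm_I, Real.norm_eq_abs,
    mul_one, Complex.norm_intCast, Complex.norm_ofNat, abs_of_pos Real.pi_pos]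
  rw [mul_pow]
  apply le_of_eq; ring

lemma periodic_series : Function.Periodic (series u) 1 := by
  intro θ
  simp only [series, mul_add, e_add, mul_one, e_int]

lemma cf_series (hs : Summable fun n => |u n|) (n : ℤ) : cf (series u) n = u n := by
  have h := intervalIntegral.hasSum_integral_of_dominated_convergence (a := 0) (b := 1)
    (μ := MeasureTheory.volume) (F := fun (m : ℤ) θ => e (-(n * θ)) * ((u m : ℂ) * e (m * θ)))
    (f := fun θ => e (-(n * θ)) * series u θ) (fun m _ => |u m|)
    (fun m => (by
      refine Continuous.aestronglyMeasurable ?_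
      exact (continuous_e.comp (by fun_prop)).mul
        (continuous_const.mul (continuous_e.comp (by fun_prop)))))
    (fun m => Eventually.of_forall fun θ _ => by simp [norm_e])
    (Eventually.of_forall fun θ _ => hs)
    (by simp)
    (Eventually.of_forall fun θ _ => (hasSum_series hs θ).mul_left _)
  have h2 : ∀ m : ℤ, (∫ θ in (0 : ℝ)..1, e (-(n * θ)) * ((u m : ℂ) * e (m * θ))) =
      if m = n then (u n : ℂ) else 0 := by
    intro m
    have h3 : (fun θ : ℝ => e (-(n * θ)) * ((u m : ℂ) * e (m * θ))) =
        fun θ => (u m : ℂ) * e ((m - n : ℤ) * θ) := by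
      funext θ
      rw [mul_left_comm, ← e_add]; congr 2; push_cast; ring
    rw [h3, intervalIntegral.integral_const_mul]
    split_ifs with hmn
    · subst hmn; simp [e_zero]
    · have hc : (2 * Real.pi * (m - n : ℤ) * Complex.I : ℂ) ≠ 0 := by
        have : (m - n : ℤ) ≠ 0 := sub_ne_zero.mpr hmn
        have hpi := Real.pi_ne_zero
        simp only [ne_eq, mul_eq_zero, not_or]
        refine ⟨⟨⟨two_ne_zero, by exact_mod_cast hpi⟩, by exact_mod_cast this⟩, Complex.I_ne_zero⟩
      have h4 : (fun θ : ℝ => e ((m - n : ℤ) * θ)) =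
          fun θ : ℝ => Complex.exp ((2 * Real.pi * (m - n : ℤ) * Complex.I) * θ) := by
        funext θ; rw [e]; congr 1; push_cast; ring
      rw [h4, integral_exp_mul_complex hc]
      have h5 := e_int (m - n)
      rw [e] at h5
      rw [show (2 * Real.pi * (m - n : ℤ) * Complex.I * (1 : ℝ) : ℂ) =
        ((2 * Real.pi * ((m - n : ℤ) : ℝ) : ℝ) : ℂ) * Complex.I by push_cast; ring, h5]
      simp
  simp only [h2] at h
  exact h.unique (hasSum_ite_eq n _)

lemma series_equation {lam E α : ℝ} (hlam : lam ≠ 0)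
    (hu : ∀ n : ℤ, u (n + 1) + u (n - 1) = coeff lam E (n * α) * u n)
    (hs : Summable fun n => |u n|) (θ : ℝ) :
    series u (θ + α) + series u (θ - α) = (coeff (1 / lam) (E / lam) θ : ℂ) * series u θ := by
  have h0 := hasSum_series hs θ
  have hp := (hasSum_series hs (θ + α)).add (hasSum_series hs (θ - α))
  have h1 : HasSum (fun n : ℤ => (u (n + 1) : ℂ) * e ((n : ℝ) * θ)) (e (-θ) * series u θ) := by
    have := ((Equiv.addRight (1 : ℤ)).hasSum_iff.mpr h0).mul_left (e (-θ))
    convert! this using 1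
    funext n
    simp only [Function.comp, Equiv.coe_addRight]
    rw [mul_left_comm, ← e_add]; congr 2; push_cast; ring
  have h2 : HasSum (fun n : ℤ => (u (n - 1) : ℂ) * e ((n : ℝ) * θ)) (e θ * series u θ) := by
    have := ((Equiv.addRight (-1 : ℤ)).hasSum_iff.mpr h0).mul_left (e θ)
    convert! this using 1
    funext n
    simp only [Function.comp, Equiv.coe_addRight]
    rw [mul_left_comm, ← e_add, ← sub_eq_add_neg]; congr 2; push_cast; ring
  have h3 := (h0.mul_left (E : ℂ)).sub (h1.add h2)
  have h4 := h3.mul_left (1 / lam : ℂ)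
  have hl : (lam : ℂ) ≠ 0 := by exact_mod_cast hlam
  have h5 : (fun n : ℤ => (1 / lam : ℂ) * ((E : ℂ) * ((u n : ℂ) * e ((n : ℝ) * θ)) -
      ((u (n + 1) : ℂ) * e ((n : ℝ) * θ) + (u (n - 1) : ℂ) * e ((n : ℝ) * θ)))) =
      fun n : ℤ => (u n : ℂ) * e (n * (θ + α)) + (u n : ℂ) * e (n * (θ - α)) := by
    funext n
    have h6 : ((u (n + 1) : ℂ) + u (n - 1)) = (coeff lam E (n * α) : ℂ) * u n := by
      exact_mod_cast hu n
    have h7 : (coeff lam E (n * α) : ℂ) = E - lam * (e (n * α) + e (-(n * α))) := by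
      rw [e_add_e_neg, coeff]; push_cast; ring
    have h8 : e (n * (θ + α)) = e (n * θ) * e (n * α) := by rw [← e_add]; ring_nf
    have h9 : e (n * (θ - α)) = e (n * θ) * e (-(n * α)) := by rw [← e_add]; ring_nf
    rw [← add_mul, h6, h7, h8, h9]
    field_simp
    ring
  rw [h5] at h4
  rw [hp.unique h4]
  have h10 : (coeff (1 / lam) (E / lam) θ : ℂ) = E / lam - 1 / lam * (e θ + e (-θ)) := by
    rw [e_add_e_neg, coeff]; push_cast; ring
  rw [h10]
  field_simp
  ring

/-- Fourier transform of a localized state: a smooth quasi-periodic solution of the dual equation. -/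
theorem exists_smooth_solution {lam E α : ℝ} (hlam : lam ≠ 0)
    (hu : ∀ n : ℤ, u (n + 1) + u (n - 1) = coeff lam E (n * α) * u n) (hγ : 0 < γ)
    (hdecay : ∀ n : ℤ, |u n| ≤ C * Real.exp (-(γ * |(n : ℝ)|))) (hu0 : u ≠ 0) :
    ∃ g : ℝ → ℝ, ContDiff ℝ (⊤ : ℕ∞) g ∧ Function.Periodic g 1 ∧ g ≠ 0 ∧
      ∀ θ, g (θ + α) + g (θ - α) = coeff (1 / lam) (E / lam) θ * g θ := by
  have hs : Summable fun n => |u n| := by simpa using summable_abs_of_decay hγ hdecay 0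
  have hsm := contDiff_series hγ hdecay
  have heq := series_equation hlam hu hs
  by_cases hre : (fun θ => (series u θ).re) = 0
  · refine ⟨fun θ => (series u θ).im, Complex.imCLM.contDiff.comp hsm, fun θ => by
      simp only [periodic_series θ], fun him => hu0 ?_, fun θ => ?_⟩
    · have h0 : series u = fun _ => 0 := by
        funext θ
        exact Complex.ext (congrFun hre θ) (congrFun him θ)
      funext n
      have h1 := cf_series hs n
      rw [h0, cf] at h1
      simpa using h1.symm
    · have := congrArg Complex.im (heq θ)
      simpa only [Complex.add_im, Complex.im_ofReal_mul] using this
  · refine ⟨fun θ => (series u θ).re, Complex.reCLM.contDiff.comp hsm, fun θ => by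
      simp only [periodic_series θ], hre, fun θ => ?_⟩
    have := congrArg Complex.re (heq θ)
    simpa only [Complex.add_re, Complex.re_ofReal_mul] using this

end FourierSeries

lemma eq_zero_of_orbit_eq_zero {α : ℝ} (hα : Irrational α) {g : ℝ → ℝ} (hg : Continuous g)
    (hper : Function.Periodic g 1) (θ : ℝ) (h : ∀ n : ℤ, g (θ + n * α) = 0) : g = 0 := by
  have hc : Continuous fun x => (g (θ + x) : ℂ) := by fun_prop
  have hp : Function.Periodic (fun x => (g (θ + x) : ℂ)) 1 := fun x => by
    simp only [← add_assoc, hper (θ + x)]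
  have hd : DenseRange fun x : ℤ => x • (α : AddCircle (1 : ℝ)) :=
    AddCircle.denseRange_zsmul_coe_iff.mpr (by simpa using hα)
  have heq := hd.equalizer (toCircle _ hc hp).continuous continuous_zero (by
    funext n
    simp only [Function.comp, Pi.zero_apply]
    rw [← AddCircle.coe_zsmul, toCircle_coe, zsmul_eq_mul, h n, Complex.ofReal_zero])
  funext x
  have h1 := congrFun heq ((x - θ : ℝ) : AddCircle (1 : ℝ))
  rw [toCircle_coe] at h1
  simpa using h1

lemma wronskian_const {w v₁ v₂ : ℤ → ℂ} (h₁ : ∀ n, v₁ (n + 1) + v₁ (n - 1) = w n * v₁ n)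
    (h₂ : ∀ n, v₂ (n + 1) + v₂ (n - 1) = w n * v₂ n) (n : ℤ) :
    v₁ n * v₂ (n + 1) - v₂ n * v₁ (n + 1) = v₁ 0 * v₂ 1 - v₂ 0 * v₁ 1 := by
  have step : ∀ n : ℤ, v₁ n * v₂ (n + 1) - v₂ n * v₁ (n + 1) =
      v₁ (n - 1) * v₂ n - v₂ (n - 1) * v₁ n := fun n => by
    linear_combination v₁ n * h₂ n - v₂ n * h₁ n
  induction n using Int.induction_on with
  | zero => simp
  | succ n ih =>
    rw [step, add_sub_cancel_right]; exact ih
  | pred n ih =>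
    rw [step] at ih
    rw [sub_add_cancel]; exact ih

/-- Two solutions of the same recurrence, one bounded and one tending to zero, are proportional. -/
lemma proportional_of_tendsto {w v₁ v₂ : ℤ → ℂ}
    (h₁ : ∀ n, v₁ (n + 1) + v₁ (n - 1) = w n * v₁ n)
    (h₂ : ∀ n, v₂ (n + 1) + v₂ (n - 1) = w n * v₂ n)
    (hW : Tendsto (fun n : ℕ => v₁ n * v₂ (n + 1) - v₂ n * v₁ (n + 1)) atTop (𝓝 0))
    (m n : ℤ) : v₁ m * v₂ n = v₂ m * v₁ n := by
  have h0 : v₁ 0 * v₂ 1 - v₂ 0 * v₁ 1 = 0 := by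
    refine tendsto_nhds_unique ?_ hW
    simp only [wronskian_const h₁ h₂]
    exact tendsto_const_nhds
  have hu := solution_eq_zero (w := fun n => w (n + m)) (u := fun n => v₁ m * v₂ (n + m) -
    v₂ m * v₁ (n + m)) (fun n => by
      have e1 := h₁ (n + m)
      have e2 := h₂ (n + m)
      rw [show n + 1 + m = n + m + 1 by ring, show n - 1 + m = n + m - 1 by ring]
      linear_combination v₁ m * e2 - v₂ m * e1) (by ring_nf) (by
      have := wronskian_const h₁ h₂ m
      rw [h0] at this
      simpa [add_comm] using this)
  have := congrFun hu (n - m)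
  simp only [sub_add_cancel, Pi.zero_apply] at this
  exact sub_eq_zero.mp this

/-- A conjugacy of the cocycle of `coeff μ e₀` to a constant parabolic one. -/
structure Reduction (α μ e₀ : ℝ) where
  (g h k : ℝ → ℝ)
  (m κ : ℝ)
  (continuous_g : Continuous g)
  (continuous_h : Continuous h)
  (continuous_k : Continuous k)
  (periodic_g : Function.Periodic g 1)
  (periodic_h : Function.Periodic h 1)
  (periodic_k : Function.Periodic k 1)
  (m_ne_zero : m ≠ 0)
  (κ_pos : 0 < κ)
  (g_add : ∀ θ, g (θ + α) + g (θ - α) = coeff μ e₀ θ * g θ)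
  (k_add : ∀ θ, h θ = k (θ + α) + m * g θ)
  (h_add : ∀ θ, coeff μ e₀ θ * h θ - k θ = h (θ + α) + m * g (θ + α))
  (det : ∀ θ, g θ * k θ - g (θ - α) * h θ = 1)
  (le_sq : ∀ θ, κ ≤ g θ ^ 2 + g (θ + α) ^ 2)

lemma tendsto_cf_nat {f : ℝ → ℂ} (hf : Continuous f) (hper : Function.Periodic f 1) :
    Tendsto (fun n : ℕ => cf f n) atTop (𝓝 0) :=
  (tendsto_cf hf hper).comp
    (by simpa [Nat.cofinite_eq_atTop] using (Nat.cast_injective (R := ℤ)).tendsto_cofinite)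

lemma cf_recurrence {α μ e₀ : ℝ} (hμ : μ ≠ 0) {g : ℝ → ℝ} (hg : Continuous g)
    (hper : Function.Periodic g 1) (heq : ∀ θ, g (θ + α) + g (θ - α) = coeff μ e₀ θ * g θ) (n : ℤ) :
    cf (fun θ => (g θ : ℂ)) (n + 1) + cf (fun θ => (g θ : ℂ)) (n - 1) =
      ((e₀ - (e (n * α) + e (-(n * α)))) / μ) * cf (fun θ => (g θ : ℂ)) n := by
  set G : ℝ → ℂ := fun θ => (g θ : ℂ) with hG
  have hGc : Continuous G := by fun_prop
  have hGp : Function.Periodic G 1 := fun x => by simp only [hG, hper x]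
  have h1 : cf (fun θ => G (θ + α) + G (θ + -α)) n = e (n * α) * cf G n + e (-(n * α)) * cf G n := by
    rw [cf_add (by fun_prop) (by fun_prop), cf_shift hGp, cf_shift hGp, mul_neg]
  have h2 : cf (fun θ => (e₀ : ℂ) * G θ + (-μ : ℂ) * (((2 * Real.cos (2 * Real.pi * θ) : ℝ) : ℂ) * G θ)) n
      = e₀ * cf G n + (-μ) * (cf G (n - 1) + cf G (n + 1)) := by
    rw [cf_add (by fun_prop) (by fun_prop), cf_const_mul, cf_const_mul, cf_mul_cos hGc]
  have h3 : (fun θ => G (θ + α) + G (θ + -α)) = fun θ => (e₀ : ℂ) * G θ +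
      (-μ : ℂ) * (((2 * Real.cos (2 * Real.pi * θ) : ℝ) : ℂ) * G θ) := by
    funext θ
    have h4 : (((g (θ + α) + g (θ - α) : ℝ)) : ℂ) = ((coeff μ e₀ θ * g θ : ℝ) : ℂ) := by rw [heq]
    rw [coeff] at h4
    simp only [hG, ← sub_eq_add_neg]
    push_cast at h4 ⊢
    linear_combination h4
  rw [h3, h2] at h1
  have hm : (μ : ℂ) ≠ 0 := by exact_mod_cast hμ
  field_simp
  linear_combination -h1

theorem exists_reduction {α c r μ e₀ : ℝ} (hα : Irrational α) (hc : 0 < c) (hsin : SinLower α c r)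
    (hμ : μ ≠ 0) {g : ℝ → ℝ} (hg : ContDiff ℝ (⊤ : ℕ∞) g) (hper : Function.Periodic g 1)
    (hg0 : g ≠ 0) (heq : ∀ θ, g (θ + α) + g (θ - α) = coeff μ e₀ θ * g θ) :
    Nonempty (Reduction α μ e₀) := by
  have hgc := hg.continuous
  set G : ℝ → ℝ := fun θ => g θ ^ 2 + g (θ - α) ^ 2 with hG
  have hGs : ContDiff ℝ (⊤ : ℕ∞) G :=
    (hg.pow 2).add ((hg.comp (contDiff_id.sub contDiff_const)).pow 2)
  have hper' : ∀ a : ℝ, ∀ θ, g (θ + 1 + a) = g (θ + a) := fun a θ => by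
    rw [add_right_comm, hper]
  have hper'' : ∀ a : ℝ, ∀ θ, g (θ + 1 - a) = g (θ - a) := fun a θ => hper' (-a) θ
  have hGp : Function.Periodic G 1 := fun θ => by simp only [hG, hper'', hper θ]
  have hGpos : ∀ θ, 0 < G θ := by
    intro θ
    have h0 : 0 ≤ G θ := by positivity
    refine lt_of_le_of_ne h0 fun hz => hg0 ?_
    have z1 : g θ = 0 := by
      have := sq_nonneg (g θ); have := sq_nonneg (g (θ - α))
      have : g θ ^ 2 = 0 := by simp only [hG] at hz; linarith
      simpa using this
    have z2 : g (θ - α) = 0 := by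
      have : g (θ - α) ^ 2 = 0 := by simp only [hG, z1] at hz; simpa using hz.symm
      simpa using this
    have hsol := solution_eq_zero (w := fun n : ℤ => coeff μ e₀ (θ - α + n * α))
      (u := fun n : ℤ => g (θ - α + n * α)) (fun n => by
        rw [← heq]; push_cast; ring_nf) (by simpa using z2) (by simpa using z1)
    exact eq_zero_of_orbit_eq_zero hα hgc hper (θ - α) fun n => congrFun hsol n
  have hsm : ∀ a : ℝ, ContDiff ℝ (⊤ : ℕ∞) fun θ : ℝ => θ + a :=
    fun a => contDiff_id.add contDiff_const
  set h0 : ℝ → ℝ := fun θ => -g (θ - α) / G θ with hh0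
  set k0 : ℝ → ℝ := fun θ => g θ / G θ with hk0
  have h0s : ContDiff ℝ (⊤ : ℕ∞) h0 :=
    (hg.comp (contDiff_id.sub contDiff_const)).neg.div hGs fun θ => (hGpos θ).ne'
  have k0s : ContDiff ℝ (⊤ : ℕ∞) k0 := hg.div hGs fun θ => (hGpos θ).ne'
  have h0p : Function.Periodic h0 1 := fun θ => by simp only [hh0, hper'', hGp θ]
  have k0p : Function.Periodic k0 1 := fun θ => by simp only [hk0, hper θ, hGp θ]
  have Vs : ContDiff ℝ (⊤ : ℕ∞) (coeff μ e₀) := by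
    unfold coeff
    exact contDiff_const.sub (contDiff_const.mul
      (Real.contDiff_cos.comp (contDiff_const.mul contDiff_id)))
  have Vp : Function.Periodic (coeff μ e₀) 1 := fun θ => by
    rw [coeff, coeff, mul_add, mul_one, Real.cos_add_two_pi]
  set f : ℝ → ℝ := fun θ => (coeff μ e₀ θ * h0 θ - k0 θ) * k0 (θ + α) - h0 θ * h0 (θ + α) with hf
  have fs : ContDiff ℝ (⊤ : ℕ∞) f :=
    (((Vs.mul h0s).sub k0s).mul (k0s.comp (hsm α))).sub (h0s.mul (h0s.comp (hsm α)))
  have fp : Function.Periodic f 1 := fun θ => by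
    simp only [hf, add_right_comm θ 1 α, h0p _, k0p _, Vp _]
  have det0 : ∀ θ, g θ * k0 θ - g (θ - α) * h0 θ = 1 := fun θ => by
    have hne := (hGpos θ).ne'
    simp only [hk0, hh0]
    field_simp
    simp only [hG]; ring
  have det1 : ∀ θ, g (θ + α) * k0 (θ + α) - g θ * h0 (θ + α) = 1 := fun θ => by
    have := det0 (θ + α); rwa [add_sub_cancel_right] at this
  have id1 : ∀ θ, h0 θ = k0 (θ + α) + f θ * g θ := fun θ => by
    simp only [hf]
    linear_combination k0 (θ + α) * det0 θ - h0 θ * det1 θ + h0 θ * k0 (θ + α) * heq θ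
  have id2 : ∀ θ, coeff μ e₀ θ * h0 θ - k0 θ = h0 (θ + α) + f θ * g (θ + α) := fun θ => by
    simp only [hf]
    linear_combination h0 (θ + α) * det0 θ - (coeff μ e₀ θ * h0 θ - k0 θ) * det1 θ
      + h0 θ * h0 (θ + α) * heq θ
  obtain ⟨β, m, hβc, hβp, hβ⟩ := hsin.exists_cohomology hc fs fp
  have hmin : ∃ κ > 0, ∀ θ, κ ≤ G θ := by
    obtain ⟨x, -, hx⟩ := (isCompact_Icc (a := (0 : ℝ)) (b := 1)).exists_isMinOn
      ⟨0, by simp⟩ hGs.continuous.continuousOn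
    refine ⟨G x, hGpos x, fun θ => ?_⟩
    obtain ⟨y, hy, hyθ⟩ := hGp.exists_mem_Ico₀ one_pos θ
    rw [hyθ]; exact hx ⟨hy.1, hy.2.le⟩
  obtain ⟨κ, hκ, hκG⟩ := hmin
  set h : ℝ → ℝ := fun θ => h0 θ + β θ * g θ with hh
  set k : ℝ → ℝ := fun θ => k0 θ + β θ * g (θ - α) with hk
  have hhc : Continuous h := h0s.continuous.add (hβc.mul hgc)
  have hkc : Continuous k := k0s.continuous.add (hβc.mul (by fun_prop))
  have hhp : Function.Periodic h 1 := fun θ => by simp only [hh, h0p θ, hβp θ, hper θ]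
  have hkp : Function.Periodic k 1 := fun θ => by simp only [hk, k0p θ, hβp θ, hper'']
  have hdet : ∀ θ, g θ * k θ - g (θ - α) * h θ = 1 := fun θ => by
    simp only [hh, hk]; linear_combination det0 θ
  have hka : ∀ θ, h θ = k (θ + α) + m * g θ := fun θ => by
    simp only [hh, hk, add_sub_cancel_right]
    linear_combination id1 θ - g θ * hβ θ
  have hha : ∀ θ, coeff μ e₀ θ * h θ - k θ = h (θ + α) + m * g (θ + α) := fun θ => by
    simp only [hh, hk]
    linear_combination id2 θ - g (θ + α) * hβ θ - β θ * heq θ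
  have hm : m ≠ 0 := by
    intro hm
    subst hm
    simp only [zero_mul, add_zero] at hka hha
    have hk' : ∀ θ, k θ = h (θ - α) := fun θ => by rw [hka, sub_add_cancel]
    have heqh : ∀ θ, h (θ + α) + h (θ - α) = coeff μ e₀ θ * h θ := fun θ => by
      rw [← hk', ← hha]; ring
    have r1 := cf_recurrence hμ hgc hper heq
    have r2 := cf_recurrence hμ hhc hhp heqh
    set Gc : ℝ → ℂ := fun θ => (g θ : ℂ) with hGc
    set Hc : ℝ → ℂ := fun θ => (h θ : ℂ) with hHc
    have cG : Continuous Gc := by fun_prop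
    have cH : Continuous Hc := by fun_prop
    have pG : Function.Periodic Gc 1 := fun x => by simp only [hGc, hper x]
    have pH : Function.Periodic Hc 1 := fun x => by simp only [hHc, hhp x]
    have t1 := tendsto_cf_nat cG pG
    have t2 := tendsto_cf_nat cH pH
    have t1' : Tendsto (fun n : ℕ => cf Gc (n + 1)) atTop (𝓝 0) := by
      simpa [Function.comp_def] using t1.comp (tendsto_add_atTop_nat 1)
    have t2' : Tendsto (fun n : ℕ => cf Hc (n + 1)) atTop (𝓝 0) := by
      simpa [Function.comp_def] using t2.comp (tendsto_add_atTop_nat 1)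
    have hW := (t1.mul t2').sub (t2.mul t1')
    rw [mul_zero, sub_zero] at hW
    have hprop := proportional_of_tendsto r1 r2 hW
    obtain ⟨j, hj⟩ : ∃ j, cf Gc j ≠ 0 := by
      by_contra! hcon
      have := eq_zero_of_cf_eq_zero cG pG hcon
      apply hg0; funext x
      have := congrFun this x
      simpa [hGc] using this
    have hzero := eq_zero_of_cf_eq_zero (f := fun θ => cf Gc j * Hc θ + -cf Hc j * Gc θ)
      (by fun_prop) (fun x => by simp only [pG x, pH x]) (fun n => by
        rw [cf_add (by fun_prop) (by fun_prop), cf_const_mul, cf_const_mul, hprop j n]; ring)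
    have z : ∀ θ, cf Gc j * h θ = cf Hc j * g θ := fun θ => by
      have := congrFun hzero θ
      simp only [hGc, hHc, Pi.zero_apply] at this ⊢
      linear_combination this
    have hd : (((g 0 * h (0 - α) - g (0 - α) * h 0 : ℝ)) : ℂ) = 1 := by
      rw [← hk', hdet]; simp
    push_cast at hd
    apply hj
    linear_combination -cf Gc j * hd + g 0 * z (0 - α) - g (0 - α) * z 0
  exact ⟨⟨g, h, k, m, κ, hgc, hhc, hkc, hper, hhp, hkp, hm, hκ, heq, hka, hha, hdet, fun θ => by
    have := hκG (θ + α)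
    simp only [hG, add_sub_cancel_right] at this
    linarith⟩⟩

lemma deviation_step {s K a b x z x' z' : ℝ} (hs : 0 ≤ s) (hs1 : s ≤ 1) (hK : 1 ≤ K) (ha : 0 ≤ a)
    (haK : a ≤ K) (hb : 0 ≤ b) (hbK : b ≤ K)
    (hx : |x' - x - s * a * z| ≤ K * s ^ 2 * (|x| + |z|))
    (hz : |z' - z - s * b * x| ≤ K * s ^ 2 * (|x| + |z|)) :
    |x' - x| ≤ 2 * K * s * (|x| + |z|) ∧ |z' - z| ≤ 2 * K * s * (|x| + |z|) ∧
      s * (a * z ^ 2 + b * x ^ 2) - 5 * K ^ 2 * s ^ 2 * (|x| + |z|) ^ 2 ≤ x' * z' - x * z := by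
  set T := |x| + |z| with hT
  have hT0 : 0 ≤ T := by positivity
  have hxT : |x| ≤ T := by rw [hT]; linarith [abs_nonneg z]
  have hzT : |z| ≤ T := by rw [hT]; linarith [abs_nonneg x]
  have hss : s ^ 2 ≤ s := by nlinarith
  have e1 : |s * a * z| ≤ K * s * T := by
    rw [abs_mul, abs_mul, abs_of_nonneg hs, abs_of_nonneg ha, mul_comm s a]; gcongr
  have e2 : |s * b * x| ≤ K * s * T := by
    rw [abs_mul, abs_mul, abs_of_nonneg hs, abs_of_nonneg hb, mul_comm s b]; gcongr
  have e3 : K * s ^ 2 * T ≤ K * s * T := by gcongr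
  have d1 : |x' - x| ≤ 2 * K * s * T := by
    have := abs_add_le (x' - x - s * a * z) (s * a * z)
    rw [sub_add_cancel] at this; linarith
  have d2 : |z' - z| ≤ 2 * K * s * T := by
    have := abs_add_le (z' - z - s * b * x) (s * b * x)
    rw [sub_add_cancel] at this; linarith
  refine ⟨d1, d2, ?_⟩
  have f1 : |z * (x' - x - s * a * z)| ≤ |z| * (K * s ^ 2 * T) := by rw [abs_mul]; gcongr
  have f2 : |x * (z' - z - s * b * x)| ≤ |x| * (K * s ^ 2 * T) := by rw [abs_mul]; gcongr
  have f3 : |(x' - x) * (z' - z)| ≤ (2 * K * s * T) * (2 * K * s * T) := by rw [abs_mul]; gcongr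
  have f4 : |z| * (K * s ^ 2 * T) + |x| * (K * s ^ 2 * T) = K * s ^ 2 * T ^ 2 := by rw [hT]; ring
  have f5 : K * s ^ 2 * T ^ 2 ≤ K ^ 2 * s ^ 2 * T ^ 2 := by
    gcongr; exact le_self_pow₀ hK two_ne_zero
  have g1 := (abs_le.mp f1).1
  have g2 := (abs_le.mp f2).1
  have g3 := (abs_le.mp f3).1
  linarith

lemma two_step {s K κ a b b' x z x' z' x'' z'' : ℝ} (hs : 0 ≤ s) (hs1 : s ≤ 1) (hK : 1 ≤ K)
    (ha : 0 ≤ a) (haK : a ≤ K) (hb : 0 ≤ b) (hbK : b ≤ K) (hb' : 0 ≤ b') (hbK' : b' ≤ K)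
    (hx : |x' - x - s * a * z| ≤ K * s ^ 2 * (|x| + |z|))
    (hz : |z' - z - s * b * x| ≤ K * s ^ 2 * (|x| + |z|))
    (hx' : |x'' - x' - s * a * z'| ≤ K * s ^ 2 * (|x'| + |z'|))
    (hz' : |z'' - z' - s * b' * x'| ≤ K * s ^ 2 * (|x'| + |z'|))
    (hκa : κ ≤ 2 * a) (hκb : κ ≤ b + b') (hsmall : s * (552 * K ^ 4) ≤ κ) :
    s * (κ / 2) * (x ^ 2 + z ^ 2) ≤ x'' * z'' - x * z := by
  obtain ⟨d1, d2, q1⟩ := deviation_step hs hs1 hK ha haK hb hbK hx hz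
  obtain ⟨-, -, q2⟩ := deviation_step hs hs1 hK ha haK hb' hbK' hx' hz'
  set T := |x| + |z| with hT
  set T' := |x'| + |z'| with hT'
  have hT0 : 0 ≤ T := by positivity
  have hxT : |x| ≤ T := by rw [hT]; linarith [abs_nonneg z]
  have hzT : |z| ≤ T := by rw [hT]; linarith [abs_nonneg x]
  have hT'T : T' ≤ 5 * K * T := by
    have h1 := abs_add_le (x' - x) x
    have h2 := abs_add_le (z' - z) z
    rw [sub_add_cancel] at h1 h2
    have h3 : 2 * K * s * T ≤ 2 * K * T := by
      have : 0 ≤ K * T := by positivity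
      have := mul_le_mul_of_nonneg_right hs1 this
      linarith
    have h4 : T ≤ K * T := le_mul_of_one_le_left hT0 hK
    linarith
  have hT2 : T' ^ 2 ≤ 25 * K ^ 2 * T ^ 2 := by
    have h0 : 0 ≤ T' := by positivity
    calc T' ^ 2 ≤ (5 * K * T) ^ 2 := by gcongr
      _ = _ := by ring
  have sqx : x ^ 2 - 4 * K * s * T ^ 2 ≤ x' ^ 2 := by
    have h1 : |x * (x' - x)| ≤ T * (2 * K * s * T) := by rw [abs_mul]; gcongr
    have h2 := (abs_le.mp h1).1
    have h3 := sq_nonneg (x' - x)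
    linarith
  have sqz : z ^ 2 - 4 * K * s * T ^ 2 ≤ z' ^ 2 := by
    have h1 : |z * (z' - z)| ≤ T * (2 * K * s * T) := by rw [abs_mul]; gcongr
    have h2 := (abs_le.mp h1).1
    have h3 := sq_nonneg (z' - z)
    linarith
  have hP : 0 ≤ 4 * K * s * T ^ 2 := by positivity
  have m1 : a * z ^ 2 - K * (4 * K * s * T ^ 2) ≤ a * z' ^ 2 := by
    have := mul_le_mul_of_nonneg_left sqz ha
    have := mul_le_mul_of_nonneg_right haK hP
    linarith
  have m2 : b' * x ^ 2 - K * (4 * K * s * T ^ 2) ≤ b' * x' ^ 2 := by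
    have := mul_le_mul_of_nonneg_left sqx hb'
    have := mul_le_mul_of_nonneg_right hbK' hP
    linarith
  have m3 : s * (a * z ^ 2 + b' * x ^ 2) - 8 * K ^ 2 * s ^ 2 * T ^ 2 ≤
      s * (a * z' ^ 2 + b' * x' ^ 2) := by
    have := mul_le_mul_of_nonneg_left (add_le_add m1 m2) hs
    linarith
  have m4 : 5 * K ^ 2 * s ^ 2 * T' ^ 2 ≤ 125 * K ^ 4 * s ^ 2 * T ^ 2 := by
    calc 5 * K ^ 2 * s ^ 2 * T' ^ 2 ≤ 5 * K ^ 2 * s ^ 2 * (25 * K ^ 2 * T ^ 2) := by gcongr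
      _ = _ := by ring
  have m5 : K ^ 2 * s ^ 2 * T ^ 2 ≤ K ^ 4 * s ^ 2 * T ^ 2 := by
    gcongr
    norm_num
  have hTR : T ^ 2 ≤ 2 * (x ^ 2 + z ^ 2) := by
    rw [← sq_abs x, ← sq_abs z, hT]; linarith [sq_nonneg (|x| - |z|)]
  have m6 : 138 * K ^ 4 * s ^ 2 * T ^ 2 ≤ s * (κ / 2) * (x ^ 2 + z ^ 2) := by
    calc 138 * K ^ 4 * s ^ 2 * T ^ 2 ≤ 138 * K ^ 4 * s ^ 2 * (2 * (x ^ 2 + z ^ 2)) := by gcongr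
      _ = s * (s * (552 * K ^ 4) / 2) * (x ^ 2 + z ^ 2) := by ring
      _ ≤ _ := by gcongr
  have m7 : s * κ * (x ^ 2 + z ^ 2) ≤ s * (2 * a * z ^ 2 + (b + b') * x ^ 2) := by
    have h1 := mul_le_mul_of_nonneg_right hκa (sq_nonneg z)
    have h2 := mul_le_mul_of_nonneg_right hκb (sq_nonneg x)
    have := mul_le_mul_of_nonneg_left (add_le_add h1 h2) hs
    linarith
  linarith

/-- A positive sequence with exponential growth is not polynomially bounded. -/
lemma not_pos_of_growth {D : ℕ → ℝ} {ρ C : ℝ} (hρ : 0 < ρ) (hD : ∀ j, (1 + ρ) * |D j| ≤ |D (j + 1)|)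
    (hC : ∀ j : ℕ, |D j| ≤ C * (1 + (j : ℝ)) ^ 2) : D 0 = 0 := by
  by_contra h0
  have hpos : 0 < |D 0| := abs_pos.mpr h0
  have hgrow : ∀ j, (1 + ρ) ^ j * |D 0| ≤ |D j| := by
    intro j
    induction j with
    | zero => simp
    | succ j ih =>
      calc (1 + ρ) ^ (j + 1) * |D 0| = (1 + ρ) * ((1 + ρ) ^ j * |D 0|) := by ring
        _ ≤ (1 + ρ) * |D j| := by gcongr
        _ ≤ _ := hD j
  have hlim : Tendsto (fun j : ℕ => C * ((j : ℝ) ^ 2 / (1 + ρ) ^ j + 2 * ((j : ℝ) ^ 1 / (1 + ρ) ^ j)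
      + (j : ℝ) ^ 0 / (1 + ρ) ^ j)) atTop (𝓝 0) := by
    have h := fun k => tendsto_pow_const_div_const_pow_of_one_lt k (r := 1 + ρ) (by linarith)
    simpa [add_assoc] using (((h 2).add ((h 1).const_mul 2)).add (h 0)).const_mul C
  have hlim' : Tendsto (fun j : ℕ => C * (1 + (j : ℝ)) ^ 2 / (1 + ρ) ^ j) atTop (𝓝 0) := by
    refine hlim.congr fun j => ?_
    ring
  obtain ⟨j, hj⟩ := (hlim'.eventually (gt_mem_nhds hpos)).exists
  rw [div_lt_iff₀ (by positivity)] at hj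
  linarith [hgrow j, hC j]

/-- Hyperbolicity: the only polynomially bounded orbit of the perturbed system is zero. -/
lemma eq_zero_of_hyperbolic {s K κ a C : ℝ} {b x z : ℤ → ℝ} (hs : 0 < s) (hs1 : s ≤ 1) (hK : 1 ≤ K)
    (ha : 0 ≤ a) (haK : a ≤ K) (hb : ∀ n, 0 ≤ b n) (hbK : ∀ n, b n ≤ K)
    (hx : ∀ n, |x (n + 1) - x n - s * a * z n| ≤ K * s ^ 2 * (|x n| + |z n|))
    (hz : ∀ n, |z (n + 1) - z n - s * b n * x n| ≤ K * s ^ 2 * (|x n| + |z n|))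
    (hκ : 0 < κ) (hκa : κ ≤ 2 * a) (hκb : ∀ n, κ ≤ b n + b (n + 1))
    (hsmall : s * (552 * K ^ 4) ≤ κ)
    (hC : ∀ n : ℤ, |x n * z n| ≤ C * (1 + |(n : ℝ)|) ^ 2) : ∀ n, x n = 0 ∧ z n = 0 := by
  have step : ∀ n, s * (κ / 2) * (x n ^ 2 + z n ^ 2) ≤
      x (n + 1 + 1) * z (n + 1 + 1) - x n * z n := fun n =>
    two_step hs.le hs1 hK ha haK (hb n) (hbK n) (hb _) (hbK _) (hx n) (hz n) (hx _) (hz _) hκa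
      (hκb n) hsmall
  have hR : ∀ n, 2 * |x n * z n| ≤ x n ^ 2 + z n ^ 2 := fun n => by
    rw [abs_mul, ← sq_abs (x n), ← sq_abs (z n)]; linarith [sq_nonneg (|x n| - |z n|)]
  set Q : ℤ → ℝ := fun n => x n * z n with hQ
  set ρ := s * κ with hρ
  have hρ0 : 0 < ρ := by positivity
  have hstep : ∀ n, ρ * |Q n| ≤ Q (n + 2) - Q n := fun n => by
    have h1 := step n
    have h2 := mul_le_mul_of_nonneg_left (hR n) (show 0 ≤ s * (κ / 2) by positivity)
    rw [add_assoc] at h1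
    have : ρ * |x n * z n| = s * (κ / 2) * (2 * |x n * z n|) := by rw [hρ]; ring
    simp only [hQ]
    rw [this]; exact h2.trans h1
  have hC0 : 0 ≤ C := by have := (abs_nonneg _).trans (hC 0); simpa using this
  have hCn : ∀ (n ε : ℤ) (j : ℕ), |ε| ≤ 2 →
      |Q (n + ε * j)| ≤ C * (2 + |(n : ℝ)|) ^ 2 * (1 + (j : ℝ)) ^ 2 := by
    intro n ε j hε
    refine (hC _).trans ?_
    rw [mul_assoc, ← mul_pow]
    have hε' : |(ε : ℝ)| ≤ 2 := by exact_mod_cast hε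
    have : |((n + ε * j : ℤ) : ℝ)| ≤ |(n : ℝ)| + 2 * j := by
      push_cast
      refine (abs_add_le _ _).trans ?_
      rw [abs_mul, Nat.abs_cast]; gcongr
    have h2 : 0 ≤ |(n : ℝ)| * j := by positivity
    gcongr
    nlinarith
  have hQ0 : ∀ n, Q n = 0 := by
    intro n
    rcases le_total 0 (Q n) with hn | hn
    · have hpos : ∀ j : ℕ, 0 ≤ Q (n + 2 * j) := by
        intro j
        induction j with
        | zero => simpa using hn
        | succ j ih =>
          have := hstep (n + 2 * j)
          have h0 : 0 ≤ ρ * |Q (n + 2 * j)| := by positivity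
          rw [show n + 2 * ((j + 1 : ℕ) : ℤ) = n + 2 * j + 2 by push_cast; ring]
          linarith
      have := not_pos_of_growth (D := fun j : ℕ => Q (n + 2 * j)) hρ0 (fun j => by
        rw [abs_of_nonneg (hpos (j + 1)), abs_of_nonneg (hpos j)]
        have := hstep (n + 2 * j)
        rw [abs_of_nonneg (hpos j)] at this
        rw [show n + 2 * ((j + 1 : ℕ) : ℤ) = n + 2 * j + 2 by push_cast; ring]
        linarith) (fun j => hCn n 2 j (by norm_num))
      simpa using this
    · have hneg : ∀ j : ℕ, Q (n + -2 * j) ≤ 0 := by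
        intro j
        induction j with
        | zero => simpa using hn
        | succ j ih =>
          have := hstep (n + -2 * (j + 1 : ℕ))
          have h0 : 0 ≤ ρ * |Q (n + -2 * (j + 1 : ℕ))| := by positivity
          rw [show n + -2 * ((j + 1 : ℕ) : ℤ) + 2 = n + -2 * j by push_cast; ring] at this
          linarith
      have := not_pos_of_growth (D := fun j : ℕ => Q (n + -2 * j)) hρ0 (fun j => by
        have h1 := hneg j
        have h2 := hneg (j + 1)
        have h3 := hstep (n + -2 * (j + 1 : ℕ))
        rw [show n + -2 * ((j + 1 : ℕ) : ℤ) + 2 = n + -2 * j by push_cast; ring] at h3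
        rw [abs_of_nonpos h2] at h3 ⊢
        rw [abs_of_nonpos h1]
        have h4 : 0 ≤ ρ * -Q (n + -2 * (j + 1 : ℕ)) := mul_nonneg hρ0.le (by linarith)
        have h5 := mul_nonneg hρ0.le (h4.trans h3)
        linarith) (fun j => hCn n (-2) j (by norm_num))
      simpa using this
  intro n
  have h1 := step n
  have h2 := hQ0 n
  have h3 := hQ0 (n + 1 + 1)
  simp only [hQ] at h2 h3
  rw [h2, h3, sub_zero] at h1
  have h4 : x n ^ 2 + z n ^ 2 ≤ 0 := by
    have : 0 < s * (κ / 2) := by positivity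
    by_contra hcon
    push Not at hcon
    have := mul_pos this hcon
    linarith
  constructor
  · have : x n ^ 2 = 0 := by nlinarith [sq_nonneg (x n), sq_nonneg (z n)]
    simpa using this
  · have : z n ^ 2 = 0 := by nlinarith [sq_nonneg (x n), sq_nonneg (z n)]
    simpa using this

/-- Gap opening next to a reducible energy. -/
theorem Reduction.exists_gap {α μ e₀ : ℝ} (R : Reduction α μ e₀) :
    ∃ σ s₀ : ℝ, |σ| = 1 ∧ 0 < s₀ ∧ ∀ s, 0 < s → s < s₀ → ∀ (ω C : ℝ) (ψ : ℤ → ℝ),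
      (∀ n : ℤ, ψ (n + 1) + ψ (n - 1) = coeff μ (e₀ - σ * s ^ 2) (ω + n * α) * ψ n) →
      (∀ n : ℤ, |ψ n| ≤ C * (1 + |(n : ℝ)|)) → ψ = 0 := by
  obtain ⟨g, h, k, m, κ, hgc, hhc, hkc, hgp, hhp, hkp, hm, hκ, heq, hka, hha, hdet, hsq⟩ := R
  obtain ⟨M₁, hM₁, hg⟩ := exists_bound_of_periodic hgc hgp
  obtain ⟨M₂, hM₂, hh⟩ := exists_bound_of_periodic hhc hhp
  obtain ⟨M₃, hM₃, hk⟩ := exists_bound_of_periodic hkc hkp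
  simp only [Real.norm_eq_abs] at hg hh hk
  obtain ⟨σ, hσ, hσm⟩ : ∃ σ : ℝ, |σ| = 1 ∧ σ * m = |m| := by
    rcases lt_or_gt_of_ne hm with hm' | hm'
    · exact ⟨-1, by simp, by rw [abs_of_neg hm']; ring⟩
    · exact ⟨1, by simp, by rw [abs_of_pos hm']; ring⟩
  have hσ2 : σ * σ = 1 := by rw [← abs_mul_abs_self, hσ, one_mul]
  have hmσ : m = σ * |m| := by rw [← hσm, ← mul_assoc, hσ2, one_mul]
  set M := max 1 (max M₁ (max M₂ M₃)) with hM
  have hM1 : 1 ≤ M := le_max_left _ _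
  have hg' : ∀ θ, |g θ| ≤ M := fun θ => (hg θ).trans (by rw [hM]; simp)
  have hh' : ∀ θ, |h θ| ≤ M := fun θ => (hh θ).trans (by rw [hM]; simp)
  have hk' : ∀ θ, |k θ| ≤ M := fun θ => (hk θ).trans (by rw [hM]; simp)
  set K := max |m| (M ^ 2) with hK
  have hMK : M ^ 2 ≤ K := le_max_right _ _
  have hK1 : 1 ≤ K := le_trans (by nlinarith) hMK
  set κ' := min κ (2 * |m|) with hκ'
  have hm0 : 0 < |m| := abs_pos.mpr hm
  have hκ0 : 0 < κ' := lt_min hκ (by positivity)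
  refine ⟨σ, min 1 (κ' / (552 * K ^ 4)), hσ, lt_min one_pos (by positivity), ?_⟩
  intro s hs hss ω C ψ hψ hC
  have hs1 : s ≤ 1 := (hss.trans_le (min_le_left _ _)).le
  have hs2 : s * (552 * K ^ 4) ≤ κ' := by
    rw [← le_div_iff₀ (by positivity)]; exact (hss.trans_le (min_le_right _ _)).le
  set t : ℤ → ℝ := fun n => ω + n * α with ht
  have ht1 : ∀ n, t (n + 1) = t n + α := fun n => by simp only [ht]; push_cast; ring
  have hC0 : 0 ≤ C := by have := (abs_nonneg _).trans (hC 0); simpa using this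
  set x : ℤ → ℝ := fun n => s * (ψ n * k (t n) - ψ (n - 1) * h (t n)) with hx
  set z : ℤ → ℝ := fun n => σ * (g (t n) * ψ (n - 1) - g (t n - α) * ψ n) with hz
  have hψx : ∀ n, s * ψ n = g (t n) * x n + s * σ * h (t n) * z n := fun n => by
    simp only [hx, hz]
    linear_combination -s * ψ n * hdet (t n) - s * h (t n) *
      (g (t n) * ψ (n - 1) - g (t n - α) * ψ n) * hσ2
  have hrec : ∀ n, ψ (n + 1) = (coeff μ e₀ (t n) - σ * s ^ 2) * ψ n - ψ (n - 1) := fun n => by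
    have := hψ n
    have h2 : coeff μ (e₀ - σ * s ^ 2) (ω + n * α) = coeff μ e₀ (t n) - σ * s ^ 2 := by
      simp only [coeff, ht]; ring
    rw [h2] at this; linarith
  have hdet' : ∀ n, g (t n + α) * k (t n + α) - g (t n) * h (t n + α) = 1 := fun n => by
    have := hdet (t n + α); rwa [add_sub_cancel_right] at this
  have hxs : ∀ n, x (n + 1) - x n - s * |m| * z n = -σ * s ^ 2 * k (t n + α) * (s * ψ n) := by
    intro n
    simp only [hx, hz, ht1, add_sub_cancel_right, hrec]
    linear_combination s * ψ n * hha (t n) + s * (ψ (n - 1) - ψ n * coeff μ e₀ (t n)) * hka (t n)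
      + s * m * ψ n * heq (t n) + s * (g (t n) * ψ (n - 1) - g (t n - α) * ψ n) * hmσ
  have hzs : ∀ n, z (n + 1) - z n - s * g (t n) ^ 2 * x n = s ^ 2 * σ * g (t n) * h (t n) * z n := by
    intro n
    have h1 : z (n + 1) - z n = s * g (t n) * (s * ψ n) := by
      simp only [hz, ht1, add_sub_cancel_right, hrec]
      linear_combination σ * ψ n * heq (t n) + s ^ 2 * g (t n) * ψ n * hσ2
    rw [h1, hψx]; ring
  have hMM : ∀ p q : ℝ, |p| ≤ M → |q| ≤ M → |p * q| ≤ K := fun p q hp hq => by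
    rw [abs_mul]
    exact le_trans (by nlinarith [abs_nonneg p, abs_nonneg q]) hMK
  have hz0 := eq_zero_of_hyperbolic (x := x) (z := z) (b := fun n => g (t n) ^ 2)
    (C := (s * (C * M * 3)) * (C * M * 3)) hs hs1 hK1 hm0.le (le_max_left _ _)
    (fun n => sq_nonneg _) (fun n => by
      rw [sq]; exact (le_abs_self _).trans (hMM _ _ (hg' _) (hg' _))) (fun n => by
      rw [hxs, hψx]
      have e1 : -σ * s ^ 2 * k (t n + α) * (g (t n) * x n + s * σ * h (t n) * z n) =
          s ^ 2 * (-σ * ((k (t n + α) * g (t n)) * x n) - (σ * σ) * s *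
            ((k (t n + α) * h (t n)) * z n)) := by ring
      rw [e1, hσ2, abs_mul, abs_of_pos (by positivity : 0 < s ^ 2), mul_comm K (s ^ 2),
        mul_assoc (s ^ 2) K]
      refine mul_le_mul_of_nonneg_left ((abs_sub _ _).trans ?_) (sq_nonneg s)
      rw [one_mul, abs_mul, abs_neg, hσ, one_mul, abs_mul _ (x n), abs_mul s (_ * z n), abs_mul _ (z n),
        abs_of_pos hs, mul_add]
      refine add_le_add (mul_le_mul_of_nonneg_right (hMM _ _ (hk' _) (hg' _)) (abs_nonneg _)) ?_
      refine (mul_le_of_le_one_left (by positivity) hs1).trans ?_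
      exact mul_le_mul_of_nonneg_right (hMM _ _ (hk' _) (hh' _)) (abs_nonneg _))
    (fun n => by
      rw [hzs]
      have e1 : s ^ 2 * σ * g (t n) * h (t n) * z n = σ * (s ^ 2 * ((g (t n) * h (t n)) * z n)) := by
        ring
      rw [e1, abs_mul, hσ, one_mul, abs_mul, abs_of_pos (by positivity : 0 < s ^ 2), mul_comm K (s ^ 2),
        mul_assoc (s ^ 2) K, abs_mul]
      refine mul_le_mul_of_nonneg_left ?_ (sq_nonneg s)
      refine (mul_le_mul_of_nonneg_right (hMM _ _ (hg' _) (hh' _)) (abs_nonneg _)).trans ?_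
      exact mul_le_mul_of_nonneg_left (le_add_of_nonneg_left (abs_nonneg _)) (by linarith))
    hκ0 (min_le_right _ _) (fun n => by
      simp only [ht1]; exact (min_le_left _ _).trans (hsq _)) hs2 (fun n => by
      have hψ' : |ψ n| ≤ C * (1 + |(n : ℝ)|) := hC n
      have hψ1 : |ψ (n - 1)| ≤ C * (2 * (1 + |(n : ℝ)|)) := by
        refine (hC _).trans (mul_le_mul_of_nonneg_left ?_ hC0)
        push_cast
        have := abs_sub (n : ℝ) 1
        rw [abs_one] at this
        linarith [abs_nonneg (n : ℝ)]
      have key : ∀ p q : ℝ, |p| ≤ M → |q| ≤ M → |ψ n * p - ψ (n - 1) * q| ≤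
          C * M * 3 * (1 + |(n : ℝ)|) := fun p q hp hq => by
        refine (abs_sub _ _).trans ?_
        rw [abs_mul, abs_mul]
        calc |ψ n| * |p| + |ψ (n - 1)| * |q| ≤ C * (1 + |(n : ℝ)|) * M +
              C * (2 * (1 + |(n : ℝ)|)) * M := by gcongr
          _ = _ := by ring
      have k1 := key _ _ (hk' (t n)) (hh' (t n))
      have k2 := key _ _ (hg' (t n - α)) (hg' (t n))
      have e1 : x n * z n = s * ((ψ n * k (t n) - ψ (n - 1) * h (t n)) *
          (-σ * (ψ n * g (t n - α) - ψ (n - 1) * g (t n)))) := by simp only [hx, hz]; ring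
      rw [e1, abs_mul, abs_mul, abs_mul, abs_neg, hσ, one_mul, abs_of_pos hs]
      calc s * (|ψ n * k (t n) - ψ (n - 1) * h (t n)| * |ψ n * g (t n - α) - ψ (n - 1) * g (t n)|)
          ≤ s * ((C * M * 3 * (1 + |(n : ℝ)|)) * (C * M * 3 * (1 + |(n : ℝ)|))) := by gcongr
        _ = _ := by ring)
  funext n
  have h1 := hψx n
  rw [(hz0 n).1, (hz0 n).2] at h1
  simpa [hs.ne'] using h1

section FiniteSpectral

variable {ι : Type*} [Fintype ι] [DecidableEq ι]

lemma exists_eigenbasis {A : Matrix ι ι ℂ} (hA : A.IsHermitian) :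
    ∃ (b : ι → ι → ℂ) (E : ι → ℝ),
      (∀ i, ∑ j, ‖b j i‖ ^ 2 = 1) ∧ (∀ j, ∑ i, ‖b j i‖ ^ 2 = 1) ∧
      (∀ f : ι → ℂ, ∑ j, ‖∑ i, (starRingEnd ℂ) (b j i) * f i‖ ^ 2 = ∑ i, ‖f i‖ ^ 2) ∧
      (∀ j, A.mulVec (b j) = (E j : ℂ) • b j) ∧
      (∀ (f : ι → ℂ) (j), ∑ i, (starRingEnd ℂ) (b j i) * A.mulVec f i =
        E j * ∑ i, (starRingEnd ℂ) (b j i) * f i) := by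
  set B := hA.eigenvectorBasis with hB
  have hinner : ∀ (f : ι → ℂ) (j), inner ℂ (B j) (WithLp.toLp 2 f) =
      ∑ i, (starRingEnd ℂ) ((B j).ofLp i) * f i := fun f j => by
    rw [PiLp.inner_apply]
    refine Finset.sum_congr rfl fun i _ => ?_
    rw [RCLike.inner_apply, mul_comm]
  have hpars : ∀ f : ι → ℂ, ∑ j, ‖∑ i, (starRingEnd ℂ) ((B j).ofLp i) * f i‖ ^ 2 =
      ∑ i, ‖f i‖ ^ 2 := fun f => by
    have := B.sum_sq_norm_inner_right (WithLp.toLp 2 f)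
    simpa only [hinner, EuclideanSpace.norm_sq_eq] using this
  have heig : ∀ j, A.mulVec (B j).ofLp = (hA.eigenvalues j : ℂ) • (B j).ofLp := fun j => by
    rw [hA.mulVec_eigenvectorBasis j]; rfl
  refine ⟨fun j i => (B j).ofLp i, hA.eigenvalues, fun i => ?_, fun j => ?_, hpars, heig,
    fun f j => ?_⟩
  · have := hpars (Pi.single i 1)
    simp only [Pi.single_apply, mul_ite, mul_one, mul_zero, Finset.sum_ite_eq', Finset.mem_univ,
      if_true, RCLike.norm_conj] at this
    rw [this, Finset.sum_eq_single i (fun k _ hk => by simp [hk]) (by simp)]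
    simp
  · have h1 := B.orthonormal.norm_eq_one j
    have h2 := EuclideanSpace.norm_sq_eq (B j)
    rw [h1, one_pow] at h2
    exact h2.symm
  · have h1 : ∀ i, (starRingEnd ℂ) (A.mulVec (B j).ofLp i) =
        ∑ k, (starRingEnd ℂ) ((B j).ofLp k) * A k i := fun i => by
      rw [Matrix.mulVec, dotProduct, map_sum]
      refine Finset.sum_congr rfl fun k _ => ?_
      rw [map_mul, mul_comm, ← hA.apply k i]
      rfl
    calc ∑ i, (starRingEnd ℂ) ((B j).ofLp i) * A.mulVec f i
        = ∑ i, ∑ k, (starRingEnd ℂ) ((B j).ofLp i) * A i k * f k := by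
          simp only [Matrix.mulVec, dotProduct, Finset.mul_sum, mul_assoc]
      _ = ∑ k, (starRingEnd ℂ) (A.mulVec (B j).ofLp k) * f k := by
          rw [Finset.sum_comm]
          simp only [h1, Finset.sum_mul]
      _ = _ := by
          rw [heig, Finset.mul_sum]
          refine Finset.sum_congr rfl fun k _ => ?_
          simp [mul_assoc]

/-- A Hermitian matrix with an approximate eigenvector supported on `S` has a nearby eigenvalue
with an eigenvector whose weighted mass is controlled by its mass on `S`. -/
lemma exists_eigenvector_controlled {A : Matrix ι ι ℂ} (hA : A.IsHermitian) {E₀ η W : ℝ}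
    (hη : 0 < η) {f : ι → ℂ} {S : Finset ι} (hfS : ∀ i ∉ S, f i = 0) (hf : f ≠ 0)
    (happ : ∑ i, ‖A.mulVec f i - E₀ * f i‖ ^ 2 ≤ (η / 2) ^ 2 * ∑ i, ‖f i‖ ^ 2)
    {w : ι → ℝ} (hw : ∀ i, 0 < w i) (hW : ∑ i, w i ≤ W) :
    ∃ (E : ℝ) (φ : ι → ℂ), |E - E₀| ≤ η ∧ φ ≠ 0 ∧ A.mulVec φ = (E : ℂ) • φ ∧
      ∑ i, w i * ‖φ i‖ ^ 2 ≤ 2 * W * ∑ i ∈ S, ‖φ i‖ ^ 2 := by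
  obtain ⟨b, E, h1, h1', hpars, heig, hAf⟩ := exists_eigenbasis hA
  set c : ι → ℂ := fun j => ∑ i, (starRingEnd ℂ) (b j i) * f i with hc
  set F := ∑ i, ‖f i‖ ^ 2 with hF
  obtain ⟨i₀, hi₀⟩ : ∃ i, f i ≠ 0 := by
    by_contra! h; exact hf (funext h)
  have hFpos : 0 < F := Finset.sum_pos' (fun i _ => by positivity)
    ⟨i₀, Finset.mem_univ _, by have := norm_pos_iff.mpr hi₀; positivity⟩
  have hWpos : 0 < W := lt_of_lt_of_le
    (Finset.sum_pos (fun i _ => hw i) ⟨i₀, Finset.mem_univ _⟩) hW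
  set good := Finset.univ.filter fun j => |E j - E₀| ≤ η with hgood
  have hdev : ∑ j, |E j - E₀| ^ 2 * ‖c j‖ ^ 2 ≤ (η / 2) ^ 2 * F := by
    refine le_trans (le_of_eq ?_) happ
    rw [← hpars fun i => A.mulVec f i - E₀ * f i]
    refine Finset.sum_congr rfl fun j _ => ?_
    have : ∑ i, (starRingEnd ℂ) (b j i) * (A.mulVec f i - E₀ * f i) = ((E j - E₀ : ℝ) : ℂ) * c j := by
      simp only [mul_sub, Finset.sum_sub_distrib, hAf, hc]
      rw [Complex.ofReal_sub, sub_mul, Finset.mul_sum (a := (E₀ : ℂ))]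
      congr 1
      refine Finset.sum_congr rfl fun i _ => ?_
      ring
    rw [this, norm_mul, mul_pow, Complex.norm_real, Real.norm_eq_abs]
  have hbad : η ^ 2 * ∑ j ∈ goodᶜ, ‖c j‖ ^ 2 ≤ (η / 2) ^ 2 * F := by
    refine le_trans ?_ hdev
    rw [Finset.mul_sum]
    refine le_trans (Finset.sum_le_sum fun j hj => ?_)
      (Finset.sum_le_sum_of_subset_of_nonneg (Finset.subset_univ goodᶜ) fun _ _ _ => by positivity)
    have : ¬ |E j - E₀| ≤ η := by simpa [hgood] using hj
    have := (not_le.mp this).le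
    gcongr
  have hgoodsum : 3 / 4 * F ≤ ∑ j ∈ good, ‖c j‖ ^ 2 := by
    have h2 := Finset.sum_add_sum_compl good fun j => ‖c j‖ ^ 2
    have h3 : ∑ j, ‖c j‖ ^ 2 = F := hpars f
    have h4 : ∑ j ∈ goodᶜ, ‖c j‖ ^ 2 ≤ 1 / 4 * F := by
      have : η ^ 2 * ∑ j ∈ goodᶜ, ‖c j‖ ^ 2 ≤ η ^ 2 * (1 / 4 * F) := by
        refine hbad.trans (le_of_eq ?_); ring
      exact le_of_mul_le_mul_left this (by positivity)
    linarith
  have hcj : ∀ j, ‖c j‖ ^ 2 ≤ F * ∑ i ∈ S, ‖b j i‖ ^ 2 := by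
    intro j
    have e1 : c j = ∑ i ∈ S, (starRingEnd ℂ) (b j i) * f i := by
      symm
      refine Finset.sum_subset (Finset.subset_univ S) fun i _ hi => ?_
      rw [hfS i hi, mul_zero]
    have e2 : F = ∑ i ∈ S, ‖f i‖ ^ 2 := by
      symm
      refine Finset.sum_subset (Finset.subset_univ S) fun i _ hi => ?_
      rw [hfS i hi, norm_zero]; norm_num
    rw [e1, e2]
    calc ‖∑ i ∈ S, (starRingEnd ℂ) (b j i) * f i‖ ^ 2 ≤ (∑ i ∈ S, ‖f i‖ * ‖b j i‖) ^ 2 := by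
          gcongr
          refine (norm_sum_le _ _).trans (le_of_eq (Finset.sum_congr rfl fun i _ => ?_))
          rw [norm_mul, RCLike.norm_conj, mul_comm]
      _ ≤ _ := Finset.sum_mul_sq_le_sq_mul_sq _ _ _
  have hexists : ∃ j ∈ good, ∑ i, w i * ‖b j i‖ ^ 2 ≤ 2 * W * ∑ i ∈ S, ‖b j i‖ ^ 2 := by
    by_contra! hcon
    have s1 : ∑ j ∈ good, 2 * W * ∑ i ∈ S, ‖b j i‖ ^ 2 ≤ ∑ j ∈ good, ∑ i, w i * ‖b j i‖ ^ 2 :=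
      Finset.sum_le_sum fun j hj => (hcon j hj).le
    have s2 : ∑ j ∈ good, ∑ i, w i * ‖b j i‖ ^ 2 ≤ W := by
      refine le_trans (Finset.sum_le_sum_of_subset_of_nonneg (Finset.subset_univ good) fun j _ _ =>
        Finset.sum_nonneg fun i _ => mul_nonneg (hw i).le (by positivity)) ?_
      rw [Finset.sum_comm]
      simp only [← Finset.mul_sum, h1, mul_one]
      exact hW
    have s3 : 3 / 4 ≤ ∑ j ∈ good, ∑ i ∈ S, ‖b j i‖ ^ 2 := by
      have : F * (3 / 4) ≤ F * ∑ j ∈ good, ∑ i ∈ S, ‖b j i‖ ^ 2 := by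
        rw [Finset.mul_sum, mul_comm]
        exact hgoodsum.trans (Finset.sum_le_sum fun j _ => hcj j)
      exact le_of_mul_le_mul_left this hFpos
    rw [← Finset.mul_sum] at s1
    nlinarith
  obtain ⟨j, hj, hjw⟩ := hexists
  refine ⟨E j, b j, by simpa [hgood] using hj, fun h0 => ?_, heig j, hjw⟩
  have := h1' j
  rw [h0] at this
  simp at this

end FiniteSpectral

/-- The action of `H - E` on sequences, at phase `ω`. -/
noncomputable def hop (lam α ω E : ℝ) (ψ : ℤ → ℂ) (n : ℤ) : ℂ :=
  ψ (n + 1) + ψ (n - 1) - coeff lam E (ω + n * α) * ψ n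

/-- `E` is an approximate eigenvalue of the operator, tested on finitely supported sequences. -/
def ApproxSpec (lam α ω E : ℝ) : Prop :=
  ∀ ε > (0 : ℝ), ∃ (ψ : ℤ → ℂ) (M : ℕ), (∀ n : ℤ, (M : ℤ) ≤ |n| → ψ n = 0) ∧ ψ ≠ 0 ∧
    ∑ n ∈ Finset.Icc (-(M : ℤ)) M, ‖hop lam α ω E ψ n‖ ^ 2 ≤
      ε ^ 2 * ∑ n ∈ Finset.Icc (-(M : ℤ)) M, ‖ψ n‖ ^ 2

/-- The restriction of the operator to a box. -/
noncomputable def boxMatrix (lam α ω : ℝ) (N : ℕ) :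
    Matrix (Finset.Icc (-(N : ℤ)) N) (Finset.Icc (-(N : ℤ)) N) ℂ :=
  fun i j => (if (j : ℤ) = i + 1 then 1 else 0) + (if (j : ℤ) = i - 1 then 1 else 0) +
    if (j : ℤ) = i then ((-coeff lam 0 (ω + (i : ℤ) * α) : ℝ) : ℂ) else 0

lemma isHermitian_boxMatrix (lam α ω : ℝ) (N : ℕ) : (boxMatrix lam α ω N).IsHermitian := by
  ext i j
  rw [Matrix.conjTranspose_apply, boxMatrix, boxMatrix]
  obtain ⟨i, hi⟩ := i
  obtain ⟨j, hj⟩ := j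
  simp only
  have h1 : (i = j + 1) = (j = i - 1) := by apply propext; omega
  have h2 : (i = j - 1) = (j = i + 1) := by apply propext; omega
  have h3 : (i = j) = (j = i) := by apply propext; omega
  simp only [h1, h2, h3, star_add]
  by_cases hji : j = i
  · subst hji
    simp
  · simp only [hji, if_false]
    split_ifs <;> simp

lemma boxMatrix_mulVec (lam α ω : ℝ) (N : ℕ) {ψ : ℤ → ℂ}
    (hψ : ∀ n ∉ Finset.Icc (-(N : ℤ)) N, ψ n = 0) (i : Finset.Icc (-(N : ℤ)) N) :
    (boxMatrix lam α ω N).mulVec (fun j => ψ j) i = hop lam α ω 0 ψ i := by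
  rw [Matrix.mulVec, dotProduct]
  simp only [boxMatrix]
  rw [Finset.sum_coe_sort (Finset.Icc (-(N : ℤ)) N) fun j => ((if j = (i : ℤ) + 1 then (1 : ℂ) else 0) +
    (if j = (i : ℤ) - 1 then 1 else 0) +
    if j = i then ((-coeff lam 0 (ω + (i : ℤ) * α) : ℝ) : ℂ) else 0) * ψ j]
  simp only [add_mul, Finset.sum_add_distrib, ite_mul, one_mul, zero_mul, Finset.sum_ite_eq']
  have h : ∀ (n : ℤ), (if n ∈ Finset.Icc (-(N : ℤ)) N then ψ n else 0) = ψ n := fun n => by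
    split_ifs with h0
    · rfl
    · exact (hψ n h0).symm
  rw [h, h, if_pos i.2, hop]
  push_cast
  ring

lemma hop_sub (lam α ω E : ℝ) (ψ : ℤ → ℂ) (n : ℤ) :
    hop lam α ω E ψ n = hop lam α ω 0 ψ n - E * ψ n := by
  simp only [hop, coeff]; push_cast; ring

lemma exists_weight : ∃ W : ℝ, ∀ s : Finset ℤ, ∑ n ∈ s, 1 / (1 + (n : ℝ) ^ 2) ≤ W := by
  have h1 : Summable fun n : ℤ => 1 / (n : ℝ) ^ 2 + if n = 0 then (1 : ℝ) else 0 :=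
    (Real.summable_one_div_int_pow.mpr one_lt_two).add
      (summable_of_ne_finset_zero (s := {0}) fun n hn => by simpa using hn)
  have h2 : Summable fun n : ℤ => 1 / (1 + (n : ℝ) ^ 2) := by
    refine Summable.of_nonneg_of_le (fun n => by positivity) (fun n => ?_) h1
    split_ifs with h
    · subst h; norm_num
    · have : (0 : ℝ) < (n : ℝ) ^ 2 := by positivity
      rw [add_zero]
      exact one_div_le_one_div_of_le this (by linarith)
  exact ⟨_, fun s => h2.sum_le_tsum s fun n _ => by positivity⟩

lemma hop_smul (lam α ω E : ℝ) (c : ℂ) (ψ : ℤ → ℂ) (n : ℤ) :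
    hop lam α ω E (fun m => c * ψ m) n = c * hop lam α ω E ψ n := by
  simp only [hop]; ring

lemma hop_eq_zero_of_support {lam α ω E : ℝ} {ψ : ℤ → ℂ} {M : ℕ}
    (hψ : ∀ n : ℤ, (M : ℤ) ≤ |n| → ψ n = 0) {n : ℤ} (hn : (M : ℤ) < |n|) :
    hop lam α ω E ψ n = 0 := by
  have h1 : (M : ℤ) ≤ |n + 1| := by
    rcases abs_cases n with h | h <;> rcases abs_cases (n + 1) with h' | h' <;> omega
  have h2 : (M : ℤ) ≤ |n - 1| := by
    rcases abs_cases n with h | h <;> rcases abs_cases (n - 1) with h' | h' <;> omega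
  rw [hop, hψ _ h1, hψ _ h2, hψ _ hn.le]
  simp

/-- Finite-volume eigenfunctions, normalized near the origin and of controlled growth. -/
lemma ApproxSpec.exists_box_eigenvector {lam α ω E₀ η : ℝ} (h : ApproxSpec lam α ω E₀)
    (hη : 0 < η) : ∃ (M : ℕ) (W : ℝ), ∀ N : ℕ, M ≤ N → ∃ (E : ℝ) (φ : ℤ → ℂ), |E - E₀| ≤ η ∧
      (∀ n ∈ Finset.Icc (-(N : ℤ)) N, hop lam α ω E φ n = 0) ∧
      ∑ n ∈ Finset.Icc (-(M : ℤ)) M, ‖φ n‖ ^ 2 = 1 ∧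
      ∀ n : ℤ, ‖φ n‖ ^ 2 ≤ W * (1 + (n : ℝ) ^ 2) := by
  obtain ⟨ψ, M, hψ, hψ0, happ⟩ := h (η / 2) (half_pos hη)
  obtain ⟨W, hW⟩ := exists_weight
  refine ⟨M, 2 * W, fun N hN => ?_⟩
  set B := Finset.Icc (-(N : ℤ)) N with hB
  set S₀ := Finset.Icc (-(M : ℤ)) M with hS₀
  have hSB : S₀ ⊆ B := Finset.Icc_subset_Icc (by omega) (by omega)
  have hout : ∀ n ∉ S₀, (M : ℤ) < |n| := fun n hn => by
    rw [hS₀, Finset.mem_Icc] at hn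
    rcases abs_cases n with h' | h' <;> omega
  have hψB : ∀ n ∉ B, ψ n = 0 := fun n hn => hψ n (hout n fun h' => hn (hSB h')).le
  have hsumS : ∀ g : ℤ → ℝ, (∀ n ∉ S₀, g n = 0) → ∑ i : B, g i = ∑ n ∈ S₀, g n := fun g hg => by
    rw [Finset.sum_coe_sort B g]
    exact (Finset.sum_subset hSB fun n _ hn => hg n hn).symm
  have hsumF : ∀ g : ℤ → ℝ, ∑ i ∈ Finset.univ.filter (fun i : B => (i : ℤ) ∈ S₀), g i =
      ∑ n ∈ S₀, g n := fun g => by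
    rw [Finset.sum_filter, Finset.sum_coe_sort B fun n => if n ∈ S₀ then g n else 0,
      ← Finset.sum_filter, Finset.filter_mem_eq_inter, Finset.inter_eq_right.mpr hSB]
  obtain ⟨E, φ, hE, hφ0, hφ, hφw⟩ := exists_eigenvector_controlled (isHermitian_boxMatrix lam α ω N)
    (E₀ := E₀) (W := W) hη (f := fun i : B => ψ i)
    (S := Finset.univ.filter fun i : B => (i : ℤ) ∈ S₀)
    (fun i hi => hψ _ (hout _ (by simpa using hi)).le)
    (fun h0 => hψ0 (funext fun n => by
      by_cases hn : n ∈ B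
      · exact congrFun h0 ⟨n, hn⟩
      · exact hψB n hn))
    (by
      rw [hsumS (fun n => ‖ψ n‖ ^ 2) fun n hn => by rw [hψ n (hout n hn).le]; simp]
      refine le_trans (le_of_eq ?_) happ
      rw [← hsumS (fun n => ‖hop lam α ω E₀ ψ n‖ ^ 2) fun n hn => by
        rw [hop_eq_zero_of_support hψ (hout n hn)]; simp]
      refine Finset.sum_congr rfl fun i _ => ?_
      rw [hop_sub, boxMatrix_mulVec lam α ω N hψB])
    (w := fun i => 1 / (1 + (i : ℝ) ^ 2)) (fun i => by positivity)
    (by rw [Finset.sum_coe_sort B fun n => 1 / (1 + (n : ℝ) ^ 2)]; exact hW B)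
  set Φ : ℤ → ℂ := fun n => if hn : n ∈ B then φ ⟨n, hn⟩ else 0 with hΦ
  have hΦφ : ∀ i : B, Φ i = φ i := fun i => by rw [hΦ]; simp
  have hΦB : ∀ n ∉ B, Φ n = 0 := fun n hn => by rw [hΦ]; simp [hn]
  set m := ∑ n ∈ S₀, ‖Φ n‖ ^ 2 with hm
  have hm0 : 0 ≤ m := Finset.sum_nonneg fun _ _ => by positivity
  have hterm : ∀ n : ℤ, ‖Φ n‖ ^ 2 ≤ 2 * W * (1 + (n : ℝ) ^ 2) * m := fun n => by
    by_cases hn : n ∈ B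
    · have h1 : 1 / (1 + (n : ℝ) ^ 2) * ‖Φ n‖ ^ 2 ≤ 2 * W * m := by
        have := Finset.single_le_sum (f := fun i : B => 1 / (1 + (i : ℝ) ^ 2) * ‖φ i‖ ^ 2)
          (fun i _ => by positivity) (Finset.mem_univ ⟨n, hn⟩)
        have h2 := this.trans hφw
        simp only [← hΦφ] at h2
        rwa [hsumF fun n => ‖Φ n‖ ^ 2] at h2
      rw [one_div, inv_mul_le_iff₀ (by positivity)] at h1
      linarith
    · rw [hΦB n hn]
      have : 0 ≤ W := by simpa using hW ∅
      rw [norm_zero, zero_pow two_ne_zero]; positivity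
  have hmpos : 0 < m := by
    refine lt_of_le_of_ne hm0 fun hm' => hφ0 (funext fun i => ?_)
    have := hterm i
    rw [← hm', mul_zero] at this
    have h0 : ‖Φ i‖ = 0 := pow_eq_zero_iff two_ne_zero |>.mp (le_antisymm this (sq_nonneg _))
    rw [← hΦφ, norm_eq_zero.mp h0]; rfl
  have hs : (Real.sqrt m) ^ 2 = m := Real.sq_sqrt hm0
  have hnorm : ∀ n, ‖(((Real.sqrt m)⁻¹ : ℝ) : ℂ) * Φ n‖ ^ 2 = m⁻¹ * ‖Φ n‖ ^ 2 := fun n => by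
    rw [norm_mul, mul_pow, Complex.norm_real, Real.norm_eq_abs, sq_abs, inv_pow, hs]
  refine ⟨E, fun n => (((Real.sqrt m)⁻¹ : ℝ) : ℂ) * Φ n, hE, fun n hn => ?_, ?_, fun n => ?_⟩
  · rw [hop_smul, hop_sub, ← boxMatrix_mulVec lam α ω N hΦB ⟨n, hn⟩]
    simp only [hΦφ]
    have := congrFun hφ ⟨n, hn⟩
    rw [this, Pi.smul_apply, smul_eq_mul, hΦφ ⟨n, hn⟩, sub_self, mul_zero]
  · simp only [hnorm]
    rw [← Finset.mul_sum]
    exact inv_mul_cancel₀ hmpos.ne'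
  · rw [hnorm, inv_mul_le_iff₀ hmpos]
    linarith [hterm n]

/-- Generalized eigenfunctions exist at energies arbitrarily close to the spectrum. -/
theorem ApproxSpec.exists_generalized_eigenfunction {lam α ω E₀ η : ℝ}
    (h : ApproxSpec lam α ω E₀) (hη : 0 < η) : ∃ (E C : ℝ) (u : ℤ → ℝ), |E - E₀| ≤ η ∧ u ≠ 0 ∧
      (∀ n : ℤ, u (n + 1) + u (n - 1) = coeff lam E (ω + n * α) * u n) ∧
      ∀ n : ℤ, |u n| ≤ C * (1 + |(n : ℝ)|) := by
  obtain ⟨M, W, hMW⟩ := h.exists_box_eigenvector hη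
  choose E φ hE hφ hφ1 hφb using fun k : ℕ => hMW (M + k) (Nat.le_add_right M k)
  have hW : 0 ≤ W := by
    have := (sq_nonneg _).trans (hφb 0 0)
    simpa using this
  set C := Real.sqrt W with hC
  have hgrow : ∀ (k : ℕ) (n : ℤ), ‖φ k n‖ ≤ C * (1 + |(n : ℝ)|) := fun k n => by
    refine abs_le_of_sq_le_sq' ?_ (by positivity) |>.2
    rw [mul_pow, hC, Real.sq_sqrt hW]
    refine (hφb k n).trans (mul_le_mul_of_nonneg_left ?_ hW)
    nlinarith [abs_nonneg (n : ℝ), sq_abs (n : ℝ)]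
  have hK : IsCompact (Metric.closedBall E₀ η ×ˢ
      Set.univ.pi fun n : ℤ => Metric.closedBall (0 : ℂ) (C * (1 + |(n : ℝ)|))) :=
    (isCompact_closedBall _ _).prod (isCompact_univ_pi fun n => isCompact_closedBall _ _)
  obtain ⟨⟨E', Φ⟩, ⟨hE', hΦ⟩, σ, hσ, hlim⟩ := hK.tendsto_subseq (x := fun k => (E k, φ k))
    fun k => ⟨by simpa [Real.dist_eq] using hE k, fun n _ => by simpa using hgrow k n⟩
  have hlimE : Tendsto (fun k => E (σ k)) atTop (𝓝 E') := (continuous_fst.tendsto _).comp hlim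
  have hlimφ : ∀ n, Tendsto (fun k => φ (σ k) n) atTop (𝓝 (Φ n)) := fun n =>
    ((continuous_apply n).tendsto _).comp ((continuous_snd.tendsto _).comp hlim)
  have heq : ∀ n : ℤ, hop lam α ω E' Φ n = 0 := fun n => by
    have h1 : Tendsto (fun k => hop lam α ω (E (σ k)) (φ (σ k)) n) atTop
        (𝓝 (hop lam α ω E' Φ n)) := by
      simp only [hop, coeff]
      push_cast
      have : Tendsto (fun k => (E (σ k) : ℂ)) atTop (𝓝 (E' : ℂ)) :=
        (Complex.continuous_ofReal.tendsto _).comp hlimE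
      exact ((hlimφ _).add (hlimφ _)).sub ((this.sub tendsto_const_nhds).mul (hlimφ n))
    refine tendsto_nhds_unique h1 (tendsto_const_nhds.congr' ?_)
    filter_upwards [eventually_ge_atTop n.natAbs] with k hk
    refine (hφ (σ k) n ?_).symm
    have := hσ.id_le k
    simp only [id_eq] at this
    rw [Finset.mem_Icc]
    omega
  have hone : ∑ n ∈ Finset.Icc (-(M : ℤ)) M, ‖Φ n‖ ^ 2 = 1 := by
    refine tendsto_nhds_unique (tendsto_finsetSum _ fun n _ => ((hlimφ n).norm.pow 2)) ?_
    simp only [hφ1]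
    exact tendsto_const_nhds
  have hΦ0 : ∃ n, Φ n ≠ 0 := by
    by_contra! h0
    simp [h0] at hone
  have hΦg : ∀ n : ℤ, ‖Φ n‖ ≤ C * (1 + |(n : ℝ)|) := fun n => by simpa using hΦ n (Set.mem_univ n)
  have hEE : |E' - E₀| ≤ η := by simpa [Real.dist_eq] using hE'
  obtain ⟨n₀, hn₀⟩ := hΦ0
  have hreal : ∀ n : ℤ, Φ (n + 1) + Φ (n - 1) = (coeff lam E' (ω + n * α) : ℂ) * Φ n := fun n =>
    sub_eq_zero.mp (heq n)
  by_cases hre : (Φ n₀).re = 0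
  · refine ⟨E', C, fun n => (Φ n).im, hEE, fun h0 => hn₀ (Complex.ext hre (congrFun h0 n₀)),
      fun n => ?_, fun n => (Complex.abs_im_le_norm _).trans (hΦg n)⟩
    have := congrArg Complex.im (hreal n)
    rwa [Complex.im_ofReal_mul, Complex.add_im] at this
  · refine ⟨E', C, fun n => (Φ n).re, hEE, fun h0 => hre (congrFun h0 n₀),
      fun n => ?_, fun n => (Complex.abs_re_le_norm _).trans (hΦg n)⟩
    have := congrArg Complex.re (hreal n)
    rwa [Complex.re_ofReal_mul, Complex.add_re] at this

/-- The trigonometric polynomial with coefficients `ψ` on `[-M, M]`. -/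
noncomputable def trig (M : ℕ) (ψ : ℤ → ℂ) (x : ℝ) : ℂ :=
  ∑ m ∈ Finset.Icc (-(M : ℤ)) M, ψ m * e (m * x)

lemma norm_trig_le (M : ℕ) (ψ : ℤ → ℂ) (x : ℝ) :
    ‖trig M ψ x‖ ≤ ∑ m ∈ Finset.Icc (-(M : ℤ)) M, ‖ψ m‖ := by
  refine (norm_sum_le _ _).trans (le_of_eq (Finset.sum_congr rfl fun m _ => ?_))
  rw [norm_mul, norm_e, mul_one]

lemma norm_sq_trig (M : ℕ) (ψ : ℤ → ℂ) (x : ℝ) :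
    ((‖trig M ψ x‖ ^ 2 : ℝ) : ℂ) = ∑ m ∈ Finset.Icc (-(M : ℤ)) M, ∑ k ∈ Finset.Icc (-(M : ℤ)) M,
      ψ m * (starRingEnd ℂ) (ψ k) * e ((m - k : ℤ) * x) := by
  rw [← Complex.normSq_eq_norm_sq, Complex.normSq_eq_conj_mul_self, mul_comm, trig, map_sum,
    Finset.sum_mul_sum]
  refine Finset.sum_congr rfl fun m _ => Finset.sum_congr rfl fun k _ => ?_
  have : ((m - k : ℤ) : ℝ) * x = m * x + -(k * x) := by push_cast; ring
  rw [this, e_add, e_neg, map_mul]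
  ring

/-- Time averages of a trigonometric polynomial along an irrational rotation. -/
lemma trig_average {α : ℝ} (hα : Irrational α) (θ : ℝ) (M : ℕ) (ψ : ℤ → ℂ) :
    ∃ C : ℝ, ∀ N : ℕ, |∑ n ∈ Finset.range N, ‖trig M ψ (θ + n * α)‖ ^ 2 -
      N * ∑ m ∈ Finset.Icc (-(M : ℤ)) M, ‖ψ m‖ ^ 2| ≤ C := by
  have hD : ∀ k : ℤ, ∃ C : ℝ, ∀ N : ℕ,
      ‖∑ n ∈ Finset.range N, e (k * (θ + n * α)) - if k = 0 then (N : ℂ) else 0‖ ≤ C := fun k => by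
    by_cases hk : k = 0
    · exact ⟨0, fun N => by simp [hk, e_zero]⟩
    · obtain ⟨C, hC⟩ := norm_sum_e_le hα hk
      exact ⟨C, fun N => by simpa [hk] using hC θ N⟩
  choose C hC using hD
  set S := Finset.Icc (-(M : ℤ)) M with hS
  refine ⟨∑ m ∈ S, ∑ k ∈ S, ‖ψ m * (starRingEnd ℂ) (ψ k)‖ * C (m - k), fun N => ?_⟩
  rw [← Real.norm_eq_abs, ← Complex.norm_real]
  have hdiag : ((N * ∑ m ∈ S, ‖ψ m‖ ^ 2 : ℝ) : ℂ) = ∑ m ∈ S, ∑ k ∈ S,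
      ψ m * (starRingEnd ℂ) (ψ k) * (if m - k = 0 then (N : ℂ) else 0) := by
    push_cast
    rw [Finset.mul_sum]
    refine Finset.sum_congr rfl fun m hm => ?_
    simp only [sub_eq_zero, mul_ite, mul_zero, Finset.sum_ite_eq, hm, if_true]
    rw [Complex.mul_conj, Complex.normSq_eq_norm_sq]
    push_cast; ring
  have hmain : ((∑ n ∈ Finset.range N, ‖trig M ψ (θ + n * α)‖ ^ 2 : ℝ) : ℂ) =
      ∑ m ∈ S, ∑ k ∈ S, ψ m * (starRingEnd ℂ) (ψ k) *
        ∑ n ∈ Finset.range N, e ((m - k : ℤ) * (θ + n * α)) := by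
    rw [Complex.ofReal_sum]
    simp only [norm_sq_trig, ← hS, Finset.mul_sum]
    rw [Finset.sum_comm]
    refine Finset.sum_congr rfl fun m _ => ?_
    rw [Finset.sum_comm]
  rw [Complex.ofReal_sub, hmain, hdiag, ← Finset.sum_sub_distrib]
  refine (norm_sum_le _ _).trans (Finset.sum_le_sum fun m _ => ?_)
  rw [← Finset.sum_sub_distrib]
  refine (norm_sum_le _ _).trans (Finset.sum_le_sum fun k _ => ?_)
  rw [← mul_sub, norm_mul]
  exact mul_le_mul_of_nonneg_left (hC _ _) (norm_nonneg _)

lemma trig_hop {lam α ω E : ℝ} {M : ℕ} {ψ : ℤ → ℂ} (hψ : ∀ n : ℤ, (M : ℤ) ≤ |n| → ψ n = 0)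
    (x : ℝ) : trig M (hop lam α ω E ψ) x = lam * (e ω * trig M ψ (x + α) + e (-ω) * trig M ψ (x - α)) -
      coeff 1 E x * trig M ψ x := by
  have hshift : ∀ (f : ℤ → ℂ), (∀ n : ℤ, (M : ℤ) ≤ |n| → f n = 0) → ∀ j : ℤ, |j| ≤ 1 →
      ∑ m ∈ Finset.Icc (-(M : ℤ)) M, f (m + j) = ∑ m ∈ Finset.Icc (-(M : ℤ)) M, f m := by
    intro f hf j hj
    rw [abs_le] at hj
    have e1 : ∑ m ∈ Finset.Icc (-(M : ℤ)) M, f (m + j) =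
        ∑ m ∈ Finset.Icc (-(M : ℤ) + j) (M + j), f m := by
      rw [← Finset.image_add_right_Icc, Finset.sum_image fun a _ b _ h => add_right_cancel h]
    rw [e1]
    have hbig : ∀ a b : ℤ, a ≤ -M + 1 → (M : ℤ) - 1 ≤ b → -(M : ℤ) - 1 ≤ a → b ≤ M + 1 →
        ∑ m ∈ Finset.Icc a b, f m = ∑ m ∈ Finset.Icc (-(M : ℤ) - 1) (M + 1), f m :=
      fun a b ha hb ha' hb' => Finset.sum_subset (Finset.Icc_subset_Icc ha' hb') fun n _ hn => by
        refine hf n ?_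
        rw [Finset.mem_Icc] at hn
        rcases abs_cases n with h' | h' <;> omega
    rw [hbig _ _ (by omega) (by omega) (by omega) (by omega),
      hbig (-(M : ℤ)) M (by omega) (by omega) (by omega) (by omega)]
  have h1 : ∑ m ∈ Finset.Icc (-(M : ℤ)) M, ψ (m + 1) * e (m * x) = e (-x) * trig M ψ x := by
    rw [trig, Finset.mul_sum,
      ← hshift (fun m => e (-x) * (ψ m * e (m * x))) (fun n hn => by simp [hψ n hn]) 1 (by simp)]
    refine Finset.sum_congr rfl fun m _ => ?_
    have : (m : ℝ) * x = -x + ((m + 1 : ℤ) : ℝ) * x := by push_cast; ring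
    rw [this, e_add]; ring
  have h2 : ∑ m ∈ Finset.Icc (-(M : ℤ)) M, ψ (m - 1) * e (m * x) = e x * trig M ψ x := by
    rw [trig, Finset.mul_sum,
      ← hshift (fun m => e x * (ψ m * e (m * x))) (fun n hn => by simp [hψ n hn]) (-1) (by simp)]
    refine Finset.sum_congr rfl fun m _ => ?_
    have : (m : ℝ) * x = x + ((m + -1 : ℤ) : ℝ) * x := by push_cast; ring
    rw [this, e_add, sub_eq_add_neg]; ring
  have h3 : ∑ m ∈ Finset.Icc (-(M : ℤ)) M, (coeff lam E (ω + m * α) : ℂ) * ψ m * e (m * x) =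
      E * trig M ψ x - lam * (e ω * trig M ψ (x + α) + e (-ω) * trig M ψ (x - α)) := by
    simp only [trig, Finset.mul_sum, ← Finset.sum_add_distrib, ← Finset.sum_sub_distrib]
    refine Finset.sum_congr rfl fun m _ => ?_
    have hc : (coeff lam E (ω + m * α) : ℂ) = E - lam * (e ω * e (m * α) + e (-ω) * e (-(m * α))) := by
      rw [← e_add, ← e_add, ← neg_add, e_add_e_neg, coeff]; push_cast; ring_nf
    have ea : (m : ℝ) * (x + α) = m * x + m * α := by ring
    have eb : (m : ℝ) * (x - α) = m * x + -(m * α) := by ring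
    rw [hc, ea, eb, e_add, e_add (m * x)]
    ring
  have h4 : (coeff 1 E x : ℂ) = E - (e x + e (-x)) := by
    rw [e_add_e_neg, coeff]; push_cast; ring
  have : trig M (hop lam α ω E ψ) x = ∑ m ∈ Finset.Icc (-(M : ℤ)) M, ψ (m + 1) * e (m * x) +
      ∑ m ∈ Finset.Icc (-(M : ℤ)) M, ψ (m - 1) * e (m * x) -
      ∑ m ∈ Finset.Icc (-(M : ℤ)) M, (coeff lam E (ω + m * α) : ℂ) * ψ m * e (m * x) := by
    rw [trig, ← Finset.sum_add_distrib, ← Finset.sum_sub_distrib]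
    refine Finset.sum_congr rfl fun m _ => ?_
    rw [hop]; ring
  rw [this, h1, h2, h3, h4]
  ring

/-- Truncation of a sequence to `[0, N)`. -/
noncomputable def truncate (N : ℕ) (φ : ℤ → ℂ) (n : ℤ) : ℂ := if 0 ≤ n ∧ n < N then φ n else 0

lemma sum_truncate (N : ℕ) (f : ℤ → ℝ) :
    ∑ n ∈ Finset.Icc (-(N : ℤ)) N, (if 0 ≤ n ∧ n < (N : ℤ) then f n else 0) =
      ∑ n ∈ Finset.range N, f n := by
  rw [← Finset.sum_filter]
  symm
  refine Finset.sum_bij (fun n _ => (n : ℤ)) (fun n hn => ?_) (fun a _ b _ h => by exact_mod_cast h)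
    (fun n hn => ⟨n.toNat, ?_⟩) fun _ _ => rfl
  · rw [Finset.mem_range] at hn
    rw [Finset.mem_filter, Finset.mem_Icc]
    omega
  · rw [Finset.mem_filter, Finset.mem_Icc] at hn
    exact ⟨by rw [Finset.mem_range]; omega, by omega⟩

lemma sum_hop_truncate {lam α ω E B : ℝ} {φ : ℤ → ℂ} (hφ : ∀ n, ‖φ n‖ ≤ B) (N : ℕ) :
    ∑ n ∈ Finset.Icc (-(N : ℤ)) N, ‖hop lam α ω E (truncate N φ) n‖ ^ 2 ≤
      ∑ n ∈ Finset.range N, ‖hop lam α ω E φ n‖ ^ 2 +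
        4 * ((2 + (|E| + 2 * |lam|)) * B) ^ 2 := by
  set K := ((2 + (|E| + 2 * |lam|)) * B) ^ 2 with hK
  set T : Finset ℤ := {-1, 0, (N : ℤ) - 1, (N : ℤ)} with hT
  have hB : 0 ≤ B := (norm_nonneg _).trans (hφ 0)
  have htr : ∀ n, ‖truncate N φ n‖ ≤ B := fun n => by
    rw [truncate]; split_ifs
    · exact hφ n
    · simpa using hB
  have hpt : ∀ n : ℤ, ‖hop lam α ω E (truncate N φ) n‖ ^ 2 ≤
      (if 0 ≤ n ∧ n < (N : ℤ) then ‖hop lam α ω E φ n‖ ^ 2 else 0) + if n ∈ T then K else 0 := by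
    intro n
    by_cases hn : n ∈ T
    · rw [if_pos hn]
      refine le_add_of_nonneg_of_le (by split_ifs <;> positivity) ?_
      rw [hK]
      gcongr
      rw [hop]
      refine (norm_sub_le _ _).trans ?_
      refine (add_le_add (norm_add_le _ _) (norm_mul_le _ _)).trans ?_
      rw [Complex.norm_real, Real.norm_eq_abs]
      have h1 := htr (n + 1)
      have h2 := htr (n - 1)
      have h3 : |coeff lam E (ω + n * α)| * ‖truncate N φ n‖ ≤ (|E| + 2 * |lam|) * B :=
        mul_le_mul (abs_coeff_le lam E _) (htr n) (norm_nonneg _) (by positivity)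
      linarith
    · rw [if_neg hn, add_zero]
      simp only [hT, Finset.mem_insert, Finset.mem_singleton, not_or] at hn
      obtain ⟨ha, hb, hc, hd⟩ := hn
      by_cases hin : 0 ≤ n ∧ n < (N : ℤ)
      · rw [if_pos hin, hop, hop, truncate, truncate, truncate, if_pos (by omega),
          if_pos (by omega), if_pos hin]
      · rw [if_neg hin, hop, truncate, truncate, truncate, if_neg (by omega),
          if_neg (by omega), if_neg hin]
        simp
  refine (Finset.sum_le_sum fun n _ => hpt n).trans ?_
  rw [Finset.sum_add_distrib, sum_truncate N fun n => ‖hop lam α ω E φ n‖ ^ 2]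
  gcongr
  rw [← Finset.sum_filter, Finset.sum_const, nsmul_eq_mul]
  have hcard : (Finset.filter (fun n => n ∈ T) (Finset.Icc (-(N : ℤ)) N)).card ≤ 4 :=
    (Finset.card_le_card fun n hn => (Finset.mem_filter.mp hn).2).trans Finset.card_le_four
  have : ((Finset.filter (fun n => n ∈ T) (Finset.Icc (-(N : ℤ)) N)).card : ℝ) ≤ 4 := by
    exact_mod_cast hcard
  exact mul_le_mul_of_nonneg_right this (by positivity)

/-- Aubry duality for the approximate point spectrum. -/
theorem ApproxSpec.dual {lam α ω E : ℝ} (hα : Irrational α) (hlam : lam ≠ 0)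
    (h : ApproxSpec lam α ω E) (θ : ℝ) : ApproxSpec (1 / lam) α θ (E / lam) := by
  intro ε hε
  obtain ⟨ψ, M, hψ, hψ0, happ⟩ := h (ε * |lam| / 2) (by positivity)
  set A := ∑ n ∈ Finset.Icc (-(M : ℤ)) M, ‖ψ n‖ ^ 2 with hA
  set D := ∑ n ∈ Finset.Icc (-(M : ℤ)) M, ‖hop lam α ω E ψ n‖ ^ 2 with hD
  have hApos : 0 < A := by
    obtain ⟨n, hn⟩ : ∃ n, ψ n ≠ 0 := by
      by_contra! h0; exact hψ0 (funext h0)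
    refine Finset.sum_pos' (fun _ _ => by positivity) ⟨n, ?_, by positivity⟩
    have : ¬ (M : ℤ) ≤ |n| := fun h' => hn (hψ n h')
    rw [Finset.mem_Icc]
    rcases abs_cases n with h' | h' <;> omega
  obtain ⟨C₁, hC₁⟩ := trig_average hα θ M ψ
  obtain ⟨C₂, hC₂⟩ := trig_average hα θ M (hop lam α ω E ψ)
  set φ : ℤ → ℂ := fun n => e (n * ω) * trig M ψ (θ + n * α) with hφ
  set B := ∑ m ∈ Finset.Icc (-(M : ℤ)) M, ‖ψ m‖ with hB
  have hφn : ∀ n, ‖φ n‖ = ‖trig M ψ (θ + n * α)‖ := fun n => by rw [hφ, norm_mul, norm_e, one_mul]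
  have hhop : ∀ n : ℤ, hop (1 / lam) α θ (E / lam) φ n =
      e (n * ω) * ((lam : ℂ)⁻¹ * trig M (hop lam α ω E ψ) (θ + n * α)) := fun n => by
    have hl : (lam : ℂ) ≠ 0 := by exact_mod_cast hlam
    have hc : (coeff (1 / lam) (E / lam) (θ + n * α) : ℂ) = (lam : ℂ)⁻¹ * coeff 1 E (θ + n * α) := by
      simp only [coeff]; push_cast; field_simp
    have ea : ((n + 1 : ℤ) : ℝ) * ω = n * ω + ω := by push_cast; ring
    have eb : ((n - 1 : ℤ) : ℝ) * ω = n * ω + -ω := by push_cast; ring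
    have ec : θ + ((n + 1 : ℤ) : ℝ) * α = θ + n * α + α := by push_cast; ring
    have ed : θ + ((n - 1 : ℤ) : ℝ) * α = θ + n * α - α := by push_cast; ring
    rw [trig_hop hψ, hop, hc, hφ]
    simp only
    rw [ea, eb, ec, ed, e_add, e_add (n * ω) (-ω)]
    field_simp
  have hhopn : ∀ n : ℤ, ‖hop (1 / lam) α θ (E / lam) φ n‖ ^ 2 =
      (lam ^ 2)⁻¹ * ‖trig M (hop lam α ω E ψ) (θ + n * α)‖ ^ 2 := fun n => by
    rw [hhop, norm_mul, norm_e, one_mul, norm_mul, mul_pow, norm_inv, Complex.norm_real,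
      Real.norm_eq_abs, inv_pow, sq_abs]
  set K := 4 * ((2 + (|E / lam| + 2 * |1 / lam|)) * B) ^ 2 with hK
  have hup : ∀ N : ℕ, ∑ n ∈ Finset.Icc (-(N : ℤ)) N,
      ‖hop (1 / lam) α θ (E / lam) (truncate N φ) n‖ ^ 2 ≤ (lam ^ 2)⁻¹ * (N * D + C₂) + K := by
    intro N
    refine (sum_hop_truncate (B := B) (fun n => (hφn n).trans_le (norm_trig_le _ _ _)) N).trans ?_
    gcongr
    simp only [hhopn]
    rw [← Finset.mul_sum]
    gcongr
    have := (abs_le.mp (hC₂ N)).2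
    push_cast
    linarith
  have hlow : ∀ N : ℕ, N * A - C₁ ≤ ∑ n ∈ Finset.Icc (-(N : ℤ)) N, ‖truncate N φ n‖ ^ 2 := by
    intro N
    have e1 : ∑ n ∈ Finset.Icc (-(N : ℤ)) N, ‖truncate N φ n‖ ^ 2 =
        ∑ n ∈ Finset.range N, ‖φ n‖ ^ 2 := by
      rw [← sum_truncate N fun n => ‖φ n‖ ^ 2]
      refine Finset.sum_congr rfl fun n _ => ?_
      rw [truncate]; split_ifs <;> simp
    rw [e1]
    simp only [hφn]
    have := (abs_le.mp (hC₁ N)).1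
    push_cast
    linarith
  have hl2 : 0 < lam ^ 2 := by positivity
  have hDA : (lam ^ 2)⁻¹ * D ≤ ε ^ 2 / 4 * A := by
    rw [inv_mul_le_iff₀ hl2]
    refine happ.trans (le_of_eq ?_)
    rw [div_pow, mul_pow, sq_abs]; ring
  obtain ⟨N, hN⟩ := exists_nat_gt (max (C₁ / A)
    (((lam ^ 2)⁻¹ * C₂ + K + ε ^ 2 * C₁) / (3 / 4 * ε ^ 2 * A)))
  rw [max_lt_iff, div_lt_iff₀ hApos, div_lt_iff₀ (by positivity)] at hN
  obtain ⟨hN1, hN2⟩ := hN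
  refine ⟨truncate N φ, N, fun n hn => if_neg ?_, fun h0 => ?_, (hup N).trans (le_trans ?_
    (mul_le_mul_of_nonneg_left (hlow N) (by positivity)))⟩
  · rcases abs_cases n with h' | h' <;> omega
  · have := hlow N
    rw [h0] at this
    simp at this
    linarith
  · have := mul_le_mul_of_nonneg_left hDA (Nat.cast_nonneg (α := ℝ) N)
    nlinarith

/-- At subcritical coupling the approximate point spectrum contains no interval. -/
theorem not_approxSpec_Ioo_of_abs_lt_one {lam α c r ω a b : ℝ} (hα : Irrational α) (hc : 0 < c)
    (hr : 0 < r) (hsin : SinLower α c r) (hlam : lam ≠ 0) (hlam1 : |lam| < 1) (hab : a < b) :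
    ∃ E ∈ Set.Ioo a b, ¬ ApproxSpec lam α ω E := by
  by_contra! hall
  have hlam0 : 0 < |lam| := abs_pos.mpr hlam
  have hmid : (a + b) / 2 ∈ Set.Ioo a b := ⟨by linarith, by linarith⟩
  obtain ⟨E, C, u, hE, hu0, hu, huC⟩ := ((hall _ hmid).dual hα hlam 0).exists_generalized_eigenfunction
    (η := (b - a) / (4 * |lam|)) (by have := sub_pos.mpr hab; positivity)
  simp only [zero_add] at hu
  obtain ⟨C', γ, hγ, hdecay⟩ := localization hα hc hr hsin
    (by rw [abs_div, abs_one]; exact one_lt_one_div hlam0 hlam1) hu huC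
  obtain ⟨g, hg, hper, hg0, heq⟩ :=
    exists_smooth_solution (one_div_ne_zero hlam) hu hγ hdecay hu0
  rw [one_div_one_div, div_div_eq_mul_div, div_one] at heq
  obtain ⟨R⟩ := exists_reduction hα hc hsin hlam hg hper hg0 heq
  obtain ⟨σ, s₀, hσ, hs₀, hgap⟩ := R.exists_gap
  have hσ2 : σ * σ = 1 := by rw [← abs_mul_abs_self, hσ, one_mul]
  have hdist : |E * lam - (a + b) / 2| ≤ (b - a) / 4 := by
    have h1 : E * lam - (a + b) / 2 = (E - (a + b) / 2 / lam) * lam := by field_simp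
    rw [h1, abs_mul]
    refine (mul_le_mul_of_nonneg_right hE hlam0.le).trans (le_of_eq ?_)
    field_simp
  set s := min (s₀ / 2) (min 1 ((b - a) / 8)) with hs
  have hspos : 0 < s := lt_min (half_pos hs₀) (lt_min one_pos (by linarith))
  have hs1 : s ≤ s₀ / 2 := min_le_left _ _
  have hs2 : s ≤ 1 := (min_le_right _ _).trans (min_le_left _ _)
  have hs3 : s ≤ (b - a) / 8 := (min_le_right _ _).trans (min_le_right _ _)
  have hsq : s ^ 2 ≤ (b - a) / 8 := by nlinarith
  have hσs : |σ * s ^ 2| ≤ (b - a) / 8 := by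
    rwa [abs_mul, hσ, one_mul, abs_of_nonneg (sq_nonneg s)]
  rw [abs_le] at hdist hσs
  have hmem : E * lam - σ * s ^ 2 ∈ Set.Ioo a b := ⟨by linarith, by linarith⟩
  obtain ⟨E', C₂, v, hE', hv0, hv, hvC⟩ :=
    (hall _ hmem).exists_generalized_eigenfunction (η := s ^ 2 / 2) (by positivity)
  set q := σ * (E * lam - E') with hq
  have hqs : |q - s ^ 2| ≤ s ^ 2 / 2 := by
    have : q - s ^ 2 = -σ * (E' - (E * lam - σ * s ^ 2)) := by
      rw [hq]; linear_combination (s ^ 2) * hσ2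
    rw [this, abs_mul, abs_neg, hσ, one_mul]
    exact hE'
  rw [abs_le] at hqs
  have hs2pos : 0 < s ^ 2 := by positivity
  have hqpos : 0 < q := by linarith
  have hsqrt : Real.sqrt q ^ 2 = q := Real.sq_sqrt hqpos.le
  refine hv0 (hgap (Real.sqrt q) (Real.sqrt_pos.mpr hqpos) ?_ ω C₂ v (fun n => ?_) hvC)
  · rw [Real.sqrt_lt' hs₀]
    nlinarith
  · have : E * lam - σ * Real.sqrt q ^ 2 = E' := by
      rw [hsqrt, hq]; linear_combination (-(E * lam - E')) * hσ2
    rw [this]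
    exact hv n

/-- Away from critical coupling the approximate point spectrum contains no interval. -/
theorem not_approxSpec_Ioo {lam α c r ω a b : ℝ} (hα : Irrational α) (hc : 0 < c)
    (hr : 0 < r) (hsin : SinLower α c r) (hlam : 0 < lam) (hlam1 : lam ≠ 1) (hab : a < b) :
    ∃ E ∈ Set.Ioo a b, ¬ ApproxSpec lam α ω E := by
  rcases lt_or_gt_of_ne hlam1 with h | h
  · exact not_approxSpec_Ioo_of_abs_lt_one hα hc hr hsin hlam.ne' (by rwa [abs_of_pos hlam]) hab
  · obtain ⟨E, hE, hnot⟩ := not_approxSpec_Ioo_of_abs_lt_one (ω := 0) (lam := 1 / lam) hα hc hr hsin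
      (one_div_ne_zero hlam.ne')
      (by rw [abs_of_pos (by positivity), div_lt_one hlam]; exact h)
      (div_lt_div_of_pos_right hab hlam)
    refine ⟨E * lam, ⟨(div_lt_iff₀ hlam).mp hE.1, (lt_div_iff₀ hlam).mp hE.2⟩, fun hcon => hnot ?_⟩
    have := hcon.dual hα hlam.ne' 0
    rwa [mul_div_cancel_right₀ _ hlam.ne'] at this

/-- The Hilbert space of square-summable two-sided sequences. -/
abbrev SeqSpace : Type := lp (fun _ : ℤ => ℂ) 2

lemma hasSum_norm_sq (ψ : SeqSpace) : HasSum (fun n => ‖ψ n‖ ^ 2) (‖ψ‖ ^ 2) := by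
  have h := lp.hasSum_norm (p := 2) (by simp) ψ
  simpa using h

/-- Translation of a square-summable sequence. -/
noncomputable def translate (k : ℤ) (ψ : SeqSpace) : SeqSpace :=
  ⟨fun n => ψ (n + k), memℓp_gen (by
    simpa [Function.comp_def] using (hasSum_norm_sq ψ).summable.comp_injective (add_left_injective k))⟩

lemma translate_apply (k : ℤ) (ψ : SeqSpace) (n : ℤ) : translate k ψ n = ψ (n + k) := rfl

lemma norm_translate (k : ℤ) (ψ : SeqSpace) : ‖translate k ψ‖ = ‖ψ‖ := by
  have h : ‖translate k ψ‖ ^ 2 = ‖ψ‖ ^ 2 := by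
    rw [← (hasSum_norm_sq ψ).tsum_eq, ← (hasSum_norm_sq (translate k ψ)).tsum_eq]
    exact (Equiv.addRight k).tsum_eq fun n => ‖ψ n‖ ^ 2
  exact (pow_left_inj₀ (norm_nonneg _) (norm_nonneg _) two_ne_zero).mp h

lemma inner_translate (k : ℤ) (φ ψ : SeqSpace) :
    inner ℂ (translate k φ) ψ = inner ℂ φ (translate (-k) ψ) := by
  rw [lp.inner_eq_tsum, lp.inner_eq_tsum,
    ← (Equiv.addRight k).tsum_eq fun n => inner ℂ (φ n) (translate (-k) ψ n)]
  refine tsum_congr fun n => ?_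
  simp [translate_apply]

lemma tendsto_coord (ψ : SeqSpace) : Tendsto (fun n : ℤ => ψ n) cofinite (𝓝 0) := by
  have h := (hasSum_norm_sq ψ).summable.tendsto_cofinite_zero
  rw [tendsto_zero_iff_norm_tendsto_zero]
  have h2 := h.sqrt
  simpa [Real.sqrt_sq] using h2

lemma tendsto_coord_nat (ψ : SeqSpace) (k : ℤ) :
    Tendsto (fun n : ℕ => ψ (n + k)) atTop (𝓝 0) := by
  refine (tendsto_coord ψ).comp ?_
  rw [← Nat.cofinite_eq_atTop]
  exact Function.Injective.tendsto_cofinite fun a b h => by simpa using h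

lemma norm_le_mul_of_forall {φ ψ : SeqSpace} {C : ℝ} (hC : 0 ≤ C) (h : ∀ n, ‖φ n‖ ≤ C * ‖ψ n‖) :
    ‖φ‖ ≤ C * ‖ψ‖ := by
  refine abs_le_of_sq_le_sq' ?_ (by positivity) |>.2
  rw [mul_pow]
  refine hasSum_le (fun n => ?_) (hasSum_norm_sq φ) ((hasSum_norm_sq ψ).mul_left (C ^ 2))
  rw [← mul_pow]
  exact pow_le_pow_left₀ (norm_nonneg _) (h n) 2

section Operator

variable {lam α ω : ℝ} {H : SeqSpace →L[ℂ] SeqSpace}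

/-- `H` is the almost Mathieu operator. -/
def IsAlmostMathieu (lam α ω : ℝ) (H : SeqSpace →L[ℂ] SeqSpace) : Prop :=
  ∀ (ψ : SeqSpace) (n : ℤ), (H ψ) n = ψ (n + 1) + ψ (n - 1) +
    (↑(2 * lam * Real.cos (2 * Real.pi * (ω + n * α))) : ℂ) * ψ n

lemma IsAlmostMathieu.sub_smul_apply (hH : IsAlmostMathieu lam α ω H) (E : ℝ) (ψ : SeqSpace)
    (n : ℤ) : (H ψ - (E : ℂ) • ψ : SeqSpace) n = hop lam α ω E ψ n := by
  rw [lp.coeFn_sub, Pi.sub_apply, hH, lp.coeFn_smul, Pi.smul_apply, smul_eq_mul, hop, coeff]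
  push_cast
  ring

lemma IsAlmostMathieu.isSelfAdjoint (hH : IsAlmostMathieu lam α ω H) : IsSelfAdjoint H := by
  rw [ContinuousLinearMap.isSelfAdjoint_iff_isSymmetric]
  intro φ ψ
  have hD : ∀ χ : SeqSpace, ∀ n, (H χ - translate 1 χ - translate (-1) χ : SeqSpace) n =
      (↑(2 * lam * Real.cos (2 * Real.pi * (ω + n * α))) : ℂ) * χ n := fun χ n => by
    rw [lp.coeFn_sub, Pi.sub_apply, lp.coeFn_sub, Pi.sub_apply, hH, translate_apply, translate_apply,
      sub_eq_add_neg n 1]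
    ring
  have h1 : inner ℂ (H φ - translate 1 φ - translate (-1) φ) ψ =
      inner ℂ φ (H ψ - translate 1 ψ - translate (-1) ψ) := by
    rw [lp.inner_eq_tsum, lp.inner_eq_tsum]
    refine tsum_congr fun n => ?_
    rw [hD, hD, RCLike.inner_apply, RCLike.inner_apply, map_mul, Complex.conj_ofReal]
    ring
  have h2 := inner_translate 1 φ ψ
  have h3 := inner_translate (-1) φ ψ
  rw [neg_neg] at h3
  simp only [inner_sub_left, inner_sub_right] at h1
  change inner ℂ (H φ) ψ = inner ℂ φ (H ψ)
  linear_combination h1 + h2 + h3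

lemma IsAlmostMathieu.bounded_below (hH : IsAlmostMathieu lam α ω H) {E ε : ℝ}
    (h : ∀ (ψ : ℤ → ℂ) (M : ℕ), (∀ n : ℤ, (M : ℤ) ≤ |n| → ψ n = 0) → ψ ≠ 0 →
      ε ^ 2 * ∑ n ∈ Finset.Icc (-(M : ℤ)) M, ‖ψ n‖ ^ 2 <
        ∑ n ∈ Finset.Icc (-(M : ℤ)) M, ‖hop lam α ω E ψ n‖ ^ 2) (ψ : SeqSpace) :
    ε * ‖ψ‖ ≤ ‖H ψ - (E : ℂ) • ψ‖ := by
  have hfin : ∀ (χ : SeqSpace) (M : ℕ), (∀ n : ℤ, (M : ℤ) ≤ |n| → χ n = 0) →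
      ε * ‖χ‖ ≤ ‖H χ - (E : ℂ) • χ‖ := by
    intro χ M hχ
    by_cases h0 : χ = 0
    · simp [h0]
    refine abs_le_of_sq_le_sq' ?_ (norm_nonneg _) |>.2
    have hout : ∀ n ∉ Finset.Icc (-(M : ℤ)) M, (M : ℤ) < |n| := fun n hn => by
      rw [Finset.mem_Icc] at hn
      rcases abs_cases n with h' | h' <;> omega
    have e1 : ‖χ‖ ^ 2 = ∑ n ∈ Finset.Icc (-(M : ℤ)) M, ‖χ n‖ ^ 2 :=
      (hasSum_norm_sq χ).unique (hasSum_sum_of_ne_finset_zero fun n hn => by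
        rw [hχ n (hout n hn).le]; simp)
    have e2 : ‖H χ - (E : ℂ) • χ‖ ^ 2 =
        ∑ n ∈ Finset.Icc (-(M : ℤ)) M, ‖hop lam α ω E χ n‖ ^ 2 := by
      refine (hasSum_norm_sq _).unique ?_
      simp only [hH.sub_smul_apply]
      exact hasSum_sum_of_ne_finset_zero fun n hn => by
        rw [hop_eq_zero_of_support hχ (hout n hn)]; simp
    rw [mul_pow, e1, e2]
    exact (h χ M hχ fun h' => h0 (lp.ext h')).le
  have hsum := lp.hasSum_single (p := 2) (by simp) ψ
  have hfs : ∀ s : Finset ℤ, ε * ‖∑ i ∈ s, (lp.single 2 i (ψ i) : SeqSpace)‖ ≤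
      ‖H (∑ i ∈ s, (lp.single 2 i (ψ i) : SeqSpace)) -
        (E : ℂ) • ∑ i ∈ s, (lp.single 2 i (ψ i) : SeqSpace)‖ := fun s => by
    refine hfin _ (s.sup Int.natAbs + 1) fun n hn => ?_
    rw [lp.coeFn_sum, Finset.sum_apply]
    refine Finset.sum_eq_zero fun i hi => ?_
    have := Finset.le_sup (f := Int.natAbs) hi
    rw [lp.single_apply_ne]
    rintro rfl
    rw [Int.abs_eq_natAbs] at hn
    omega
  have hl : Tendsto (fun s : Finset ℤ => ε * ‖∑ i ∈ s, (lp.single 2 i (ψ i) : SeqSpace)‖) atTop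
      (𝓝 (ε * ‖ψ‖)) := hsum.norm.const_mul ε
  have hr : Tendsto (fun s : Finset ℤ => ‖H (∑ i ∈ s, (lp.single 2 i (ψ i) : SeqSpace)) -
        (E : ℂ) • ∑ i ∈ s, (lp.single 2 i (ψ i) : SeqSpace)‖) atTop
      (𝓝 ‖H ψ - (E : ℂ) • ψ‖) :=
    (((H.continuous.tendsto ψ).comp hsum).sub (Tendsto.const_smul hsum (E : ℂ))).norm
  exact le_of_tendsto_of_tendsto' hl hr hfs

end Operator

lemma isUnit_of_bounded_below {V : Type*} [NormedAddCommGroup V] [InnerProductSpace ℂ V]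
    [CompleteSpace V] {T : V →L[ℂ] V} (hT : IsSelfAdjoint T) {ε : ℝ} (hε : 0 < ε)
    (h : ∀ x, ε * ‖x‖ ≤ ‖T x‖) : IsUnit T := by
  rw [ContinuousLinearMap.isUnit_iff_bijective, ContinuousLinearMap.bijective_iff_dense_range_and_antilipschitz]
  refine ⟨?_, ⟨ε⁻¹, by positivity⟩, T.antilipschitz_of_bound fun x => ?_⟩
  · rw [Submodule.topologicalClosure_eq_top_iff, ContinuousLinearMap.orthogonal_range, hT.adjoint_eq]
    exact LinearMap.ker_eq_bot'.mpr fun x hx => by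
      have := h x
      have hx' : T x = 0 := hx
      rw [hx', norm_zero] at this
      exact norm_le_zero_iff.mp (nonpos_of_mul_nonpos_right this hε)
  · change ‖x‖ ≤ ε⁻¹ * ‖T x‖
    rw [inv_mul_eq_div, le_div_iff₀ hε, mul_comm]
    exact h x

theorem IsAlmostMathieu.approxSpec {lam α ω : ℝ} {H : SeqSpace →L[ℂ] SeqSpace}
    (hH : IsAlmostMathieu lam α ω H) {E : ℝ} (hE : (E : ℂ) ∈ spectrum ℂ H) :
    ApproxSpec lam α ω E := by
  by_contra hcon
  simp only [ApproxSpec] at hcon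
  push Not at hcon
  obtain ⟨ε, hε, hcon⟩ := hcon
  have hb := hH.bounded_below hcon
  rw [spectrum.mem_iff] at hE
  refine hE ?_
  rw [← IsUnit.neg_iff, neg_sub]
  refine isUnit_of_bounded_below (hH.isSelfAdjoint.sub ?_) hε fun x => ?_
  · rw [IsSelfAdjoint, Algebra.algebraMap_eq_smul_one, star_smul, star_one]
    simp
  · rw [Algebra.algebraMap_eq_smul_one]
    exact hb x

lemma exists_return (α : ℝ) (K : ℕ) {ε : ℝ} (hε : 0 < ε) : ∃ k ≥ K, ‖e (k * α) - 1‖ < ε := by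
  obtain ⟨a, _, σ, hσ, hlim⟩ := (isCompact_closedBall (0 : ℂ) 1).tendsto_subseq
    (x := fun n : ℕ => e (n * α)) fun n => by simp [norm_e]
  obtain ⟨N, hN⟩ := Metric.cauchySeq_iff'.mp hlim.cauchySeq ε hε
  refine ⟨σ (N + σ N + K) - σ N, ?_, ?_⟩
  · have := hσ.id_le (N + σ N + K)
    simp only [id_eq] at this
    omega
  · have h1 := hN (N + σ N + K) (by omega)
    have hle : σ N ≤ σ (N + σ N + K) := hσ.monotone (by omega)
    have h2 : (σ (N + σ N + K) : ℝ) * α =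
        σ N * α + ((σ (N + σ N + K) - σ N : ℕ) : ℝ) * α := by
      rw [Nat.cast_sub hle]; ring
    rw [dist_eq_norm] at h1
    simp only [Function.comp_apply] at h1
    rw [h2, e_add, ← mul_sub_one, norm_mul, norm_e, one_mul] at h1
    exact h1

section Isolated

variable {lam α ω E : ℝ} {H : SeqSpace →L[ℂ] SeqSpace}

lemma IsAlmostMathieu.norm_translate_le (hH : IsAlmostMathieu lam α ω H) {ψ : SeqSpace}
    (hψ : H ψ = (E : ℂ) • ψ) (k : ℕ) :
    ‖H (translate k ψ) - (E : ℂ) • translate k ψ‖ ≤ 2 * |lam| * ‖e (k * α) - 1‖ * ‖ψ‖ := by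
  rw [← norm_translate k ψ]
  refine norm_le_mul_of_forall (by positivity) fun n => ?_
  have h0 : hop lam α ω E ψ (n + k) = 0 := by
    rw [← hH.sub_smul_apply, hψ, sub_self]; rfl
  have hc : ∀ x, (coeff lam E x : ℂ) = E - 2 * lam * (e x).re := fun x => by
    rw [coeff, e_re]; push_cast; ring
  have h1 : hop lam α ω E (translate k ψ) n =
      ((2 * lam * (e (ω + n * α) - e (ω + n * α + k * α)).re : ℝ) : ℂ) * translate k ψ n := by
    have ea : n + 1 + (k : ℤ) = n + k + 1 := by ring
    have eb : n - 1 + (k : ℤ) = n + k - 1 := by ring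
    have ec : ω + ((n + k : ℤ) : ℝ) * α = ω + n * α + k * α := by push_cast; ring
    rw [hop, translate_apply, translate_apply, translate_apply, ea, eb, Complex.sub_re]
    rw [hop, ec, hc] at h0
    rw [hc]
    push_cast
    linear_combination h0
  rw [hH.sub_smul_apply, h1, norm_mul, Complex.norm_real, Real.norm_eq_abs, abs_mul, abs_mul, abs_two]
  gcongr
  refine (Complex.abs_re_le_norm _).trans (le_of_eq ?_)
  rw [e_add _ (k * α), ← mul_one_sub, norm_mul, norm_e, one_mul, norm_sub_rev]

lemma IsAlmostMathieu.eigenvectors_proportional (hH : IsAlmostMathieu lam α ω H) {φ ψ : SeqSpace}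
    (hφ : H φ = (E : ℂ) • φ) (hψ : H ψ = (E : ℂ) • ψ) (hψ0 : ψ ≠ 0) : ∃ c : ℂ, φ = c • ψ := by
  have hsol : ∀ {χ : SeqSpace}, H χ = (E : ℂ) • χ → ∀ n : ℤ,
      χ (n + 1) + χ (n - 1) = (coeff lam E (ω + n * α) : ℂ) * χ n := fun {χ} hχ n => by
    have : hop lam α ω E χ n = 0 := by rw [← hH.sub_smul_apply, hχ, sub_self]; rfl
    exact sub_eq_zero.mp this
  have hW : Tendsto (fun n : ℕ => φ n * ψ (n + 1) - ψ n * φ (n + 1)) atTop (𝓝 0) := by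
    have h0 := fun χ : SeqSpace => tendsto_coord_nat χ 0
    simp only [add_zero] at h0
    simpa using ((h0 φ).mul (tendsto_coord_nat ψ 1)).sub ((h0 ψ).mul (tendsto_coord_nat φ 1))
  have hprop := proportional_of_tendsto (hsol hφ) (hsol hψ) hW
  obtain ⟨n₀, hn₀⟩ : ∃ n, ψ n ≠ 0 := by
    by_contra! h; exact hψ0 (lp.ext (funext h))
  refine ⟨φ n₀ / ψ n₀, lp.ext (funext fun n => ?_)⟩
  rw [lp.coeFn_smul, Pi.smul_apply, smul_eq_mul, div_mul_eq_mul_div, eq_div_iff hn₀]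
  have := hprop n n₀
  linear_combination this

/-- An isolated point of the spectrum of a self-adjoint operator carries a spectral projection. -/
lemma exists_projection_of_isolated {V : Type*} [NormedAddCommGroup V] [InnerProductSpace ℂ V]
    [CompleteSpace V] {T : V →L[ℂ] V} (hT : IsSelfAdjoint T) {E δ : ℝ} (hE : E ∈ spectrum ℝ T)
    (hδ : 0 < δ) (hiso : ∀ x ∈ spectrum ℝ T, |x - E| < δ → x = E) :
    ∃ P G : V →L[ℂ] V, P ≠ 0 ∧ (∀ v, T (P v) = (E : ℂ) • P v) ∧
      ∀ v, v - P v = G (T v - (E : ℂ) • v) := by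
  classical
  have hcont : ∀ {f : ℝ → ℝ}, ContinuousOn f (spectrum ℝ T \ {E}) → ContinuousOn f (spectrum ℝ T) := by
    intro f hf x hx
    by_cases hxE : x = E
    · subst hxE
      refine (continuousWithinAt_const (b := f x)).congr_of_eventuallyEq ?_ rfl
      filter_upwards [self_mem_nhdsWithin, mem_nhdsWithin_of_mem_nhds (Metric.ball_mem_nhds x hδ)]
        with y hy hyδ
      rw [hiso y hy (by simpa [Real.dist_eq] using hyδ)]
    · refine (hf x ⟨hx, hxE⟩).mono_of_mem_nhdsWithin ?_
      rw [Set.sdiff_eq]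
      exact inter_mem_nhdsWithin _ (isOpen_compl_singleton.mem_nhds hxE)
  have hf : ContinuousOn (fun x => if x = E then (1 : ℝ) else 0) (spectrum ℝ T) :=
    hcont (continuousOn_const.congr (f := fun _ => 0) fun x hx => if_neg hx.2)
  have hg : ContinuousOn (fun x => (x - E)⁻¹) (spectrum ℝ T) :=
    hcont (ContinuousOn.inv₀ (by fun_prop) fun x hx => sub_ne_zero.mpr hx.2)
  have hid : cfc (fun x : ℝ => x - E) T = T - algebraMap ℝ _ E := by
    rw [cfc_sub (fun x : ℝ => x) (fun _ => E) T, cfc_id' ℝ T, cfc_const E T]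
  have hidv : ∀ v, (T - algebraMap ℝ (V →L[ℂ] V) E) v = T v - (E : ℂ) • v := fun v => by
    rw [Algebra.algebraMap_eq_smul_one]; rfl
  refine ⟨cfc (fun x => if x = E then (1 : ℝ) else 0) T, cfc (fun x => (x - E)⁻¹) T, fun h0 => ?_,
    fun v => ?_, fun v => ?_⟩
  · rw [← cfc_zero ℝ T] at h0
    have := eqOn_of_cfc_eq_cfc h0 hf continuousOn_const hT hE
    simp at this
  · have h1 : (T - algebraMap ℝ (V →L[ℂ] V) E) * cfc (fun x => if x = E then (1 : ℝ) else 0) T = 0 := by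
      rw [← hid, ← cfc_mul _ _ T (by fun_prop) hf, ← cfc_zero ℝ T]
      refine cfc_congr fun x _ => ?_
      by_cases hx : x = E <;> simp [hx]
    have h2 := DFunLike.congr_fun h1 v
    rw [mul_apply_eq_comp, hidv] at h2
    exact sub_eq_zero.mp h2
  · have h1 : cfc (fun x => (x - E)⁻¹) T * (T - algebraMap ℝ (V →L[ℂ] V) E) =
        1 - cfc (fun x => if x = E then (1 : ℝ) else 0) T := by
      rw [← hid, ← cfc_mul _ _ T hg (by fun_prop), ← cfc_one ℝ T, ← cfc_sub _ _ T (by fun_prop) hf]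
      refine cfc_congr fun x _ => ?_
      by_cases hx : x = E
      · simp [hx]
      · simp [hx, inv_mul_cancel₀ (sub_ne_zero.mpr hx)]
    have h2 := DFunLike.congr_fun h1 v
    rw [mul_apply_eq_comp, hidv] at h2
    exact h2.symm

/-- The spectrum of the almost Mathieu operator has no isolated points. -/
theorem IsAlmostMathieu.not_isolated (hH : IsAlmostMathieu lam α ω H) (hE : E ∈ spectrum ℝ H)
    {δ : ℝ} (hδ : 0 < δ) : ∃ x ∈ spectrum ℝ H, |x - E| < δ ∧ x ≠ E := by
  by_contra! hiso
  obtain ⟨P, G, hP0, hP, hG⟩ := exists_projection_of_isolated hH.isSelfAdjoint hE hδ hiso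
  obtain ⟨v, hv⟩ : ∃ v, P v ≠ 0 := by
    by_contra! h; exact hP0 (ContinuousLinearMap.ext h)
  set ψ := P v with hψ
  have hψE : H ψ = (E : ℂ) • ψ := hP v
  choose k hk hkε using fun j : ℕ => exists_return α j (ε := 1 / ((j : ℝ) + 1)) (by positivity)
  choose c hc using fun j : ℕ => hH.eigenvectors_proportional (hP (translate (k j) ψ)) hψE hv
  have hret : Tendsto (fun j => ‖e (k j * α) - 1‖) atTop (𝓝 0) :=
    squeeze_zero (fun _ => norm_nonneg _) (fun j => (hkε j).le) tendsto_one_div_add_atTop_nhds_zero_nat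
  have hdiff : Tendsto (fun j => ‖translate (k j) ψ - c j • ψ‖) atTop (𝓝 0) := by
    refine squeeze_zero (fun _ => norm_nonneg _) (fun j => ?_)
      (g := fun j => ‖G‖ * (2 * |lam| * ‖e (k j * α) - 1‖ * ‖ψ‖)) ?_
    · rw [← hc, hG]
      exact (G.le_opNorm _).trans (mul_le_mul_of_nonneg_left (hH.norm_translate_le hψE _)
        (norm_nonneg _))
    · simpa using ((hret.const_mul (2 * |lam|)).mul_const ‖ψ‖).const_mul ‖G‖
  obtain ⟨n₀, hn₀⟩ : ∃ n, ψ n ≠ 0 := by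
    by_contra! h; exact hv (lp.ext (funext h))
  have hkinf : Tendsto k atTop atTop := tendsto_atTop_mono hk tendsto_id
  have h1 : Tendsto (fun j => ψ (n₀ + k j)) atTop (𝓝 0) := by
    have := (tendsto_coord_nat ψ n₀).comp hkinf
    refine this.congr fun j => ?_
    simp only [Function.comp_apply, add_comm]
  have h2 : Tendsto (fun j => ψ (n₀ + k j) - c j * ψ n₀) atTop (𝓝 0) := by
    refine squeeze_zero_norm (fun j => ?_) hdiff
    exact lp.norm_apply_le_norm two_ne_zero (translate (k j) ψ - c j • ψ) n₀
  have hc0 : Tendsto c atTop (𝓝 0) := by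
    have := (h1.sub h2).mul_const (ψ n₀)⁻¹
    simpa [hn₀] using this
  have hlim : Tendsto (fun j => ‖translate (k j) ψ - c j • ψ‖ + ‖c j • ψ‖) atTop (𝓝 (0 + 0)) := by
    refine hdiff.add ?_
    simpa using (hc0.smul_const ψ).norm
  have hbound : ‖ψ‖ ≤ 0 + 0 := ge_of_tendsto' hlim fun j => by
    have := norm_sub_norm_le (translate (k j) ψ) (c j • ψ)
    rw [norm_translate] at this
    linarith
  rw [add_zero] at hbound
  exact hv (norm_le_zero_iff.mp hbound)

end Isolated

theorem IsAlmostMathieu.cantor {lam α ω c r : ℝ} {H : SeqSpace →L[ℂ] SeqSpace}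
    (hAM : IsAlmostMathieu lam α ω H) (hα : Irrational α) (hc : 0 < c) (hr : 0 < r)
    (hsin : SinLower α c r) (hlam : 0 < lam) (hlam1 : lam ≠ 1) :
    IsClosed {E : ℝ | (E : ℂ) ∈ spectrum ℂ H} ∧
    (∀ E : ℝ, (E : ℂ) ∈ spectrum ℂ H →
      E ∈ closure ({x : ℝ | (x : ℂ) ∈ spectrum ℂ H} \ {E})) ∧
    interior {E : ℝ | (E : ℂ) ∈ spectrum ℂ H} = ∅ := by
  have hspec : ∀ x : ℝ, (x : ℂ) ∈ spectrum ℂ H ↔ x ∈ spectrum ℝ H := fun x => by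
    rw [← spectrum.algebraMap_mem_iff (R := ℝ) ℂ, Complex.coe_algebraMap]
  refine ⟨(spectrum.isClosed H).preimage Complex.continuous_ofReal, fun E hE => ?_, ?_⟩
  · rw [Metric.mem_closure_iff]
    intro δ hδ
    obtain ⟨x, hx, hxδ, hxE⟩ := hAM.not_isolated ((hspec E).mp hE) hδ
    have hdist : dist E x < δ := by rwa [dist_comm, Real.dist_eq]
    have hmem : x ∈ {y : ℝ | (y : ℂ) ∈ spectrum ℂ H} := (hspec x).mpr hx
    exact ⟨x, ⟨hmem, hxE⟩, hdist⟩
  · rw [Set.eq_empty_iff_forall_notMem]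
    intro E hE
    obtain ⟨δ, hδ, hball⟩ := Metric.mem_nhds_iff.mp (mem_interior_iff_mem_nhds.mp hE)
    obtain ⟨x, hx, hnot⟩ := not_approxSpec_Ioo (ω := ω) hα hc hr hsin hlam hlam1
      (show E - δ < E + δ by linarith)
    rw [← Real.ball_eq_Ioo] at hx
    exact hnot (hAM.approxSpec (hball hx))

end AlmostMathieu

lemma IsDiophantine.exists_sinLower {α : ℝ} (hα : IsDiophantine α) :
    ∃ c r : ℝ, 0 < c ∧ 0 < r ∧ AlmostMathieu.SinLower α c r := by
  obtain ⟨-, c, hc, r, hr, h⟩ := hα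
  refine ⟨c / 2, r, half_pos hc, by linarith, fun n hn => ?_⟩
  have h1 := (h n hn).le
  have h2 : 2 * Real.pi * n * α = 2 * (Real.pi * (n * α)) := by ring
  rw [h2, Real.sin_two_mul, abs_mul, abs_mul, abs_two] at h1
  have h3 := mul_le_mul_of_nonneg_left (Real.abs_cos_le_one (Real.pi * (n * α)))
    (show 0 ≤ 2 * |Real.sin (Real.pi * (n * α))| by positivity)
  rw [div_right_comm]
  linarith

/-- Puig: for Diophantine `α` and coupling `λ > 0`, `λ ≠ 1`, the (real) spectrum of the
almost Mathieu operator `(Hψ)(n) = ψ(n+1) + ψ(n−1) + 2λ cos(2π(ω + nα))ψ(n)` on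
`ℓ²(ℤ, ℂ)` is a Cantor set: closed, without isolated points, and with empty interior. -/
theorem puig_cantor_spectrum (lam α ω : ℝ) (hlam : 0 < lam) (hlam1 : lam ≠ 1)
    (hα : IsDiophantine α)
    (H : lp (fun _ : ℤ => ℂ) 2 →L[ℂ] lp (fun _ : ℤ => ℂ) 2)
    (hH : ∀ (ψ : lp (fun _ : ℤ => ℂ) 2) (n : ℤ),
      (H ψ) n = ψ (n + 1) + ψ (n - 1) +
        (↑(2 * lam * Real.cos (2 * Real.pi * (ω + n * α))) : ℂ) * ψ n) :
    IsClosed {E : ℝ | (E : ℂ) ∈ spectrum ℂ H} ∧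
    (∀ E : ℝ, (E : ℂ) ∈ spectrum ℂ H →
      E ∈ closure ({x : ℝ | (x : ℂ) ∈ spectrum ℂ H} \ {E})) ∧
    interior {E : ℝ | (E : ℂ) ∈ spectrum ℂ H} = ∅ := by
  have hAM : AlmostMathieu.IsAlmostMathieu lam α ω H := hH
  obtain ⟨c, r, hc, hr, hsin⟩ := hα.exists_sinLower
  exact hAM.cantor hα.1 hc hr hsin hlam hlam1
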